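/- (Global boundedness, critical case, coercive potential.) Assume condition (D), condition (H₂), and that V ∈ L¹_loc(ℝ^N) satisfies ess inf_{ℝ^N} V > 0. Then every u ∈ C¹(ℝ^N) with ρ_V(u) < ∞ which satisfies, for every φ ∈ C_c^∞(ℝ^N), ∫_{ℝ^N} 𝒜(x,u,∇u)·∇φ dx + ∫_{ℝ^N} V(x)(|u|^{p(x)−2}u + a(x)|u|^{q(x)−2}u) φ dx = ∫_{ℝ^N} ℬ(x,u,∇u) φ dx, belongs to L^∞(ℝ^N). -/

import Mathlib

open MeasureTheory Filter
open scoped ENNReal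

/-- The double phase integrand `H(x,t) = t^{p(x)} + a(x) t^{q(x)}`. -/
noncomputable def Hfun {N : ℕ} (p q a : EuclideanSpace ℝ (Fin N) → ℝ)
    (x : EuclideanSpace ℝ (Fin N)) (t : ℝ) : ℝ :=
  t ^ p x + a x * t ^ q x

/-- The modular `ρ_V(u) = ∫_{ℝ^N} [H(x,|∇u|) + V(x) H(x,|u|)] dx`. -/
noncomputable def rhoV {N : ℕ} (p q a V : EuclideanSpace ℝ (Fin N) → ℝ)
    (u : EuclideanSpace ℝ (Fin N) → ℝ) : ℝ≥0∞ :=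
  ∫⁻ x, (ENNReal.ofReal (Hfun p q a x ‖gradient u x‖) +
    ENNReal.ofReal (V x * Hfun p q a x |u x|))

/-- The Luxemburg norm `‖u‖ = inf {τ > 0 : ρ_V(u/τ) ≤ 1}` associated with `ρ_V`. -/
noncomputable def VNorm {N : ℕ} (p q a V : EuclideanSpace ℝ (Fin N) → ℝ)
    (u : EuclideanSpace ℝ (Fin N) → ℝ) : ℝ :=
  sInf {τ : ℝ | 0 < τ ∧
    (∫⁻ x, (ENNReal.ofReal (Hfun p q a x (‖gradient u x‖ / τ)) +
      ENNReal.ofReal (V x * Hfun p q a x (|u x| / τ)))) ≤ 1}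

/-- The Luxemburg norm `‖u‖_{L^Φ(U)}` of a Musielak integrand `Φ` on a set `U`. -/
noncomputable def luxNormOn {N : ℕ} (Φ : EuclideanSpace ℝ (Fin N) → ℝ → ℝ)
    (U : Set (EuclideanSpace ℝ (Fin N))) (u : EuclideanSpace ℝ (Fin N) → ℝ) : ℝ :=
  sInf {τ : ℝ | 0 < τ ∧ (∫⁻ x in U, ENNReal.ofReal (Φ x (|u x| / τ))) ≤ 1}

/-- The Sobolev Luxemburg norm `‖u‖_{W^{1,H}(U)}`. -/
noncomputable def sobNormOn {N : ℕ} (p q a : EuclideanSpace ℝ (Fin N) → ℝ)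
    (U : Set (EuclideanSpace ℝ (Fin N))) (u : EuclideanSpace ℝ (Fin N) → ℝ) : ℝ :=
  sInf {τ : ℝ | 0 < τ ∧
    (∫⁻ x in U, (ENNReal.ofReal (Hfun p q a x (‖gradient u x‖ / τ)) +
      ENNReal.ofReal (Hfun p q a x (|u x| / τ)))) ≤ 1}

/-- The open cube `Q_{y,ε}` centered at `y` with edges parallel to the axes of length `ε`. -/
def cube {N : ℕ} (y : EuclideanSpace ℝ (Fin N)) (ε : ℝ) : Set (EuclideanSpace ℝ (Fin N)) :=
  {x | ∀ i, |x i - y i| < ε / 2}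

/-- Condition (D): `p, q` bounded Lipschitz with `1 < inf p`, `sup q < N`,
`p < q < N` pointwise, `sup q/p < 1 + 1/N`; `a ≥ 0` bounded Lipschitz. -/
structure CondD (N : ℕ) (p q a : EuclideanSpace ℝ (Fin N) → ℝ) : Prop where
  lip_p : ∃ K : NNReal, LipschitzWith K p
  lip_q : ∃ K : NNReal, LipschitzWith K q
  lip_a : ∃ K : NNReal, LipschitzWith K a
  inf_p : ∃ c > (1 : ℝ), ∀ x, c ≤ p x
  sup_q : ∃ c < (N : ℝ), ∀ x, q x ≤ c
  p_lt_q : ∀ x, p x < q x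
  q_lt_N : ∀ x, q x < N
  ratio : ∃ c < 1 + 1 / (N : ℝ), ∀ x, q x / p x ≤ c
  a_nonneg : ∀ x, 0 ≤ a x
  a_bdd : ∃ C : ℝ, ∀ x, a x ≤ C

section Mollification

open scoped Topology Convolution ContDiff
open ContinuousLinearMap (lsmul)

variable {E : Type*} [NormedAddCommGroup E] [InnerProductSpace ℝ E] [FiniteDimensional ℝ E]
  [MeasurableSpace E] [BorelSpace E]

/-- The derivative of the mollification of a Lipschitz function is the mollification of its
almost everywhere derivative. -/
theorem ContDiffBump.hasFDerivAt_normed_convolution_of_lipschitz (μ : Measure E)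
    [μ.IsAddHaarMeasure] (φ : ContDiffBump (0 : E)) {f : E → ℝ} {K : NNReal}
    (hf : LipschitzWith K f) (x : E) :
    HasFDerivAt (φ.normed μ ⋆[lsmul ℝ ℝ, μ] f)
      ((φ.normed μ ⋆[lsmul ℝ ℝ, μ] (fderiv ℝ f)) x) x := by
  have hdiff : ∀ᵐ t ∂μ, DifferentiableAt ℝ f (x - t) :=
    (Measure.measurePreserving_sub_left μ x).quasiMeasurePreserving.ae
      hf.ae_differentiableAt
  have key := hasFDerivAt_integral_of_dominated_loc_of_lip (μ := μ) (x₀ := x)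
    (F := fun z t => φ.normed μ t • f (z - t))
    (F' := fun t => φ.normed μ t • fderiv ℝ f (x - t))
    (bound := fun t => φ.normed μ t * K) (s := Set.univ) Filter.univ_mem ?_ ?_ ?_ ?_ ?_ ?_
  · exact key.2
  · refine Eventually.of_forall fun z => Continuous.aestronglyMeasurable ?_
    exact φ.continuous_normed.smul (hf.continuous.comp (continuous_const.sub continuous_id))
  · refine Continuous.integrable_of_hasCompactSupport ?_ ?_
    · exact φ.continuous_normed.smul (hf.continuous.comp (continuous_const.sub continuous_id))
    · exact φ.hasCompactSupport_normed.smul_right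
  · refine φ.continuous_normed.aestronglyMeasurable.smul ?_
    exact ((measurable_fderiv ℝ f).comp (measurable_const.sub measurable_id)).aestronglyMeasurable
  · refine Eventually.of_forall fun t => ?_
    rw [lipschitzOnWith_univ]
    refine LipschitzWith.of_dist_le_mul fun z z' => ?_
    have h1 : dist (f (z - t)) (f (z' - t)) ≤ K * dist z z' := by
      simpa using hf.dist_le_mul (z - t) (z' - t)
    have h0 := φ.nonneg_normed (μ := μ) t
    rw [dist_smul₀, Real.norm_of_nonneg h0, Real.coe_nnabs, abs_of_nonneg (by positivity), mul_assoc]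
    exact mul_le_mul_of_nonneg_left h1 h0
  · exact φ.integrable_normed.mul_const _
  · filter_upwards [hdiff] with t ht
    have h2 : HasFDerivAt (fun z => f (z - t)) (fderiv ℝ f (x - t)) x := by
      simpa [Function.comp_def] using ht.hasFDerivAt.comp x ((hasFDerivAt_id x).sub_const t)
    exact h2.fun_const_smul _

/-- A compactly supported Lipschitz function is a limit of smooth functions, with supports in a
common compact set, with the same Lipschitz bound, and whose derivatives converge almost
everywhere. -/
theorem LipschitzWith.exists_smooth_approx (μ : Measure E) [μ.IsAddHaarMeasure]
    {f : E → ℝ} {K : NNReal} (hf : LipschitzWith K f) (hc : HasCompactSupport f) :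
    ∃ g : ℕ → E → ℝ, ∃ S : Set E, ∃ M : ℝ, IsCompact S ∧ (∀ n, ContDiff ℝ ∞ (g n)) ∧
      (∀ n, ∀ x ∉ S, g n x = 0) ∧ (∀ n x, |g n x| ≤ M) ∧ (∀ n x, ‖fderiv ℝ (g n) x‖ ≤ K) ∧
      (∀ x, Tendsto (fun n => g n x) atTop (𝓝 (f x))) ∧
      ∀ᵐ x ∂μ, Tendsto (fun n => fderiv ℝ (g n) x) atTop (𝓝 (fderiv ℝ f x)) := by
  let φ : ℕ → ContDiffBump (0 : E) := fun n =>
    ⟨1 / (n + 1) / 2, 1 / (n + 1), by positivity, half_lt_self (by positivity)⟩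
  have hφout : ∀ n, (φ n).rOut = 1 / ((n : ℝ) + 1) := fun n => rfl
  have hφin : ∀ n, (φ n).rIn = 1 / ((n : ℝ) + 1) / 2 := fun n => rfl
  have hout1 : ∀ n, (φ n).rOut ≤ 1 := fun n => by
    rw [hφout, div_le_one (by positivity)]; linarith [(Nat.cast_nonneg n : (0 : ℝ) ≤ n)]
  have hφ0 : Tendsto (fun n => (φ n).rOut) atTop (𝓝 0) := by
    simp only [hφout]; exact tendsto_one_div_add_atTop_nhds_zero_nat
  obtain ⟨M0, hM0⟩ := hc.exists_bound_of_continuous hf.continuous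
  have hclose : ∀ n x, dist (((φ n).normed μ ⋆[lsmul ℝ ℝ, μ] f) x) (f x) ≤ K := fun n x => by
    refine (φ n).dist_normed_convolution_le hf.continuous.aestronglyMeasurable fun z hz => ?_
    refine (hf.dist_le_mul z x).trans ?_
    have : dist z x ≤ 1 := (Metric.mem_ball.1 hz).le.trans (hout1 n)
    exact mul_le_of_le_one_right K.2 this
  have hder := fun n x => (φ n).hasFDerivAt_normed_convolution_of_lipschitz μ hf x
  have hloc : LocallyIntegrable (fderiv ℝ f) μ := by
    refine (locallyIntegrable_const (K : ℝ)).mono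
      (measurable_fderiv ℝ f).aestronglyMeasurable (Eventually.of_forall fun x => ?_)
    simpa using norm_fderiv_le_of_lipschitz ℝ hf
  refine ⟨fun n => (φ n).normed μ ⋆[lsmul ℝ ℝ, μ] f, Metric.cthickening 1 (tsupport f), M0 + K,
    hc.isCompact.cthickening, fun n => ?_, fun n x hx => ?_, fun n x => ?_, fun n x => ?_,
    fun x => ?_, ?_⟩
  · exact (φ n).hasCompactSupport_normed.contDiff_convolution_left _ (φ n).contDiff_normed
      hf.continuous.locallyIntegrable
  · have h0 : ∀ z ∈ Metric.ball x (φ n).rOut, f z = 0 := fun z hz => by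
      by_contra h
      refine hx (Metric.mem_cthickening_of_dist_le x z 1 _ (subset_tsupport f h) ?_)
      rw [dist_comm]
      exact (Metric.mem_ball.1 hz).le.trans (hout1 n)
    have hx0 := h0 x (Metric.mem_ball_self (φ n).rOut_pos)
    exact ((φ n).normed_convolution_eq_right fun z hz => (h0 z hz).trans hx0.symm).trans hx0
  · have h1 := hclose n x
    have h2 := hM0 x
    rw [Real.dist_eq, abs_le] at h1
    rw [Real.norm_eq_abs, abs_le] at h2
    rw [abs_le]
    constructor <;> linarith
  · rw [(hder n x).fderiv]
    have h0 := fun t => (φ n).nonneg_normed (μ := μ) t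
    calc ‖((φ n).normed μ ⋆[lsmul ℝ ℝ, μ] (fderiv ℝ f)) x‖
        ≤ ∫ t, (φ n).normed μ t * K ∂μ := by
          refine norm_integral_le_of_norm_le ((φ n).integrable_normed.mul_const _)
            (Eventually.of_forall fun t => ?_)
          rw [ContinuousLinearMap.lsmul_apply, norm_smul, Real.norm_of_nonneg (h0 t)]
          exact mul_le_mul_of_nonneg_left (norm_fderiv_le_of_lipschitz ℝ hf) (h0 t)
      _ = K := by rw [integral_mul_const, (φ n).integral_normed, one_mul]
  · exact ContDiffBump.convolution_tendsto_right_of_continuous hφ0 hf.continuous x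
  · filter_upwards [ContDiffBump.ae_convolution_tendsto_right_of_locallyIntegrable (K := 2) hφ0
      (Eventually.of_forall fun n => by rw [hφout, hφin]; linarith) hloc] with x hx
    simpa only [fun n => (hder n x).fderiv] using hx

/-- The `L¹` Gagliardo–Nirenberg–Sobolev inequality for compactly supported Lipschitz
functions. -/
theorem LipschitzWith.lintegral_pow_le_pow_lintegral_fderiv (μ : Measure E) [μ.IsAddHaarMeasure]
    {f : E → ℝ} {K : NNReal} (hf : LipschitzWith K f) (hc : HasCompactSupport f) {r : ℝ}
    (hr : Real.HolderConjugate (Module.finrank ℝ E) r) :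
    ∫⁻ x, ‖f x‖ₑ ^ r ∂μ ≤
      lintegralPowLePowLIntegralFDerivConst μ r * (∫⁻ x, ‖fderiv ℝ f x‖ₑ ∂μ) ^ r := by
  obtain ⟨g, S, M, hS, hg, hg0, hgM, hgK, hglim, hglim'⟩ := hf.exists_smooth_approx μ hc
  have hr0 : 0 < r := hr.symm.pos
  have hgc : ∀ n, HasCompactSupport (g n) := fun n => HasCompactSupport.intro hS (hg0 n)
  have hg0' : ∀ n, ∀ x ∉ S, fderiv ℝ (g n) x = 0 := fun n x hx => by
    have : (g n) =ᶠ[𝓝 x] fun _ => (0 : ℝ) := by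
      filter_upwards [hS.isClosed.isOpen_compl.mem_nhds hx] with z hz using hg0 n z hz
    rw [this.fderiv_eq, fderiv_fun_const]; rfl
  have hSfin : μ S ≠ ⊤ := hS.measure_lt_top.ne
  have h1 : Tendsto (fun n => ∫⁻ x, ‖g n x‖ₑ ^ r ∂μ) atTop (𝓝 (∫⁻ x, ‖f x‖ₑ ^ r ∂μ)) := by
    refine tendsto_lintegral_of_dominated_convergence
      (S.indicator fun _ => ENNReal.ofReal M ^ r) (fun n => ?_) (fun n => ?_) ?_ ?_
    · exact ((hg n).continuous.enorm.measurable).pow_const _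
    · refine Eventually.of_forall fun x => ?_
      by_cases hx : x ∈ S
      · simp only [Set.indicator_of_mem hx]
        gcongr
        rw [← ofReal_norm]
        exact ENNReal.ofReal_le_ofReal (hgM n x)
      · simp [hx, hg0 n x hx, hr0]
    · rw [lintegral_indicator hS.measurableSet, lintegral_const]
      exact ENNReal.mul_ne_top (by finiteness) (by simpa using hSfin)
    · exact Eventually.of_forall fun x =>
        (ENNReal.continuous_rpow_const.tendsto _).comp ((hglim x).enorm)
  have h2 : Tendsto (fun n => ∫⁻ x, ‖fderiv ℝ (g n) x‖ₑ ∂μ) atTop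
      (𝓝 (∫⁻ x, ‖fderiv ℝ f x‖ₑ ∂μ)) := by
    refine tendsto_lintegral_of_dominated_convergence
      (S.indicator fun _ => ENNReal.ofReal K) (fun n => ?_) (fun n => ?_) ?_ ?_
    · exact (measurable_fderiv ℝ (g n)).enorm
    · refine Eventually.of_forall fun x => ?_
      by_cases hx : x ∈ S
      · simp only [Set.indicator_of_mem hx]
        rw [← ofReal_norm]
        exact ENNReal.ofReal_le_ofReal (hgK n x)
      · have h0 : ‖fderiv ℝ (g n) x‖ = 0 := by rw [hg0' n x hx]; exact norm_zero
        simp only [Set.indicator_of_notMem hx]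
        rw [← ofReal_norm, h0, ENNReal.ofReal_zero]
    · rw [lintegral_indicator hS.measurableSet, lintegral_const]
      exact ENNReal.mul_ne_top (by finiteness) (by simpa using hSfin)
    · filter_upwards [hglim'] with x hx using hx.enorm
  have h3 := (ENNReal.continuous_rpow_const (y := r)).tendsto _ |>.comp h2
  refine le_of_tendsto_of_tendsto' h1 (ENNReal.Tendsto.const_mul h3 (Or.inr ENNReal.coe_ne_top))
    fun n => ?_
  exact MeasureTheory.lintegral_pow_le_pow_lintegral_fderiv μ
    ((hg n).of_le (by exact_mod_cast le_top)) (hgc n) hr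

/-- A linear identity tested against smooth compactly supported functions extends to Lipschitz
compactly supported functions. -/
theorem LipschitzWith.integral_inner_gradient_add_integral_mul_eq_zero (μ : Measure E)
    [μ.IsAddHaarMeasure] {F : E → E} {G : E → ℝ} (hF : LocallyIntegrable F μ)
    (hG : LocallyIntegrable G μ)
    (h : ∀ φ : E → ℝ, ContDiff ℝ ∞ φ → HasCompactSupport φ →
      (∫ x, inner ℝ (F x) (gradient φ x) ∂μ) + ∫ x, G x * φ x ∂μ = 0)
    {f : E → ℝ} {K : NNReal} (hf : LipschitzWith K f) (hc : HasCompactSupport f) :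
    (∫ x, inner ℝ (F x) (gradient f x) ∂μ) + ∫ x, G x * f x ∂μ = 0 := by
  obtain ⟨g, S, M, hS, hg, hg0, hgM, hgK, hglim, hglim'⟩ := hf.exists_smooth_approx μ hc
  have hgc : ∀ n, HasCompactSupport (g n) := fun n => HasCompactSupport.intro hS (hg0 n)
  have hg0' : ∀ n, ∀ x ∉ S, fderiv ℝ (g n) x = 0 := fun n x hx => by
    have : (g n) =ᶠ[𝓝 x] fun _ => (0 : ℝ) := by
      filter_upwards [hS.isClosed.isOpen_compl.mem_nhds hx] with z hz using hg0 n z hz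
    rw [this.fderiv_eq, fderiv_fun_const]; rfl
  have hgrad : ∀ (φ : E → ℝ) x, ‖gradient φ x‖ = ‖fderiv ℝ φ x‖ := fun φ x => by
    simp [gradient]
  have hgm : ∀ φ : E → ℝ, Measurable (gradient φ) := fun φ =>
    (LinearIsometryEquiv.continuous _).measurable.comp (measurable_fderiv ℝ φ)
  have h1 : Tendsto (fun n => ∫ x, inner ℝ (F x) (gradient (g n) x) ∂μ) atTop
      (𝓝 (∫ x, inner ℝ (F x) (gradient f x) ∂μ)) := by
    refine tendsto_integral_of_dominated_convergence (S.indicator fun x => ‖F x‖ * K)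
      (fun n => ?_) ?_ (fun n => Eventually.of_forall fun x => ?_) ?_
    · exact hF.aestronglyMeasurable.inner (hgm (g n)).aestronglyMeasurable
    · rw [integrable_indicator_iff hS.measurableSet]
      exact (hF.integrableOn_isCompact hS).norm.mul_const _
    · by_cases hx : x ∈ S
      · simp only [Set.indicator_of_mem hx]
        refine (norm_inner_le_norm _ _).trans ?_
        rw [hgrad]
        exact mul_le_mul_of_nonneg_left (hgK n x) (norm_nonneg _)
      · have : gradient (g n) x = 0 := by rw [← norm_eq_zero, hgrad, hg0' n x hx, norm_zero]
        simp [hx, this]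
    · filter_upwards [hglim'] with x hx
      refine Tendsto.inner tendsto_const_nhds ?_
      exact ((LinearIsometryEquiv.continuous _).tendsto _).comp hx
  have h2 : Tendsto (fun n => ∫ x, G x * g n x ∂μ) atTop (𝓝 (∫ x, G x * f x ∂μ)) := by
    refine tendsto_integral_of_dominated_convergence (S.indicator fun x => ‖G x‖ * M)
      (fun n => ?_) ?_ (fun n => Eventually.of_forall fun x => ?_) ?_
    · exact hG.aestronglyMeasurable.mul (hg n).continuous.aestronglyMeasurable
    · rw [integrable_indicator_iff hS.measurableSet]
      exact (hG.integrableOn_isCompact hS).norm.mul_const _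
    · by_cases hx : x ∈ S
      · simp only [Set.indicator_of_mem hx]
        rw [norm_mul]
        exact mul_le_mul_of_nonneg_left (hgM n x) (norm_nonneg _)
      · simp [hx, hg0 n x hx]
    · exact Eventually.of_forall fun x => tendsto_const_nhds.mul (hglim x)
  have h3 := h1.add h2
  simp only [fun n => h (g n) (hg n) (hgc n)] at h3
  exact tendsto_nhds_unique h3 tendsto_const_nhds

end Mollification

section RealInequalities

/-- Young's inequality with a parameter. -/
theorem Real.rpow_sub_one_mul_le_add {s A B ε : ℝ} (hs : 1 < s) (hA : 0 ≤ A) (hB : 0 ≤ B)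
    (hε : 0 < ε) : A ^ (s - 1) * B ≤ ε * A ^ s + ε ^ (-(s - 1)) * B ^ s := by
  have h1 : ∀ x : ℝ, 0 ≤ x → x ^ (s - 1) * x = x ^ s := fun x hx => by
    rcases hx.eq_or_lt with rfl | hx
    · rw [mul_zero, Real.zero_rpow (by linarith)]
    · rw [← Real.rpow_add_one hx.ne', sub_add_cancel]
  rcases le_total B (ε * A) with h | h
  · calc A ^ (s - 1) * B ≤ A ^ (s - 1) * (ε * A) := by gcongr
      _ = ε * A ^ s := by rw [← h1 A hA]; ring
      _ ≤ _ := le_add_of_nonneg_right (by positivity)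
  · have h2 : A ≤ ε⁻¹ * B := by
      rw [inv_mul_eq_div, le_div_iff₀ hε]; linarith
    calc A ^ (s - 1) * B ≤ (ε⁻¹ * B) ^ (s - 1) * B := by
          gcongr
      _ = ε ^ (-(s - 1)) * B ^ s := by
          rw [Real.mul_rpow (by positivity) hB, Real.inv_rpow hε.le, Real.rpow_neg hε.le, mul_assoc,
            h1 B hB]
      _ ≤ _ := le_add_of_nonneg_left (by positivity)

theorem Real.rpow_sub_one_mul_le_add_of_le {s S A B ε : ℝ} (hs : 1 < s) (hS : s - 1 ≤ S)
    (hA : 0 ≤ A) (hB : 0 ≤ B) (hε : 0 < ε) (hε1 : ε ≤ 1) :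
    A ^ (s - 1) * B ≤ ε * A ^ s + ε ^ (-S) * B ^ s := by
  refine (Real.rpow_sub_one_mul_le_add hs hA hB hε).trans ?_
  have : ε ^ (-(s - 1)) ≤ ε ^ (-S) := Real.rpow_le_rpow_of_exponent_ge hε hε1 (by linarith)
  gcongr

theorem Real.rpow_one_sub_mul_rpow_le_add {X Z θ : ℝ} (hX : 0 ≤ X) (hZ : 0 ≤ Z) (h0 : 0 ≤ θ)
    (h1 : θ ≤ 1) : X ^ (1 - θ) * Z ^ θ ≤ X + Z := by
  have hm : 0 ≤ max X Z := hX.trans (le_max_left _ _)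
  calc X ^ (1 - θ) * Z ^ θ ≤ (max X Z) ^ (1 - θ) * (max X Z) ^ θ := by
        gcongr
        · exact le_max_left _ _
        · exact le_max_right _ _
    _ = max X Z := by
        rw [← Real.rpow_add_of_nonneg hm (by linarith) h0, sub_add_cancel, Real.rpow_one]
    _ ≤ X + Z := max_le (by linarith) (by linarith)

theorem Real.abs_log_le_inv_of_le_one {x : ℝ} (hx : 0 < x) (h1 : x ≤ 1) : |Real.log x| ≤ x⁻¹ := by
  rw [abs_of_nonpos (Real.log_nonpos hx.le h1), ← Real.log_inv]
  linarith [Real.log_le_sub_one_of_pos (inv_pos.2 hx)]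

theorem Real.abs_log_le_div_of_le {x A : ℝ} (hx : 0 < x) (hA : x ≤ A) :
    |Real.log x| ≤ (1 + A ^ 2) / x := by
  rcases le_total x 1 with h | h
  · refine (Real.abs_log_le_inv_of_le_one hx h).trans ?_
    rw [inv_eq_one_div]
    gcongr
    nlinarith
  · rw [abs_of_nonneg (Real.log_nonneg h), le_div_iff₀ hx]
    have h1 := Real.log_le_sub_one_of_pos hx
    have h2 := Real.log_nonneg h
    nlinarith

theorem Real.rpow_mul_abs_log_le {t a d A : ℝ} (ht : 0 < t) (htA : t ≤ A) (ha : 1 ≤ a)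
    (had : a ≤ d) : t ^ a * |Real.log t| ≤ (1 + A) ^ (d + 1) := by
  have hA : 0 < A := ht.trans_le htA
  rcases le_total t 1 with h | h
  · calc t ^ a * |Real.log t| ≤ t ^ (1 : ℝ) * t⁻¹ :=
          mul_le_mul (Real.rpow_le_rpow_of_exponent_ge ht h ha)
            (Real.abs_log_le_inv_of_le_one ht h) (abs_nonneg _) (by positivity)
      _ = 1 := by rw [Real.rpow_one, mul_inv_cancel₀ ht.ne']
      _ ≤ _ := Real.one_le_rpow (by linarith) (by linarith)
  · rw [abs_of_nonneg (Real.log_nonneg h), Real.rpow_add_one (by linarith)]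
    have h2 : Real.log t ≤ 1 + A := by linarith [Real.log_le_sub_one_of_pos ht]
    have h3 : t ^ a ≤ (1 + A) ^ d :=
      (Real.rpow_le_rpow ht.le (by linarith) (by linarith)).trans
        (Real.rpow_le_rpow_of_exponent_le (by linarith) had)
    exact mul_le_mul h3 h2 (Real.log_nonneg h) (by positivity)

theorem Real.abs_rpow_sub_rpow_le {s t a b d A : ℝ} (hs : 0 ≤ s) (hsA : s ≤ A) (ht : 0 ≤ t)
    (htA : t ≤ A) (ha : 1 ≤ a) (had : a ≤ d) (hb : 1 ≤ b) (hbd : b ≤ d) :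
    |s ^ a - t ^ b| ≤ d * (1 + A) ^ d * |s - t| + (1 + A) ^ (d + 1) * |a - b| := by
  have hA : 0 ≤ A := hs.trans hsA
  have h1 : |s ^ a - t ^ a| ≤ d * (1 + A) ^ d * |s - t| := by
    have := Convex.norm_image_sub_le_of_norm_hasDerivWithin_le (f := fun x : ℝ => x ^ a)
      (f' := fun x => a * x ^ (a - 1)) (s := Set.Icc 0 A) (C := d * (1 + A) ^ d) (x := t) (y := s)
      (fun x _ => (Real.hasDerivAt_rpow_const (Or.inr ha)).hasDerivWithinAt) (fun x hx => ?_)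
      (convex_Icc 0 A) ⟨ht, htA⟩ ⟨hs, hsA⟩
    · simpa using this
    · have h3 : x ^ (a - 1) ≤ (1 + A) ^ d :=
        (Real.rpow_le_rpow hx.1 (by linarith [hx.2]) (by linarith)).trans
          (Real.rpow_le_rpow_of_exponent_le (by linarith) (by linarith))
      have h4 : 0 ≤ x ^ (a - 1) := Real.rpow_nonneg hx.1 _
      rw [Real.norm_of_nonneg (by positivity)]
      exact mul_le_mul had h3 h4 (by linarith)
  have h2 : |t ^ a - t ^ b| ≤ (1 + A) ^ (d + 1) * |a - b| := by
    rcases ht.eq_or_lt with rfl | ht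
    · rw [Real.zero_rpow (by linarith), Real.zero_rpow (by linarith)]
      simp only [sub_self, abs_zero]; positivity
    have := Convex.norm_image_sub_le_of_norm_hasDerivWithin_le (f := fun x : ℝ => t ^ x)
      (f' := fun x => t ^ x * Real.log t) (s := Set.Icc 1 d) (C := (1 + A) ^ (d + 1)) (x := b)
      (y := a) (fun x _ => ?_) (fun x hx => ?_) (convex_Icc 1 d) ⟨hb, hbd⟩ ⟨ha, had⟩
    · simpa using this
    · simpa [mul_comm] using ((hasDerivAt_id x).const_rpow ht).hasDerivWithinAt
    · rw [norm_mul, Real.norm_of_nonneg (by positivity), Real.norm_eq_abs]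
      exact Real.rpow_mul_abs_log_le ht htA hx.1 hx.2
  calc |s ^ a - t ^ b| ≤ |s ^ a - t ^ a| + |t ^ a - t ^ b| := abs_sub_le _ _ _
    _ ≤ _ := add_le_add h1 h2

end RealInequalities

section Lipschitz

variable {E : Type*} [PseudoMetricSpace E]

theorem LipschitzWith.exists_rpow {f g : E → ℝ} {K L : NNReal} {A d : ℝ} (hf : LipschitzWith K f)
    (hg : LipschitzWith L g) (hf0 : ∀ x, 0 ≤ f x) (hfA : ∀ x, f x ≤ A) (hg1 : ∀ x, 1 ≤ g x)
    (hgd : ∀ x, g x ≤ d) : ∃ M, LipschitzWith M fun x => f x ^ g x := by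
  refine ⟨(d * (1 + A) ^ d * K + (1 + A) ^ (d + 1) * L).toNNReal,
    LipschitzWith.of_dist_le_mul fun x y => ?_⟩
  have hA : 0 ≤ A := (hf0 x).trans (hfA x)
  have hd : 0 ≤ d := zero_le_one.trans ((hg1 x).trans (hgd x))
  have h1 := hf.dist_le_mul x y
  have h2 := hg.dist_le_mul x y
  rw [Real.dist_eq] at h1 h2 ⊢
  rw [Real.coe_toNNReal _ (by positivity)]
  refine (Real.abs_rpow_sub_rpow_le (hf0 x) (hfA x) (hf0 y) (hfA y) (hg1 x) (hgd x) (hg1 y)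
    (hgd y)).trans ?_
  calc _ ≤ d * (1 + A) ^ d * (K * dist x y) + (1 + A) ^ (d + 1) * (L * dist x y) := by gcongr
    _ = _ := by ring

theorem LipschitzWith.exists_mul {f g : E → ℝ} {K L : NNReal} {A B : ℝ} (hf : LipschitzWith K f)
    (hg : LipschitzWith L g) (hfA : ∀ x, |f x| ≤ A) (hgB : ∀ x, |g x| ≤ B) :
    ∃ M, LipschitzWith M fun x => f x * g x := by
  refine ⟨(A * L + B * K).toNNReal, LipschitzWith.of_dist_le_mul fun x y => ?_⟩
  have hA : 0 ≤ A := (abs_nonneg _).trans (hfA x)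
  have hB : 0 ≤ B := (abs_nonneg _).trans (hgB x)
  have h1 := hf.dist_le_mul x y
  have h2 := hg.dist_le_mul x y
  rw [Real.dist_eq] at h1 h2 ⊢
  rw [Real.coe_toNNReal _ (by positivity)]
  calc |f x * g x - f y * g y| = |f x * (g x - g y) + g y * (f x - f y)| := by ring_nf
    _ ≤ |f x * (g x - g y)| + |g y * (f x - f y)| := abs_add_le _ _
    _ = |f x| * |g x - g y| + |g y| * |f x - f y| := by rw [abs_mul, abs_mul]
    _ ≤ A * (L * dist x y) + B * (K * dist x y) := by
        gcongr
        · exact hfA x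
        · exact hgB y
    _ = _ := by ring

theorem LipschitzWith.exists_const_div_const_sub {f : E → ℝ} {K : NNReal} {b n Q : ℝ}
    (hf : LipschitzWith K f) (hQ : Q < n) (hfQ : ∀ x, f x ≤ Q) :
    ∃ M, LipschitzWith M fun x => b / (n - f x) := by
  refine ⟨(|b| * K / (n - Q) ^ 2).toNNReal, LipschitzWith.of_dist_le_mul fun x y => ?_⟩
  have h1 := hf.dist_le_mul x y
  have hnQ : 0 < n - Q := sub_pos.2 hQ
  rw [Real.dist_eq] at h1 ⊢
  rw [Real.coe_toNNReal _ (by positivity)]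
  have hx : n - Q ≤ n - f x := by linarith [hfQ x]
  have hy : n - Q ≤ n - f y := by linarith [hfQ y]
  have hx0 := hnQ.trans_le hx
  have hy0 := hnQ.trans_le hy
  have h3 : b / (n - f x) - b / (n - f y) = b * (f x - f y) / ((n - f x) * (n - f y)) := by
    field_simp; ring
  rw [h3, abs_div, abs_mul, abs_of_pos (mul_pos hx0 hy0)]
  calc |b| * |f x - f y| / ((n - f x) * (n - f y))
      ≤ |b| * (K * dist x y) / ((n - Q) * (n - Q)) := by gcongr
    _ = _ := by ring

end Lipschitz

section GradientBound

set_option maxHeartbeats 1000000 in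
/-- The pointwise bound behind the Sobolev inequality for `α ^ (n / (n - q)) * w ^ (n q / (n - q))`:
an estimate of the gradient of the power `(n - 1) / n` of this function. -/
theorem exists_critical_gradient_bound (n Q A Ka Ke : ℝ) (hQ : Q < n) (hQ1 : 1 < Q) (hA : 0 ≤ A)
    (hKa : 0 ≤ Ka) (hKe : 0 ≤ Ke) :
    ∃ C > 0, ∀ α w q r g l : ℝ, 1 < q → q ≤ Q → 1 ≤ r → q * n / (n + 1 - q) ≤ r →
      0 < α → α ≤ A → 0 < w → 0 ≤ g → 0 < l →
      α ^ ((n - 1) / (n - q)) * w ^ (n * ((n - 1) / (n - q)) - (n - 1)) *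
        (Ke * |Real.log α| + (n - 1) / (n - q) * Ka / α + n * Ke * |Real.log w| +
          (n * ((n - 1) / (n - q)) - (n - 1)) * g / w) ≤
      C * (l * (α ^ (n / (n - q)) * w ^ (n * q / (n - q))) + l ^ (-(q - 1)) * (α * g ^ q) +
        (α ^ (n / (n - q)) * w ^ (n * q / (n - q)) + 1 + w ^ r)) := by
  have hn : 1 < n := hQ1.trans hQ
  have hnQ : 0 < n - Q := sub_pos.2 hQ
  set e₁ := (n - 1) / (n - Q) with he₁
  have he₁0 : 0 < e₁ := div_pos (by linarith) hnQ
  set C₁ := Ke * (1 + A ^ 2) + e₁ * Ka with hC₁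
  set C₂ := n * Ke * ((1 + A) ^ e₁ + n) with hC₂
  have hC₁0 : 0 ≤ C₁ := by positivity
  have hC₂0 : 0 ≤ C₂ := by positivity
  refine ⟨n * e₁ + C₁ + C₂ + 1, by positivity, fun α w q r g l hq hqQ hr1 hr hα hαA hw hg hl => ?_⟩
  have hnq : 0 < n - q := by linarith
  set e := (n - 1) / (n - q) with he
  have he0 : 0 < e := div_pos (by linarith) hnq
  have hee₁ : e ≤ e₁ := div_le_div_of_nonneg_left (by linarith) hnQ (by linarith)
  set s := n * e - (n - 1) with hs
  have hsq : s = q * e := by rw [hs, he]; field_simp; ring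
  have he1 : 1 ≤ e := by rw [he, le_div_iff₀ hnq]; linarith
  have hs1 : 1 ≤ s := by rw [hsq]; nlinarith
  have hsn : s ≤ n * e₁ := by rw [hsq]; gcongr; linarith
  set Y := α ^ (n / (n - q)) * w ^ (n * q / (n - q)) with hY
  have hY0 : 0 < Y := by positivity
  set F := α ^ e * w ^ s with hF
  have hF0 : 0 < F := by positivity
  have hYpow : ∀ z : ℝ, Y ^ z = α ^ (n / (n - q) * z) * w ^ (n * q / (n - q) * z) := fun z => by
    rw [hY, Real.mul_rpow (by positivity) (by positivity), ← Real.rpow_mul hα.le,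
      ← Real.rpow_mul hw.le]
  have hFY : F = Y ^ ((n - 1) / n) := by
    rw [hYpow, hF, hsq]
    congr 2 <;> rw [he] <;> field_simp
  have hwr0 : 0 < w ^ r := by positivity
  have T1 : F * (s * g / w) ≤ n * e₁ * (l * Y + l ^ (-(q - 1)) * (α * g ^ q)) := by
    have h1 := Real.rpow_sub_one_mul_le_add (A := Y ^ (1 / q)) (B := α ^ (1 / q) * g) hq
      (by positivity) (by positivity) hl
    have h2 : (Y ^ (1 / q)) ^ q = Y := by
      rw [← Real.rpow_mul hY0.le, one_div_mul_cancel (by linarith), Real.rpow_one]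
    have h3 : (α ^ (1 / q) * g) ^ q = α * g ^ q := by
      rw [Real.mul_rpow (by positivity) hg, ← Real.rpow_mul hα.le,
        one_div_mul_cancel (by linarith), Real.rpow_one]
    have h4 : F * (g / w) = (Y ^ (1 / q)) ^ (q - 1) * (α ^ (1 / q) * g) := by
      rw [← Real.rpow_mul hY0.le, hYpow, hF]
      have h5 : e = n / (n - q) * (1 / q * (q - 1)) + 1 / q := by
        rw [he]; field_simp; ring
      have h6 : s = n * q / (n - q) * (1 / q * (q - 1)) + 1 := by
        rw [hsq, he]; field_simp; ring
      rw [h5, h6, Real.rpow_add hα, Real.rpow_add_one hw.ne']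
      field_simp
    rw [h2, h3, ← h4] at h1
    calc F * (s * g / w) = s * (F * (g / w)) := by ring
      _ ≤ s * (l * Y + l ^ (-(q - 1)) * (α * g ^ q)) := by gcongr
      _ ≤ _ := by gcongr
  have T2' : F * (1 / α) ≤ Y + w ^ r + 1 := by
    have h1 := Real.rpow_one_sub_mul_rpow_le_add (X := w ^ (q * n / (n + 1 - q))) (Z := Y)
      (θ := (q - 1) / n) (by positivity) hY0.le (div_nonneg (by linarith) (by linarith))
      (by rw [div_le_one (by linarith)]; linarith)
    have h2 : F * (1 / α) = (w ^ (q * n / (n + 1 - q))) ^ (1 - (q - 1) / n) *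
        Y ^ ((q - 1) / n) := by
      rw [← Real.rpow_mul hw.le, hYpow, hF]
      have h5 : e = n / (n - q) * ((q - 1) / n) + 1 := by
        rw [he]; field_simp; ring
      have h7 : n + 1 - q ≠ 0 := by linarith
      have h6 : s = q * n / (n + 1 - q) * (1 - (q - 1) / n) +
          n * q / (n - q) * ((q - 1) / n) := by
        rw [hsq, he]; field_simp; ring
      rw [h5, h6, Real.rpow_add hw, Real.rpow_add_one hα.ne']
      field_simp
    rw [h2]
    refine h1.trans ?_
    have h3 : w ^ (q * n / (n + 1 - q)) ≤ w ^ r + 1 := by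
      rcases le_total w 1 with h | h
      · have := Real.rpow_le_one hw.le h (z := q * n / (n + 1 - q))
          (div_nonneg (by nlinarith) (by linarith))
        linarith
      · have := Real.rpow_le_rpow_of_exponent_le h hr
        linarith
    linarith
  have T2 : F * (Ke * |Real.log α| + e * Ka / α) ≤ C₁ * (Y + 1 + w ^ r) := by
    have h1 := Real.abs_log_le_div_of_le hα hαA
    calc F * (Ke * |Real.log α| + e * Ka / α)
        ≤ F * (Ke * ((1 + A ^ 2) / α) + e₁ * Ka / α) := by gcongr
      _ = C₁ * (F * (1 / α)) := by rw [hC₁]; ring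
      _ ≤ C₁ * (Y + w ^ r + 1) := by gcongr
      _ = _ := by ring
  have T3' : F * |Real.log w| ≤ ((1 + A) ^ e₁ + n) * (Y + 1 + w ^ r) := by
    have hA1 : 0 < (1 + A) ^ e₁ := by positivity
    rcases le_total w 1 with h | h
    · have h1 := Real.abs_log_le_inv_of_le_one hw h
      have h2 : α ^ e ≤ (1 + A) ^ e₁ :=
        (Real.rpow_le_rpow hα.le (by linarith) he0.le).trans
          (Real.rpow_le_rpow_of_exponent_le (by linarith) hee₁)
      have h3 : w ^ s ≤ w := by
        simpa using Real.rpow_le_rpow_of_exponent_ge hw h hs1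
      calc F * |Real.log w| ≤ ((1 + A) ^ e₁ * w) * w⁻¹ := by
            rw [hF]; gcongr
        _ = (1 + A) ^ e₁ * 1 := by field_simp
        _ ≤ _ := by
            apply mul_le_mul <;> linarith
    · have h1 : |Real.log w| ≤ n * w ^ (1 / n) := by
        rw [abs_of_nonneg (Real.log_nonneg h)]
        refine (Real.log_le_rpow_div hw.le (ε := 1 / n) (by positivity)).trans (le_of_eq ?_)
        field_simp
      have h2 := Real.rpow_one_sub_mul_rpow_le_add (X := Y) (Z := w) (θ := 1 / n) hY0.le hw.le
        (by positivity) (by rw [div_le_one (by linarith)]; exact hn.le)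
      have h3 : F = Y ^ (1 - 1 / n) := by
        rw [hFY]; congr 1; field_simp
      have h4 : w ≤ w ^ r := by
        simpa using Real.rpow_le_rpow_of_exponent_le h hr1
      calc F * |Real.log w| ≤ F * (n * w ^ (1 / n)) := by gcongr
        _ = n * (Y ^ (1 - 1 / n) * w ^ (1 / n)) := by rw [h3]; ring
        _ ≤ n * (Y + w) := by gcongr
        _ ≤ _ := by
            apply mul_le_mul <;> linarith
  have T3 : F * (n * Ke * |Real.log w|) ≤ C₂ * (Y + 1 + w ^ r) := by
    calc F * (n * Ke * |Real.log w|) = n * Ke * (F * |Real.log w|) := by ring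
      _ ≤ n * Ke * (((1 + A) ^ e₁ + n) * (Y + 1 + w ^ r)) := by gcongr
      _ = _ := by rw [hC₂]; ring
  have hZ1 : 0 ≤ l * Y + l ^ (-(q - 1)) * (α * g ^ q) := by positivity
  have hZ2 : 0 ≤ Y + 1 + w ^ r := by positivity
  have hne : 0 ≤ n * e₁ := by positivity
  calc _ = F * (s * g / w) + F * (Ke * |Real.log α| + e * Ka / α) +
        F * (n * Ke * |Real.log w|) := by ring
    _ ≤ n * e₁ * (l * Y + l ^ (-(q - 1)) * (α * g ^ q)) + C₁ * (Y + 1 + w ^ r) +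
        C₂ * (Y + 1 + w ^ r) := by gcongr
    _ ≤ _ := by
        have m1 := mul_nonneg hne hZ2
        have m2 := mul_nonneg (add_nonneg hC₁0 hC₂0) hZ1
        linear_combination m1 + m2 + hZ1 + hZ2

variable {E : Type*} [NormedAddCommGroup E] [NormedSpace ℝ E]

theorem norm_fderiv_rpow_mul_rpow_le {α w e : E → ℝ} {x : E} {n Ka Ke : ℝ}
    (hα : DifferentiableAt ℝ α x) (hw : DifferentiableAt ℝ w x) (he : DifferentiableAt ℝ e x)
    (hα0 : 0 < α x) (hw0 : 0 < w x) (hn : 0 ≤ n) (he0 : 0 ≤ e x) (hs0 : 0 ≤ n * e x - (n - 1))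
    (hKa : ‖fderiv ℝ α x‖ ≤ Ka) (hKe : ‖fderiv ℝ e x‖ ≤ Ke) :
    ‖fderiv ℝ (fun z => α z ^ e z * w z ^ (n * e z - (n - 1))) x‖ ≤
      α x ^ e x * w x ^ (n * e x - (n - 1)) *
        (Ke * |Real.log (α x)| + e x * Ka / α x + n * Ke * |Real.log (w x)| +
          (n * e x - (n - 1)) * ‖fderiv ℝ w x‖ / w x) := by
  have hKe0 : 0 ≤ Ke := (norm_nonneg _).trans hKe
  have h1 := hα.hasFDerivAt.rpow he.hasFDerivAt hα0
  have h2 := hw.hasFDerivAt.rpow ((he.hasFDerivAt.const_mul n).sub_const (n - 1)) hw0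
  rw [(h1.fun_mul h2).fderiv]
  set s := n * e x - (n - 1)
  have hαe : α x ^ (e x - 1) = α x ^ e x / α x := Real.rpow_sub_one hα0.ne' _
  have hws : w x ^ (s - 1) = w x ^ s / w x := Real.rpow_sub_one hw0.ne' _
  have b1 : ‖(e x * α x ^ (e x - 1)) • fderiv ℝ α x +
      (α x ^ e x * Real.log (α x)) • fderiv ℝ e x‖ ≤
      α x ^ e x * (Ke * |Real.log (α x)| + e x * Ka / α x) := by
    refine (norm_add_le _ _).trans ?_
    rw [norm_smul, norm_smul, hαe, Real.norm_of_nonneg (by positivity), norm_mul,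
      Real.norm_of_nonneg (by positivity : 0 ≤ α x ^ e x), Real.norm_eq_abs]
    calc _ ≤ e x * (α x ^ e x / α x) * Ka + α x ^ e x * |Real.log (α x)| * Ke := by gcongr
      _ = _ := by ring
  have b2 : ‖(s * w x ^ (s - 1)) • fderiv ℝ w x +
      (w x ^ s * Real.log (w x)) • (n • fderiv ℝ e x)‖ ≤
      w x ^ s * (n * Ke * |Real.log (w x)| + s * ‖fderiv ℝ w x‖ / w x) := by
    refine (norm_add_le _ _).trans ?_
    rw [norm_smul, norm_smul, norm_smul, hws, Real.norm_of_nonneg (by positivity), norm_mul,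
      Real.norm_of_nonneg (by positivity : 0 ≤ w x ^ s), Real.norm_eq_abs,
      Real.norm_of_nonneg hn]
    calc _ ≤ s * (w x ^ s / w x) * ‖fderiv ℝ w x‖ + w x ^ s * |Real.log (w x)| * (n * Ke) := by
          gcongr
      _ = _ := by ring
  refine (norm_add_le _ _).trans ?_
  rw [norm_smul, norm_smul, Real.norm_of_nonneg (by positivity : 0 ≤ α x ^ e x),
    Real.norm_of_nonneg (by positivity : 0 ≤ w x ^ s)]
  calc _ ≤ α x ^ e x * (w x ^ s * (n * Ke * |Real.log (w x)| + s * ‖fderiv ℝ w x‖ / w x)) +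
        w x ^ s * (α x ^ e x * (Ke * |Real.log (α x)| + e x * Ka / α x)) := by gcongr
    _ = _ := by ring

end GradientBound

section Sobolev

variable {N : ℕ}

/-- A critical Sobolev inequality with variable exponent `q` and weight `α`. -/
theorem exists_sobolev_weighted {α q r : EuclideanSpace ℝ (Fin N) → ℝ} {A Q : ℝ} {Ka Kq : NNReal}
    (hα : LipschitzWith Ka α) (hq : LipschitzWith Kq q) (hα0 : ∀ x, 0 ≤ α x)
    (hαA : ∀ x, α x ≤ A) (hq1 : ∀ x, 1 < q x) (hqQ : ∀ x, q x ≤ Q) (hQ : Q < N)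
    (hr1 : ∀ x, 1 ≤ r x) (hr : ∀ x, q x * N / (N + 1 - q x) ≤ r x) :
    ∃ C > 0, ∀ (w : EuclideanSpace ℝ (Fin N) → ℝ) (K : NNReal), LipschitzWith K w →
      HasCompactSupport w → (∀ x, 0 ≤ w x) → ∀ l : ℝ, 0 < l →
      ∀ G : EuclideanSpace ℝ (Fin N) → ℝ, IntegrableOn G {x | 0 < w x} →
      (∀ᵐ x, 0 < w x →
        l * (α x ^ (N / (N - q x)) * w x ^ (N * q x / (N - q x))) +
          l ^ (-(q x - 1)) * (α x * ‖fderiv ℝ w x‖ ^ q x) +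
          (α x ^ (N / (N - q x)) * w x ^ (N * q x / (N - q x)) + 1 + w x ^ r x) ≤ G x) →
      ∫ x, α x ^ (N / (N - q x)) * w x ^ (N * q x / (N - q x)) ≤
        C * (∫ x in {x | 0 < w x}, G x) ^ ((N : ℝ) / (N - 1)) := by
  have hQ1 : 1 < Q := (hq1 0).trans_le (hqQ 0)
  have hN1 : (1 : ℝ) < N := hQ1.trans hQ
  have hA : 0 ≤ A := (hα0 0).trans (hαA 0)
  have hNQ : 0 < N - Q := sub_pos.2 hQ
  have hNq : ∀ x, 0 < N - q x := fun x => by linarith [hqQ x]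
  set e : EuclideanSpace ℝ (Fin N) → ℝ := fun x => ((N : ℝ) - 1) / (N - q x) with he
  obtain ⟨Ke, hKe⟩ : ∃ M, LipschitzWith M e := hq.exists_const_div_const_sub hQ hqQ
  have he1 : ∀ x, 1 ≤ e x := fun x => by
    rw [he]; dsimp only; rw [le_div_iff₀ (hNq x)]; linarith [hq1 x]
  have hed : ∀ x, e x ≤ (N - 1) / (N - Q) := fun x =>
    div_le_div_of_nonneg_left (by linarith) hNQ (by linarith [hqQ x])
  obtain ⟨C, hC, hgrad⟩ := exists_critical_gradient_bound N Q A Ka Ke hQ hQ1 hA Ka.2 Ke.2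
  set R : ℝ := N / (N - 1) with hR
  have hR0 : 0 < R := div_pos (by linarith) (by linarith)
  have hconj : Real.HolderConjugate (Module.finrank ℝ (EuclideanSpace ℝ (Fin N)))
      R := by
    rw [finrank_euclideanSpace_fin]
    exact Real.HolderConjugate.conjExponent hN1
  set D := lintegralPowLePowLIntegralFDerivConst (volume : Measure (EuclideanSpace ℝ (Fin N))) R
  refine ⟨(D + 1) * C ^ R, by positivity, fun w K hw hwc hw0 l hl G hG hle => ?_⟩
  set s : EuclideanSpace ℝ (Fin N) → ℝ := fun x => N * e x - (N - 1) with hs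
  have hs1 : ∀ x, 1 ≤ s x := fun x => by
    have := he1 x
    rw [hs]; dsimp only; nlinarith
  have hsL : LipschitzWith (‖(N : ℝ)‖₊ * Ke) s := by
    refine LipschitzWith.of_dist_le_mul fun x y => ?_
    have := hKe.dist_le_mul x y
    rw [Real.dist_eq] at this ⊢
    have h3 : s x - s y = N * (e x - e y) := by rw [hs]; ring
    rw [h3, abs_mul]
    push_cast
    rw [Real.norm_eq_abs, mul_assoc]
    gcongr
  obtain ⟨W, hW⟩ := hwc.exists_bound_of_continuous hw.continuous
  have hwW : ∀ x, w x ≤ W := fun x => (le_abs_self _).trans (hW x)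
  obtain ⟨L1, hL1⟩ := hα.exists_rpow hKe hα0 hαA he1 hed
  obtain ⟨L2, hL2⟩ := hw.exists_rpow hsL hw0 hwW hs1 (d := N * ((N - 1) / (N - Q)) - (N - 1))
    (fun x => by have := hed x; rw [hs]; dsimp only; gcongr)
  have hb1 : ∀ x, |α x ^ e x| ≤ (1 + A) ^ (((N : ℝ) - 1) / (N - Q)) := fun x => by
    have h0 : 0 ≤ e x := zero_le_one.trans (he1 x)
    rw [abs_of_nonneg (Real.rpow_nonneg (hα0 x) _)]
    exact (Real.rpow_le_rpow (hα0 x) (by linarith [hαA x]) h0).trans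
      (Real.rpow_le_rpow_of_exponent_le (by linarith) (hed x))
  have hb2 : ∀ x, |w x ^ s x| ≤ (1 + W) ^ ((N : ℝ) * ((N - 1) / (N - Q)) - (N - 1)) := fun x => by
    have h0 : 0 ≤ s x := zero_le_one.trans (hs1 x)
    have hW0 : 0 ≤ W := (hw0 x).trans (hwW x)
    rw [abs_of_nonneg (Real.rpow_nonneg (hw0 x) _)]
    refine (Real.rpow_le_rpow (hw0 x) (by linarith [hwW x]) h0).trans
      (Real.rpow_le_rpow_of_exponent_le (by linarith) ?_)
    have := hed x; rw [hs]; dsimp only; gcongr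
  obtain ⟨L, hL⟩ := hL1.exists_mul hL2 hb1 hb2
  set f : EuclideanSpace ℝ (Fin N) → ℝ := fun x => α x ^ e x * w x ^ s x with hf
  have hf0 : ∀ x, 0 ≤ f x := fun x =>
    mul_nonneg (Real.rpow_nonneg (hα0 x) _) (Real.rpow_nonneg (hw0 x) _)
  have hfw : ∀ x, w x = 0 → f x = 0 := fun x hx => by
    rw [hf]; dsimp only
    rw [hx, Real.zero_rpow (by linarith [hs1 x]), mul_zero]
  have hfα : ∀ x, α x = 0 → f x = 0 := fun x hx => by
    rw [hf]; dsimp only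
    rw [hx, Real.zero_rpow (by linarith [he1 x]), zero_mul]
  have hfc : HasCompactSupport f := hwc.mono fun x hx h => hx (hfw x h)
  have hfd : ∀ x, f x = 0 → fderiv ℝ f x = 0 := fun x hx =>
    IsLocalMin.fderiv_eq_zero (Eventually.of_forall fun z => hx.trans_le (hf0 z))
  have hfY : ∀ x, α x ^ (N / (N - q x)) * w x ^ (N * q x / (N - q x)) = f x ^ R := fun x => by
    have h1 : (N : ℝ) - 1 ≠ 0 := by linarith
    have h2 := (hNq x).ne'
    rw [hf]; dsimp only
    rw [Real.mul_rpow (Real.rpow_nonneg (hα0 x) _) (Real.rpow_nonneg (hw0 x) _),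
      ← Real.rpow_mul (hα0 x), ← Real.rpow_mul (hw0 x), hs, he]
    dsimp only
    congr 2 <;> rw [hR] <;> field_simp
    ring
  have hwm : MeasurableSet {x | 0 < w x} := measurableSet_lt measurable_const hw.continuous.measurable
  have hpt : ∀ᵐ x, ‖fderiv ℝ f x‖ₑ ≤
      {x | 0 < w x}.indicator (fun x => ENNReal.ofReal (C * G x)) x := by
    filter_upwards [hle, hα.ae_differentiableAt, hw.ae_differentiableAt, hKe.ae_differentiableAt]
      with x hx dα dw de
    rcases (hw0 x).eq_or_lt with h | h
    · have h0 : ‖fderiv ℝ f x‖ = 0 := by rw [hfd x (hfw x h.symm)]; exact norm_zero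
      rw [← ofReal_norm, h0, ENNReal.ofReal_zero]
      exact zero_le
    · rw [Set.indicator_of_mem (by exact h), ← ofReal_norm]
      refine ENNReal.ofReal_le_ofReal ?_
      have hG' := hx h
      rcases (hα0 x).eq_or_lt with h' | h'
      · have h0 : ‖fderiv ℝ f x‖ = 0 := by rw [hfd x (hfα x h'.symm)]; exact norm_zero
        rw [h0]
        refine mul_nonneg hC.le (le_trans ?_ hG')
        have := hα0 x
        positivity
      · refine (norm_fderiv_rpow_mul_rpow_le dα dw de h' h (by linarith)
          (zero_le_one.trans (he1 x)) (zero_le_one.trans (hs1 x))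
          (norm_fderiv_le_of_lipschitz ℝ hα) (norm_fderiv_le_of_lipschitz ℝ hKe)).trans ?_
        refine (hgrad (α x) (w x) (q x) (r x) ‖fderiv ℝ w x‖ l (hq1 x) (hqQ x) (hr1 x) (hr x)
          h' (hαA x) h (norm_nonneg _) hl).trans ?_
        gcongr
  have hG0 : 0 ≤ᵐ[volume.restrict {x | 0 < w x}] fun x => C * G x := by
    rw [EventuallyLE, ae_restrict_iff' hwm]
    filter_upwards [hle] with x hx h
    refine mul_nonneg hC.le (le_trans ?_ (hx h))
    have := hα0 x
    have := hw0 x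
    positivity
  have hG0' : 0 ≤ ∫ x in {x | 0 < w x}, G x := by
    have := integral_nonneg_of_ae hG0
    rw [integral_const_mul] at this
    exact nonneg_of_mul_nonneg_right this hC
  have hint : ∫⁻ x, ‖fderiv ℝ f x‖ₑ ≤ ENNReal.ofReal (C * ∫ x in {x | 0 < w x}, G x) := by
    refine (lintegral_mono_ae hpt).trans ?_
    rw [lintegral_indicator hwm, ← integral_const_mul,
      ofReal_integral_eq_lintegral_ofReal (hG.const_mul C) hG0]
  have hGNS := hL.lintegral_pow_le_pow_lintegral_fderiv volume hfc hconj
  simp_rw [hfY]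
  have hcont : Continuous fun x => f x ^ R := hL.continuous.rpow_const fun x => Or.inr hR0.le
  rw [integral_eq_lintegral_of_nonneg_ae (Eventually.of_forall fun x => Real.rpow_nonneg (hf0 x) _)
    hcont.aestronglyMeasurable]
  refine ENNReal.toReal_le_of_le_ofReal (by positivity) ?_
  have h1 : ∀ x, ENNReal.ofReal (f x ^ R) = ‖f x‖ₑ ^ R := fun x => by
    rw [← ofReal_norm, Real.norm_of_nonneg (hf0 x), ENNReal.ofReal_rpow_of_nonneg (hf0 x) hR0.le]
  simp_rw [h1]
  refine hGNS.trans ?_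
  calc (D : ℝ≥0∞) * (∫⁻ x, ‖fderiv ℝ f x‖ₑ) ^ R
      ≤ ENNReal.ofReal (D + 1) * (ENNReal.ofReal (C * ∫ x in {x | 0 < w x}, G x)) ^ R := by
        gcongr
        rw [← ENNReal.ofReal_coe_nnreal]
        exact ENNReal.ofReal_le_ofReal (by linarith)
    _ = _ := by
        rw [ENNReal.ofReal_rpow_of_nonneg (by positivity) hR0.le, ← ENNReal.ofReal_mul (by positivity),
          Real.mul_rpow hC.le hG0', mul_assoc]

end Sobolev

/-- The Sobolev conjugate integrand `t ^ p* + a ^ (q* / q) t ^ q*` of `Hfun`. -/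
noncomputable def critFun {N : ℕ} (p q a : EuclideanSpace ℝ (Fin N) → ℝ)
    (x : EuclideanSpace ℝ (Fin N)) (t : ℝ) : ℝ :=
  t ^ (N * p x / (N - p x)) + a x ^ (N / (N - q x)) * t ^ (N * q x / (N - q x))

section CondD

variable {N : ℕ} {p q a : EuclideanSpace ℝ (Fin N) → ℝ}

namespace CondD

theorem one_lt_p (hD : CondD N p q a) (x) : 1 < p x := by
  obtain ⟨c, hc, h⟩ := hD.inf_p
  exact hc.trans_le (h x)

theorem one_lt_q (hD : CondD N p q a) (x) : 1 < q x := (hD.one_lt_p x).trans (hD.p_lt_q x)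

theorem p_lt_N (hD : CondD N p q a) (x) : p x < N := (hD.p_lt_q x).trans (hD.q_lt_N x)

theorem one_lt_N (hD : CondD N p q a) : (1 : ℝ) < N := (hD.one_lt_q 0).trans (hD.q_lt_N 0)

theorem q_le (hD : CondD N p q a) (x) : q x ≤ p x * (1 + 1 / N) := by
  obtain ⟨c, hc, h⟩ := hD.ratio
  have := (h x).trans hc.le
  have hp := hD.one_lt_p x
  rw [div_le_iff₀ (by linarith)] at this
  linarith

theorem p_lt_pstar (hD : CondD N p q a) (x) : p x < N * p x / (N - p x) := by
  have h1 := hD.one_lt_p x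
  have h2 := hD.p_lt_N x
  rw [lt_div_iff₀ (by linarith)]
  nlinarith

theorem q_lt_qstar (hD : CondD N p q a) (x) : q x < N * q x / (N - q x) := by
  have h1 := hD.one_lt_q x
  have h2 := hD.q_lt_N x
  rw [lt_div_iff₀ (by linarith)]
  nlinarith

theorem mul_div_le_pstar (hD : CondD N p q a) (x) :
    q x * N / (N + 1 - q x) ≤ N * p x / (N - p x) := by
  have h1 := hD.one_lt_p x
  have h2 := hD.p_lt_N x
  have h3 := hD.q_lt_N x
  have h4 := hD.q_le x
  have hN := hD.one_lt_N
  have h5 : q x * N ≤ p x * N + p x := by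
    have : p x * (1 + 1 / N) * N = p x * N + p x := by field_simp
    nlinarith
  rw [div_le_div_iff₀ (by linarith) (by linarith)]
  nlinarith

theorem q_le_pstar (hD : CondD N p q a) (x) : q x ≤ N * p x / (N - p x) := by
  refine le_trans ?_ (hD.mul_div_le_pstar x)
  have h3 := hD.q_lt_N x
  have h1 := hD.one_lt_q x
  rw [le_div_iff₀ (by linarith)]
  nlinarith

theorem pstar_lt_qstar (hD : CondD N p q a) (x) : N * p x / (N - p x) < N * q x / (N - q x) := by
  have h3 := hD.q_lt_N x
  have h1 := hD.one_lt_p x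
  have h2 := hD.p_lt_q x
  rw [div_lt_div_iff₀ (by linarith) (by linarith)]
  have hN : (0 : ℝ) < N := by linarith [hD.one_lt_N]
  nlinarith [mul_pos (mul_pos hN hN) (sub_pos.2 h2)]

theorem exists_qstar_le (hD : CondD N p q a) : ∃ S, 1 ≤ S ∧ ∀ x, N * q x / (N - q x) ≤ S := by
  obtain ⟨Q, hQ, h⟩ := hD.sup_q
  have hN := hD.one_lt_N
  have key : ∀ x, N * q x / (N - q x) ≤ N * Q / (N - Q) := fun x => by
    have h3 := hD.q_lt_N x
    have := h x
    rw [div_le_div_iff₀ (by linarith) (by linarith)]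
    have hN : (0 : ℝ) < N := by linarith
    nlinarith [mul_nonneg (mul_pos hN hN).le (sub_nonneg.2 this)]
  refine ⟨_, le_trans ?_ (key 0), key⟩
  have := hD.q_lt_qstar 0
  have := hD.one_lt_q 0
  linarith

theorem continuous_p (hD : CondD N p q a) : Continuous p := hD.lip_p.elim fun _ h => h.continuous
theorem continuous_q (hD : CondD N p q a) : Continuous q := hD.lip_q.elim fun _ h => h.continuous
theorem continuous_a (hD : CondD N p q a) : Continuous a := hD.lip_a.elim fun _ h => h.continuous

theorem continuous_pstar (hD : CondD N p q a) : Continuous fun x => N * p x / (N - p x) :=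
  (continuous_const.mul hD.continuous_p).div (continuous_const.sub hD.continuous_p) fun x => by
    have := hD.p_lt_N x; linarith

theorem continuous_qstar (hD : CondD N p q a) : Continuous fun x => N * q x / (N - q x) :=
  (continuous_const.mul hD.continuous_q).div (continuous_const.sub hD.continuous_q) fun x => by
    have := hD.q_lt_N x; linarith

theorem continuous_rpow_a (hD : CondD N p q a) : Continuous fun x => a x ^ (N / (N - q x)) :=
  hD.continuous_a.rpow (continuous_const.div (continuous_const.sub hD.continuous_q) fun x => by
    have := hD.q_lt_N x; linarith) fun x => Or.inr <| by
    have := hD.q_lt_N x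
    exact div_pos (by linarith [hD.one_lt_N]) (by linarith)

theorem continuous_Hfun (hD : CondD N p q a) {X : Type*} [TopologicalSpace X]
    {f : X → EuclideanSpace ℝ (Fin N)} {g : X → ℝ} (hf : Continuous f) (hg : Continuous g) :
    Continuous fun x => Hfun p q a (f x) (g x) :=
  (hg.rpow (hD.continuous_p.comp hf) fun x => Or.inr (by linarith [hD.one_lt_p (f x)] : 0 < p (f x))).add
    ((hD.continuous_a.comp hf).mul (hg.rpow (hD.continuous_q.comp hf)
      fun x => Or.inr (by linarith [hD.one_lt_q (f x)] : 0 < q (f x))))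

theorem continuous_critFun (hD : CondD N p q a) {X : Type*} [TopologicalSpace X]
    {f : X → EuclideanSpace ℝ (Fin N)} {g : X → ℝ} (hf : Continuous f) (hg : Continuous g) :
    Continuous fun x => critFun p q a (f x) (g x) :=
  (hg.rpow (hD.continuous_pstar.comp hf) fun x => Or.inr
    (by linarith [hD.one_lt_p (f x), hD.p_lt_pstar (f x)] :
      0 < N * p (f x) / (N - p (f x)))).add
    ((hD.continuous_rpow_a.comp hf).mul (hg.rpow (hD.continuous_qstar.comp hf)
      fun x => Or.inr (by linarith [hD.one_lt_q (f x), hD.q_lt_qstar (f x)] :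
      0 < N * q (f x) / (N - q (f x)))))

theorem Hfun_nonneg (hD : CondD N p q a) (x) {t : ℝ} (ht : 0 ≤ t) : 0 ≤ Hfun p q a x t :=
  add_nonneg (Real.rpow_nonneg ht _) (mul_nonneg (hD.a_nonneg x) (Real.rpow_nonneg ht _))

theorem critFun_nonneg (hD : CondD N p q a) (x) {t : ℝ} (ht : 0 ≤ t) : 0 ≤ critFun p q a x t :=
  add_nonneg (Real.rpow_nonneg ht _)
    (mul_nonneg (Real.rpow_nonneg (hD.a_nonneg x) _) (Real.rpow_nonneg ht _))

theorem critFun_mono (hD : CondD N p q a) (x) {s t : ℝ} (hs : 0 ≤ s) (hst : s ≤ t) :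
    critFun p q a x s ≤ critFun p q a x t := by
  have h1 := hD.one_lt_p x
  have h2 := hD.p_lt_pstar x
  have h3 := hD.pstar_lt_qstar x
  exact add_le_add (Real.rpow_le_rpow hs hst (by linarith))
    (mul_le_mul_of_nonneg_left (Real.rpow_le_rpow hs hst (by linarith))
      (Real.rpow_nonneg (hD.a_nonneg x) _))

theorem critFun_zero (hD : CondD N p q a) (x) : critFun p q a x 0 = 0 := by
  have h1 := hD.one_lt_p x
  have h2 := hD.p_lt_pstar x
  have h3 := hD.pstar_lt_qstar x
  rw [critFun, Real.zero_rpow (by linarith), Real.zero_rpow (by linarith)]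
  simp

/-- The combined critical Sobolev inequality for the double phase integrand. -/
theorem exists_sobolev (hD : CondD N p q a) :
    ∃ C > 0, ∀ (w : EuclideanSpace ℝ (Fin N) → ℝ) (K : NNReal), LipschitzWith K w →
      HasCompactSupport w → (∀ x, 0 ≤ w x) → ∀ l : ℝ, 1 ≤ l →
      ∀ P : ℝ, (∀ x, 0 < w x → P ≤ p x) →
      ∀ G : EuclideanSpace ℝ (Fin N) → ℝ, IntegrableOn G {x | 0 < w x} →
      (∀ᵐ x, 0 < w x → l * critFun p q a x (w x) +
        l ^ (-(P - 1)) * Hfun p q a x ‖fderiv ℝ w x‖ + 1 ≤ G x) →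
      ∫ x, critFun p q a x (w x) ≤
        C * (∫ x in {x | 0 < w x}, G x) ^ ((N : ℝ) / (N - 1)) := by
  obtain ⟨Kp, hKp⟩ := hD.lip_p
  obtain ⟨Kq, hKq⟩ := hD.lip_q
  obtain ⟨Ka, hKa⟩ := hD.lip_a
  obtain ⟨Q, hQ, hqQ⟩ := hD.sup_q
  obtain ⟨A, hA⟩ := hD.a_bdd
  have hN := hD.one_lt_N
  have hps : ∀ x, 1 ≤ N * p x / (N - p x) := fun x =>
    (hD.one_lt_p x).le.trans (hD.p_lt_pstar x).le
  obtain ⟨C1, hC1, h1⟩ := exists_sobolev_weighted (α := fun _ => (1 : ℝ))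
    (r := fun x => N * p x / (N - p x)) (LipschitzWith.const (1 : ℝ)) hKp
    (fun _ => zero_le_one) (fun _ => le_rfl) hD.one_lt_p
    (fun x => (hD.p_lt_q x).le.trans (hqQ x)) hQ hps (fun x => by
      have h1 := hD.one_lt_p x
      have h2 := hD.p_lt_N x
      rw [mul_comm]
      exact div_le_div_of_nonneg_left (by nlinarith) (by linarith) (by linarith))
  obtain ⟨C2, hC2, h2⟩ := exists_sobolev_weighted (r := fun x => N * p x / (N - p x)) hKa hKq
    hD.a_nonneg hA hD.one_lt_q hqQ hQ hps hD.mul_div_le_pstar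
  refine ⟨(C1 + C2) * 3 ^ ((N : ℝ) / (N - 1)), by positivity,
    fun w K hw hwc hw0 l hl P hP G hG hle => ?_⟩
  have hG3 : IntegrableOn (fun x => 3 * G x) {x | 0 < w x} := hG.const_mul 3
  have hwm : MeasurableSet {x | 0 < w x} :=
    measurableSet_lt measurable_const hw.continuous.measurable
  have haux : ∀ᵐ x, 0 < w x → ∀ e, P ≤ e → l ^ (-(e - 1)) ≤ l ^ (-(P - 1)) :=
    Eventually.of_forall fun x _ e he => Real.rpow_le_rpow_of_exponent_le hl (by linarith)
  have e1 := h1 w K hw hwc hw0 l (by linarith) _ hG3 (by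
    filter_upwards [hle, haux] with x hx hx2 hwx
    have hx := hx hwx
    have hx2 := hx2 hwx (p x) (hP x hwx)
    simp only [Real.one_rpow, one_mul]
    rw [critFun, Hfun] at hx
    have t1 : 0 ≤ w x ^ (N * p x / (N - p x)) := Real.rpow_nonneg (hw0 x) _
    have t2 : 0 ≤ a x ^ (N / (N - q x)) * w x ^ (N * q x / (N - q x)) :=
      mul_nonneg (Real.rpow_nonneg (hD.a_nonneg x) _) (Real.rpow_nonneg (hw0 x) _)
    have t3 : 0 ≤ ‖fderiv ℝ w x‖ ^ p x := by positivity
    have t4 : 0 ≤ a x * ‖fderiv ℝ w x‖ ^ q x := mul_nonneg (hD.a_nonneg x) (by positivity)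
    have t5 : 0 ≤ l ^ (-(P - 1)) := by positivity
    have t6 := mul_le_mul_of_nonneg_right hx2 t3
    nlinarith [mul_nonneg t5 t4, mul_nonneg t5 t3])
  have e2 := h2 w K hw hwc hw0 l (by linarith) _ hG3 (by
    filter_upwards [hle, haux] with x hx hx2 hwx
    have hx := hx hwx
    have hx2 := hx2 hwx (q x) ((hP x hwx).trans (hD.p_lt_q x).le)
    rw [critFun, Hfun] at hx
    have t1 : 0 ≤ w x ^ (N * p x / (N - p x)) := Real.rpow_nonneg (hw0 x) _
    have t2 : 0 ≤ a x ^ (N / (N - q x)) * w x ^ (N * q x / (N - q x)) :=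
      mul_nonneg (Real.rpow_nonneg (hD.a_nonneg x) _) (Real.rpow_nonneg (hw0 x) _)
    have t3 : 0 ≤ ‖fderiv ℝ w x‖ ^ p x := by positivity
    have t4 : 0 ≤ a x * ‖fderiv ℝ w x‖ ^ q x := mul_nonneg (hD.a_nonneg x) (by positivity)
    have t5 : 0 ≤ l ^ (-(P - 1)) := by positivity
    have t6 := mul_le_mul_of_nonneg_right hx2 t4
    nlinarith [mul_nonneg t5 t4, mul_nonneg t5 t3])
  have hG0 : 0 ≤ ∫ x in {x | 0 < w x}, G x := by
    refine integral_nonneg_of_ae ?_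
    rw [EventuallyLE, ae_restrict_iff' hwm]
    filter_upwards [hle] with x hx h
    refine le_trans ?_ (hx h)
    have := hD.critFun_nonneg x (hw0 x)
    have := hD.Hfun_nonneg x (norm_nonneg (fderiv ℝ w x))
    positivity
  simp only [Real.one_rpow, one_mul] at e1
  rw [integral_const_mul, Real.mul_rpow (by norm_num) hG0] at e1 e2
  have i1 : Integrable fun x => w x ^ (N * p x / (N - p x)) :=
    (hw.continuous.rpow hD.continuous_pstar fun x => Or.inr
      (by linarith [hps x])).integrable_of_hasCompactSupport
      (hwc.mono fun x hx h => hx (by dsimp only; rw [h, Real.zero_rpow (by linarith [hps x])]))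
  have i2 : Integrable fun x => a x ^ (N / (N - q x)) * w x ^ (N * q x / (N - q x)) :=
    (hD.continuous_rpow_a.mul (hw.continuous.rpow hD.continuous_qstar fun x => Or.inr
      (by linarith [hps x, hD.pstar_lt_qstar x]))).integrable_of_hasCompactSupport
      (hwc.mono fun x hx h => hx (by
        rw [Pi.mul_apply, h, Real.zero_rpow (by linarith [hps x, hD.pstar_lt_qstar x]), mul_zero]))
  simp only [critFun]
  rw [integral_add i1 i2]
  linarith

end CondD

end CondD

theorem Real.mul_le_mul_rpow_conj_add {s k B μ : ℝ} (hs : 1 < s) (hk : 0 ≤ k) (hB : 0 ≤ B)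
    (hμ : 0 < μ) : k * B ≤ μ * k ^ (s / (s - 1)) + μ ^ (-(s - 1)) * B ^ s := by
  have h := Real.rpow_sub_one_mul_le_add hs (Real.rpow_nonneg hk (1 / (s - 1))) hB hμ
  have h1 : s - 1 ≠ 0 := by linarith
  rwa [← Real.rpow_mul hk, ← Real.rpow_mul hk, one_div_mul_cancel h1, Real.rpow_one,
    one_div_mul_eq_div] at h

theorem pow_pred_le_rpow {N : ℕ} {p e : ℝ} (hp : 1 < p) (hpN : p < N) (he : 0 ≤ e) (he1 : e ≤ 1) :
    e ^ (N - 1) ≤ (e ^ ((N : ℝ) / p)) ^ (p - 1) := by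
  have hN : 1 < N := by exact_mod_cast hp.trans hpN
  rcases he.eq_or_lt with rfl | h
  · rw [zero_pow (by omega)]
    positivity
  · rw [← Real.rpow_mul he, ← Real.rpow_natCast, Nat.cast_sub hN.le, Nat.cast_one]
    refine Real.rpow_le_rpow_of_exponent_ge h he1 ?_
    rw [div_mul_eq_mul_div, div_le_iff₀ (by linarith)]
    nlinarith

/-- The cut-off gradient term in the Caccioppoli inequality. -/
theorem cutoff_gradient_term_le {N : ℕ} {p S e X B ε : ℝ} (hp : 1 < p) (hpN : p < N) (hpS : p ≤ S)
    (he : 0 ≤ e) (he1 : e ≤ 1) (hX : 0 ≤ X) (hB : 0 ≤ B) (hε : 0 < ε) (hε1 : ε ≤ 1) :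
    e ^ (N - 1) * B * X ^ (p - 1) ≤ ε * (e ^ N * X ^ p) + ε ^ (-S) * B ^ p := by
  have h := Real.rpow_sub_one_mul_le_add_of_le (S := S) hp (by linarith)
    (mul_nonneg (Real.rpow_nonneg he ((N : ℝ) / p)) hX) hB hε hε1
  rw [Real.mul_rpow (Real.rpow_nonneg he _) hX, Real.mul_rpow (Real.rpow_nonneg he _) hX,
    ← Real.rpow_mul he ((N : ℝ) / p) p, div_mul_cancel₀ _ (by linarith), Real.rpow_natCast] at h
  refine le_trans ?_ h
  have := pow_pred_le_rpow hp hpN he he1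
  have h2 : 0 ≤ X ^ (p - 1) := Real.rpow_nonneg hX _
  nlinarith [mul_le_mul_of_nonneg_right this (mul_nonneg hB h2)]

theorem rpow_div_conj_mul_le {q s S X B ε : ℝ} (hs : 1 < s) (hsS : s ≤ S)
    (hX : 0 ≤ X) (hB : 0 ≤ B) (hε : 0 < ε) (hε1 : ε ≤ 1) :
    X ^ (q / (s / (s - 1))) * B ≤ ε * X ^ q + ε ^ (-S) * B ^ s := by
  have h := Real.rpow_sub_one_mul_le_add_of_le (S := S) hs (by linarith)
    (Real.rpow_nonneg hX (q / s)) hB hε hε1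
  have h1 : s - 1 ≠ 0 := by linarith
  have h2 : s ≠ 0 := by linarith
  rw [← Real.rpow_mul hX, ← Real.rpow_mul hX, div_mul_cancel₀ _ h2] at h
  rwa [show q / (s / (s - 1)) = q / s * (s - 1) by field_simp]

set_option maxHeartbeats 1000000 in
theorem exists_caccioppoli_pointwise (N : ℕ) (A S M₁ M₂ M₃ L : ℝ) (hA : 0 ≤ A)
    (hM₁ : 0 < M₁) (hM₂ : 0 < M₂) (hM₃ : 0 < M₃) (hL : 0 < L) :
    ∃ C > 0, ∀ p q a ρ σ k d t e X D T μ F₀ F₁ g : ℝ, 1 < p → p < q → q < N →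
      q ≤ N * p / (N - p) → N * q / (N - q) ≤ S → 0 ≤ a → a ≤ A → 1 < ρ → 1 < σ →
      ρ ≤ N * p / (N - p) → σ ≤ N * p / (N - p) → 0 ≤ k → 0 ≤ d → 1 ≤ t →
      0 ≤ e → e ≤ 1 → 0 ≤ X → 1 ≤ D → 1 ≤ T → 0 < μ → μ ≤ 1 → μ ^ (-(ρ - 1)) ≤ T →
      μ ^ (-(σ - 1)) ≤ T →
      M₂ * (X ^ p + a * X ^ q) -
          M₃ * (t ^ (N * p / (N - p)) + a ^ (N / (N - q)) * t ^ (N * q / (N - q)) + 1) ≤ F₀ →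
      F₁ ≤ M₁ * (k + t ^ (N * p / (N - p) - 1) + a ^ (N / (N - q)) * t ^ (N * q / (N - q) - 1) +
          X ^ (p - 1) + a * X ^ (q - 1)) →
      g ≤ L * (d + t ^ (N * p / (N - p) - 1) + a ^ (N / (N - q)) * t ^ (N * q / (N - q) - 1) +
          X ^ (p / ((N * p / (N - p)) / (N * p / (N - p) - 1))) +
          a ^ ((N + 1) / (N : ℝ)) *
            X ^ (q / ((N * q / (N - q)) / (N * q / (N - q) - 1)))) →
      M₂ / 2 * (e ^ N * (X ^ p + a * X ^ q)) ≤
        e ^ N * F₀ - N * e ^ (N - 1) * t * D * F₁ - e ^ N * t * g +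
          C * D ^ S * (T * (t ^ (N * p / (N - p)) + a ^ (N / (N - q)) * t ^ (N * q / (N - q))) +
            μ * (k ^ (ρ / (ρ - 1)) + d ^ (σ / (σ - 1)))) := by
  set n : ℝ := (N : ℝ) with hn
  have hn0 : 0 ≤ n := Nat.cast_nonneg N
  have hc : 0 < n * M₁ + L := by positivity
  set ε : ℝ := min 1 (M₂ / (2 * (n * M₁ + L))) with hε
  have hε0 : 0 < ε := lt_min one_pos (by positivity)
  have hε1 : ε ≤ 1 := min_le_left _ _
  have hεM : (n * M₁ + L) * ε ≤ M₂ / 2 := by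
    calc (n * M₁ + L) * ε ≤ (n * M₁ + L) * (M₂ / (2 * (n * M₁ + L))) := by
          gcongr; exact min_le_right _ _
      _ = M₂ / 2 := by field_simp
  set K : ℝ := ε ^ (-S) with hK
  have hK0 : 0 < K := Real.rpow_pos_of_pos hε0 _
  refine ⟨2 * M₃ + (n * M₁ + L) * (2 + K * (1 + A)), by positivity, ?_⟩
  intro p q a ρ σ k d t e X D T μ F₀ F₁ g hp hpq hqN hqps hqsS ha haA hρ hσ hρps hσps hk hd ht he
    he1 hX hD hT hμ hμ1 hμρ hμσ hF₀ hF₁ hg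
  have hN1 : 1 < n := by linarith
  have hpsS : n * p / (n - p) ≤ S := by
    refine le_trans ?_ hqsS
    rw [div_le_div_iff₀ (by linarith) (by linarith)]
    nlinarith [mul_pos (mul_pos (by linarith : 0 < n) (by linarith : 0 < n)) (sub_pos.2 hpq)]
  have hqs : q < n * q / (n - q) := by
    rw [lt_div_iff₀ (by linarith)]; nlinarith
  set ps := n * p / (n - p) with hps
  set qs := n * q / (n - q) with hqs'
  set b := a ^ (n / (n - q)) with hb
  have hb0 : 0 ≤ b := Real.rpow_nonneg ha _
  have ht0 : 0 < t := by linarith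
  have hD0 : 0 < D := by linarith
  set Γ := t ^ ps + b * t ^ qs with hΓ
  have htps : 1 ≤ t ^ ps := Real.one_le_rpow ht (by linarith)
  have htqs : 0 ≤ t ^ qs := by positivity
  have hpsΓ : t ^ ps ≤ Γ := le_add_of_nonneg_right (mul_nonneg hb0 htqs)
  have hΓ1 : 1 ≤ Γ := htps.trans hpsΓ
  have hDS : 1 ≤ D ^ S := Real.one_le_rpow hD (by linarith)
  have hDle : D ≤ D ^ S := Real.self_le_rpow_of_one_le hD (by linarith)
  have hpow : ∀ s, 0 ≤ s → s ≤ ps → (t * D) ^ s ≤ D ^ S * t ^ ps := fun s hs0 hs => by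
    rw [Real.mul_rpow ht0.le hD0.le, mul_comm]
    exact mul_le_mul (Real.rpow_le_rpow_of_exponent_le hD (by linarith))
      (Real.rpow_le_rpow_of_exponent_le ht hs) (by positivity) (by positivity)
  set hh := k ^ (ρ / (ρ - 1)) + d ^ (σ / (σ - 1)) with hhh
  have hkh : k ^ (ρ / (ρ - 1)) ≤ hh := le_add_of_nonneg_right (Real.rpow_nonneg hd _)
  have hdh : d ^ (σ / (σ - 1)) ≤ hh := le_add_of_nonneg_left (Real.rpow_nonneg hk _)
  have hh0 : 0 ≤ hh := (Real.rpow_nonneg hk _).trans hkh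
  have heN : 0 ≤ e ^ N := by positivity
  have heN1 : e ^ N ≤ 1 := pow_le_one₀ he he1
  have heP : 0 ≤ e ^ (N - 1) := by positivity
  have heP1 : e ^ (N - 1) ≤ 1 := pow_le_one₀ he he1
  have hXp : 0 ≤ X ^ p := Real.rpow_nonneg hX _
  have hXq : 0 ≤ X ^ q := Real.rpow_nonneg hX _
  have htt : ∀ s : ℝ, t * t ^ (s - 1) = t ^ s := fun s => by
    rw [Real.rpow_sub_one ht0.ne']; field_simp
  -- the terms coming from the cut-off
  have a1 : k * (t * D) ≤ D ^ S * (T * Γ + μ * hh) := by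
    refine (Real.mul_le_mul_rpow_conj_add hρ hk (by positivity) hμ).trans ?_
    have h0 : (t * D) ^ ρ ≤ D ^ S * Γ :=
      (hpow ρ (by linarith) hρps).trans (mul_le_mul_of_nonneg_left hpsΓ (by positivity))
    have h1 : μ ^ (-(ρ - 1)) * (t * D) ^ ρ ≤ T * (D ^ S * Γ) :=
      mul_le_mul hμρ h0 (by positivity) (by linarith)
    have h2 : μ * k ^ (ρ / (ρ - 1)) ≤ μ * hh := by gcongr
    linarith only [h1, h2, mul_nonneg (sub_nonneg.2 hDS) (mul_nonneg hμ.le hh0)]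
  have a2 : t * D * (t ^ (ps - 1) + b * t ^ (qs - 1)) ≤ D ^ S * Γ := by
    have : t * D * (t ^ (ps - 1) + b * t ^ (qs - 1)) = D * Γ := by
      rw [hΓ, ← htt ps, ← htt qs]; ring
    rw [this]; gcongr
  have a3 : e ^ (N - 1) * (t * D) * X ^ (p - 1) ≤ ε * (e ^ N * X ^ p) + K * (D ^ S * Γ) :=
    (cutoff_gradient_term_le hp (by linarith) (by linarith : p ≤ S) he he1 hX (by positivity)
      hε0 hε1).trans (by
        have := (hpow p (by linarith) (by linarith)).trans
          (mul_le_mul_of_nonneg_left hpsΓ (by positivity))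
        gcongr)
  have a4 : a * (e ^ (N - 1) * (t * D) * X ^ (q - 1)) ≤
      ε * (e ^ N * (a * X ^ q)) + K * A * (D ^ S * Γ) := by
    have h1 := (cutoff_gradient_term_le (by linarith : 1 < q) (by linarith) (by linarith : q ≤ S)
      he he1 hX (by positivity : 0 ≤ t * D) hε0 hε1)
    have h2 := (hpow q (by linarith) (by linarith)).trans
          (mul_le_mul_of_nonneg_left hpsΓ (by positivity : 0 ≤ D ^ S))
    have h3 := mul_le_mul_of_nonneg_left (h1.trans (add_le_add_right
      (mul_le_mul_of_nonneg_left h2 hK0.le) _)) ha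
    have h4 : a * (K * (D ^ S * Γ)) ≤ A * (K * (D ^ S * Γ)) := by gcongr
    linarith only [h3, h4]
  -- the terms coming from the lower order part
  have b1 : d * t ≤ T * Γ + μ * hh := by
    refine (Real.mul_le_mul_rpow_conj_add hσ hd ht0.le hμ).trans ?_
    have h1 : μ ^ (-(σ - 1)) * t ^ σ ≤ T * Γ :=
      mul_le_mul hμσ ((Real.rpow_le_rpow_of_exponent_le ht hσps).trans hpsΓ) (by positivity)
        (by linarith)
    have h2 : μ * d ^ (σ / (σ - 1)) ≤ μ * hh := by gcongr
    linarith
  have b3 : X ^ (p / (ps / (ps - 1))) * t ≤ ε * X ^ p + K * t ^ ps :=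
    rpow_div_conj_mul_le (by linarith) (by linarith) hX ht0.le hε0 hε1
  have b4 : a ^ ((n + 1) / n) * X ^ (q / (qs / (qs - 1))) * t ≤ ε * (a * X ^ q) + K * (b * t ^ qs) := by
    have h1 := mul_le_mul_of_nonneg_left (rpow_div_conj_mul_le (q := q) (s := qs) (S := S)
      (by linarith) (by linarith) hX
      (mul_nonneg (Real.rpow_nonneg ha (1 / n)) ht0.le) hε0 hε1) ha
    rcases ha.eq_or_lt with h0 | h0
    · rw [← h0, Real.zero_rpow (by positivity)]
      simp only [zero_mul, mul_zero, zero_add]; positivity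
    · have e1 : a ^ ((n + 1) / n) = a * a ^ (1 / n) := by
        rw [← Real.rpow_one_add' ha (by positivity)]; congr 1; field_simp
      have e2 : a * (a ^ (1 / n)) ^ qs = b := by
        have h4 : n - q ≠ 0 := by linarith
        rw [← Real.rpow_mul ha, ← Real.rpow_one_add' ha (by
          have : 0 ≤ 1 / n * qs := mul_nonneg (by positivity) (by linarith)
          linarith), hb, hqs']
        congr 1; field_simp; ring
      rw [Real.mul_rpow (Real.rpow_nonneg ha _) ht0.le] at h1
      calc _ = a * (X ^ (q / (qs / (qs - 1))) * (a ^ (1 / n) * t)) := by rw [e1]; ring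
        _ ≤ _ := h1
        _ = ε * (a * X ^ q) + K * (a * (a ^ (1 / n)) ^ qs * t ^ qs) := by ring
        _ = _ := by rw [e2]
  have hle0 : Γ ≤ T * Γ + μ * hh :=
    (le_mul_of_one_le_left (by linarith only [hΓ1]) hT).trans
      (le_add_of_nonneg_right (mul_nonneg hμ.le hh0))
  have tA : e ^ (N - 1) * t * D * F₁ ≤ M₁ * (ε * (e ^ N * (X ^ p + a * X ^ q)) +
      (2 + K * (1 + A)) * (D ^ S * (T * Γ + μ * hh))) := by
    have hle : D ^ S * Γ ≤ D ^ S * (T * Γ + μ * hh) := by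
      gcongr
    have h1 := mul_le_mul_of_nonneg_left hF₁ (by positivity : 0 ≤ e ^ (N - 1) * t * D)
    refine h1.trans ?_
    have h2 : e ^ (N - 1) * (k * (t * D)) ≤ D ^ S * (T * Γ + μ * hh) :=
      (mul_le_of_le_one_left (by positivity) heP1).trans a1
    have h3 : e ^ (N - 1) * (t * D * (t ^ (ps - 1) + b * t ^ (qs - 1))) ≤ D ^ S * Γ :=
      (mul_le_of_le_one_left (by positivity) heP1).trans a2
    have h4 := mul_le_mul_of_nonneg_left hle (by positivity : 0 ≤ K * (1 + A))
    have h5 : e ^ (N - 1) * t * D * (k + t ^ (ps - 1) + b * t ^ (qs - 1) + X ^ (p - 1) +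
        a * X ^ (q - 1)) ≤ ε * (e ^ N * (X ^ p + a * X ^ q)) +
      (2 + K * (1 + A)) * (D ^ S * (T * Γ + μ * hh)) := by
      linarith only [h2, h3, h4, hle, a3, a4]
    calc _ = M₁ * (e ^ (N - 1) * t * D * (k + t ^ (ps - 1) + b * t ^ (qs - 1) + X ^ (p - 1) +
        a * X ^ (q - 1))) := by ring
      _ ≤ _ := by gcongr
  have tB : e ^ N * t * g ≤ L * (ε * (e ^ N * (X ^ p + a * X ^ q)) +
      (2 + K * (1 + A)) * (D ^ S * (T * Γ + μ * hh))) := by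
    have hle : T * Γ + μ * hh ≤ D ^ S * (T * Γ + μ * hh) :=
      le_mul_of_one_le_left (by positivity) hDS
    have h1 := mul_le_mul_of_nonneg_left hg (by positivity : 0 ≤ e ^ N * t)
    refine h1.trans ?_
    have h5 : t * (d + t ^ (ps - 1) + b * t ^ (qs - 1) + X ^ (p / (ps / (ps - 1))) +
        a ^ ((n + 1) / n) * X ^ (q / (qs / (qs - 1)))) ≤
        ε * (X ^ p + a * X ^ q) + (2 + K) * (T * Γ + μ * hh) := by
      have e3 : t * (t ^ (ps - 1) + b * t ^ (qs - 1)) = Γ := by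
        rw [hΓ, ← htt ps, ← htt qs]; ring
      have e4 : K * Γ = K * t ^ ps + K * (b * t ^ qs) := by rw [hΓ]; ring
      have h6 := mul_le_mul_of_nonneg_left hle0 hK0.le
      linarith only [h6, e3, e4, b1, b3, b4, hle0]
    have h7 := mul_le_mul_of_nonneg_left h5 heN
    have h8 : e ^ N * ((2 + K) * (T * Γ + μ * hh)) ≤ (2 + K * (1 + A)) * (D ^ S * (T * Γ + μ * hh)) := by
      refine (mul_le_of_le_one_left (by positivity) heN1).trans ?_
      refine mul_le_mul ?_ hle (by positivity) (by positivity)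
      linarith only [mul_nonneg hK0.le hA]
    have h9 : e ^ N * (t * (d + t ^ (ps - 1) + b * t ^ (qs - 1) + X ^ (p / (ps / (ps - 1))) +
        a ^ ((n + 1) / n) * X ^ (q / (qs / (qs - 1))))) ≤ ε * (e ^ N * (X ^ p + a * X ^ q)) +
      (2 + K * (1 + A)) * (D ^ S * (T * Γ + μ * hh)) := by linarith only [h7, h8]
    calc _ = L * (e ^ N * (t * (d + t ^ (ps - 1) + b * t ^ (qs - 1) + X ^ (p / (ps / (ps - 1))) +
        a ^ ((n + 1) / n) * X ^ (q / (qs / (qs - 1)))))) := by ring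
      _ ≤ _ := by gcongr
  have tC : M₂ * (e ^ N * (X ^ p + a * X ^ q)) - 2 * M₃ * (D ^ S * (T * Γ + μ * hh)) ≤
      e ^ N * F₀ := by
    have hle : Γ ≤ D ^ S * (T * Γ + μ * hh) :=
      hle0.trans
        (le_mul_of_one_le_left (by positivity) hDS)
    have h1 := mul_le_mul_of_nonneg_left hF₀ heN
    have h2 : e ^ N * (M₃ * (Γ + 1)) ≤ 2 * M₃ * (D ^ S * (T * Γ + μ * hh)) := by
      refine (mul_le_of_le_one_left (by positivity) heN1).trans ?_
      have := mul_le_mul_of_nonneg_left hle hM₃.le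
      have h4 := mul_le_mul_of_nonneg_left hΓ1 hM₃.le
      linarith only [this, h4]
    linarith only [h1, h2]
  have tA' := mul_le_mul_of_nonneg_left tA hn0
  have hY : 0 ≤ e ^ N * (X ^ p + a * X ^ q) := by positivity
  have := mul_le_mul_of_nonneg_right hεM hY
  linarith only [this, tA', tB, tC]

section Truncation

variable {E : Type*} [NormedAddCommGroup E]

theorem LipschitzWith.exists_pow_of_le_one {η : E → ℝ} {K : NNReal} (hη : LipschitzWith K η)
    (h0 : ∀ x, 0 ≤ η x) (h1 : ∀ x, η x ≤ 1) {n : ℕ} (hn : n ≠ 0) :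
    ∃ M, LipschitzWith M fun x => η x ^ n := by
  obtain ⟨M, hM⟩ := hη.exists_rpow (g := fun _ => (n : ℝ)) (LipschitzWith.const _) h0 h1
    (fun _ => by exact_mod_cast Nat.one_le_iff_ne_zero.2 hn) (d := n) (fun _ => le_rfl)
  exact ⟨M, by simpa only [Real.rpow_natCast] using hM⟩

theorem HasCompactSupport.pow_of_ne_zero {η : E → ℝ} (hc : HasCompactSupport η) {n : ℕ}
    (hn : n ≠ 0) : HasCompactSupport fun x => η x ^ n :=
  hc.mono fun x hx h => hx (by simp [h, hn])

variable [InnerProductSpace ℝ E]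

theorem fderiv_posPart_sub_mul {u η : E → ℝ} {x : E} {c : ℝ} (hu : DifferentiableAt ℝ u x)
    (hη : DifferentiableAt ℝ η x) (hx : c < u x) :
    fderiv ℝ (fun x => max (u x - c) 0 * η x) x =
      (u x - c) • fderiv ℝ η x + η x • fderiv ℝ u x := by
  have h1 : (fun x => max (u x - c) 0 * η x) =ᶠ[nhds x] fun x => (u x - c) * η x := by
    filter_upwards [hu.continuousAt.eventually (lt_mem_nhds hx)] with z hz
    rw [max_eq_left (by linarith)]
  rw [h1.fderiv_eq, fderiv_fun_mul (hu.sub_const c) hη, fderiv_sub_const]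

theorem fderiv_posPart_sub_mul_pow {u η : E → ℝ} {x : E} {c : ℝ} (hu : DifferentiableAt ℝ u x)
    (hη : DifferentiableAt ℝ η x) (hx : c < u x) (n : ℕ) :
    fderiv ℝ (fun x => max (u x - c) 0 * η x ^ n) x =
      ((u x - c) * (n * η x ^ (n - 1))) • fderiv ℝ η x + η x ^ n • fderiv ℝ u x := by
  rw [fderiv_posPart_sub_mul hu (hη.fun_pow n) hx, fderiv_fun_pow n hη, smul_smul]
  simp [nsmul_eq_mul]

theorem fderiv_posPart_sub_mul_of_eq_zero {u η : E → ℝ} {x : E} {c : ℝ} (h0 : ∀ x, 0 ≤ η x)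
    (hx : max (u x - c) 0 * η x = 0) : fderiv ℝ (fun x => max (u x - c) 0 * η x) x = 0 :=
  IsLocalMin.fderiv_eq_zero (Eventually.of_forall fun z => by
    dsimp only
    rw [hx]
    exact mul_nonneg (le_max_right _ _) (h0 z))

variable [FiniteDimensional ℝ E]

theorem inner_gradient_right_eq_fderiv (f : E → ℝ) (x v : E) :
    inner ℝ v (gradient f x) = fderiv ℝ f x v := by
  rw [real_inner_comm, gradient, InnerProductSpace.toDual_symm_apply]

theorem norm_gradient_eq_norm_fderiv (f : E → ℝ) (x : E) : ‖gradient f x‖ = ‖fderiv ℝ f x‖ := by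
  simp [gradient]

theorem ContDiff.exists_lipschitzWith_posPart_sub_mul {u η : E → ℝ} {K : NNReal}
    (hu : ContDiff ℝ 1 u) (hη : LipschitzWith K η) (hc : HasCompactSupport η) (c : ℝ) :
    ∃ M, LipschitzWith M fun x => max (u x - c) 0 * η x := by
  obtain ⟨R, hR⟩ := hc.isCompact.isBounded.subset_closedBall (0 : E)
  let χ : ContDiffBump (0 : E) := ⟨max R 1, max R 1 + 1, by positivity, by linarith⟩
  have hχR : ∀ x ∈ tsupport η, χ x = 1 := fun x hx =>
    χ.one_of_mem_closedBall (Metric.closedBall_subset_closedBall (le_max_left _ _) (hR hx))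
  have h1 : ContDiff ℝ 1 fun x => χ x * u x := χ.contDiff.mul hu
  have h1c : HasCompactSupport fun x => χ x * u x := χ.hasCompactSupport.mul_right
  obtain ⟨C, hC⟩ := h1.lipschitzWith_of_hasCompactSupport h1c one_ne_zero
  obtain ⟨B, hB⟩ := h1c.exists_bound_of_continuous h1.continuous
  obtain ⟨B', hB'⟩ := hc.exists_bound_of_continuous hη.continuous
  have h2 : LipschitzWith C fun x => max (χ x * u x - c) 0 := by
    have := (hC.sub (LipschitzWith.const c)).max_const 0
    simpa using this
  obtain ⟨M, hM⟩ := h2.exists_mul hη (A := B + |c|) (B := B') (fun x => by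
    have h3 := hB x
    rw [Real.norm_eq_abs] at h3
    rw [abs_of_nonneg (le_max_right _ _)]
    refine max_le ?_ (add_nonneg ((norm_nonneg _).trans (hB x)) (abs_nonneg c))
    have := le_abs_self (χ x * u x)
    have := neg_abs_le c
    linarith) (fun x => hB' x)
  refine ⟨M, ?_⟩
  rw [show (fun x => max (u x - c) 0 * η x) = fun x => max (χ x * u x - c) 0 * η x from ?_]
  · exact hM
  funext x
  by_cases hx : x ∈ tsupport η
  · rw [hχR x hx, one_mul]
  · rw [image_eq_zero_of_notMem_tsupport hx, mul_zero, mul_zero]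

end Truncation

section Caccioppoli

variable {N : ℕ}

/-- The composed data of a weak solution `u` of a double phase problem with critical growth: `F` is
the flux, `g` the lower order term and `β` the potential term along `u`. -/
structure IsCriticalSolution (p q a ρ σ k d : EuclideanSpace ℝ (Fin N) → ℝ) (M₁ M₂ M₃ L : ℝ)
    (F : EuclideanSpace ℝ (Fin N) → EuclideanSpace ℝ (Fin N))
    (g β u : EuclideanSpace ℝ (Fin N) → ℝ) : Prop where
  contDiff : ContDiff ℝ 1 u
  locallyIntegrable_flux : LocallyIntegrable F
  locallyIntegrable_sub : LocallyIntegrable fun x => β x - g x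
  coercive : ∀ᵐ x, M₂ * Hfun p q a x ‖gradient u x‖ - M₃ * (critFun p q a x |u x| + 1) ≤
    inner ℝ (F x) (gradient u x)
  flux_le : ∀ᵐ x, ‖F x‖ ≤ M₁ * (|k x| + |u x| ^ (N * p x / (N - p x) - 1) +
    a x ^ (N / (N - q x)) * |u x| ^ (N * q x / (N - q x) - 1) +
    ‖gradient u x‖ ^ (p x - 1) + a x * ‖gradient u x‖ ^ (q x - 1))
  lower_le : ∀ᵐ x, |g x| ≤ L * (|d x| + |u x| ^ (N * p x / (N - p x) - 1) +
    a x ^ (N / (N - q x)) * |u x| ^ (N * q x / (N - q x) - 1) +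
    ‖gradient u x‖ ^ (p x / ((N * p x / (N - p x)) / (N * p x / (N - p x) - 1))) +
    a x ^ ((N + 1) / (N : ℝ)) *
      ‖gradient u x‖ ^ (q x / ((N * q x / (N - q x)) / (N * q x / (N - q x) - 1))))
  sign : ∀ᵐ x, 0 ≤ β x * u x
  weak : ∀ φ : EuclideanSpace ℝ (Fin N) → ℝ, ContDiff ℝ (⊤ : ℕ∞) φ → HasCompactSupport φ →
    (∫ x, inner ℝ (F x) (gradient φ x)) + ∫ x, (β x - g x) * φ x = 0

variable {p q a ρ σ k d : EuclideanSpace ℝ (Fin N) → ℝ} {M₁ M₂ M₃ L : ℝ}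

theorem gradient_neg_eq (u : EuclideanSpace ℝ (Fin N) → ℝ) (x) :
    gradient (fun x => -u x) x = -gradient u x := by
  simp only [gradient, fderiv_fun_neg, map_neg]

theorem IsCriticalSolution.neg {F : EuclideanSpace ℝ (Fin N) → EuclideanSpace ℝ (Fin N)}
    {g β u : EuclideanSpace ℝ (Fin N) → ℝ}
    (h : IsCriticalSolution p q a ρ σ k d M₁ M₂ M₃ L F g β u) :
    IsCriticalSolution p q a ρ σ k d M₁ M₂ M₃ L (fun x => -F x) (fun x => -g x) (fun x => -β x)
      (fun x => -u x) where
  contDiff := h.contDiff.neg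
  locallyIntegrable_flux := h.locallyIntegrable_flux.neg
  locallyIntegrable_sub := by
    convert h.locallyIntegrable_sub.neg using 2 with x
    simp only [Pi.neg_apply]
    ring
  coercive := by simpa only [gradient_neg_eq, norm_neg, abs_neg, inner_neg_neg] using h.coercive
  flux_le := by simpa only [gradient_neg_eq, norm_neg, abs_neg] using h.flux_le
  lower_le := by simpa only [gradient_neg_eq, norm_neg, abs_neg] using h.lower_le
  sign := by simpa only [neg_mul_neg] using h.sign
  weak := fun φ hφ hc => by
    have := h.weak φ hφ hc
    simp only [inner_neg_left, integral_neg]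
    have h2 : ∀ x, (-β x - -g x) * φ x = -((β x - g x) * φ x) := fun x => by ring
    simp only [h2, integral_neg]
    linarith

theorem CondD.exists_caccioppoli (hD : CondD N p q a)
    (hρ1 : ∀ x, 1 < ρ x) (hσ1 : ∀ x, 1 < σ x) (hρ : ∀ x, ρ x ≤ N * p x / (N - p x))
    (hσ : ∀ x, σ x ≤ N * p x / (N - p x))
    (hM₁ : 0 < M₁) (hM₂ : 0 < M₂) (hM₃ : 0 < M₃) (hL : 0 < L) :
    ∃ C > 0, ∃ S ≥ 1, (∀ x, N * q x / (N - q x) ≤ S) ∧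
    ∀ F g β u, IsCriticalSolution p q a ρ σ k d M₁ M₂ M₃ L F g β u →
      ∀ (U : Set (EuclideanSpace ℝ (Fin N))) (η : EuclideanSpace ℝ (Fin N) → ℝ) (D : NNReal)
        (c T μ : ℝ), MeasurableSet U → Bornology.IsBounded U → LipschitzWith D η → 1 ≤ D →
        (∀ x, 0 ≤ η x) → (∀ x, η x ≤ 1) → (∀ x ∉ U, η x = 0) → 1 ≤ c → 1 ≤ T → 0 < μ → μ ≤ 1 →
        (∀ x ∈ U, μ ^ (-(ρ x - 1)) ≤ T) → (∀ x ∈ U, μ ^ (-(σ x - 1)) ≤ T) →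
        IntegrableOn (fun x => |k x| ^ (ρ x / (ρ x - 1)) + |d x| ^ (σ x / (σ x - 1))) U →
        ∫ x in U ∩ {x | c < u x}, η x ^ N * Hfun p q a x ‖gradient u x‖ ≤
          C * D ^ S * (T * (∫ x in U ∩ {x | c < u x}, critFun p q a x (u x)) +
            μ * ∫ x in U, (|k x| ^ (ρ x / (ρ x - 1)) + |d x| ^ (σ x / (σ x - 1)))) := by
  obtain ⟨A, hA⟩ := hD.a_bdd
  obtain ⟨S, hS1, hS⟩ := hD.exists_qstar_le
  have hN1 := hD.one_lt_N
  have hN0 : N ≠ 0 := by rintro rfl; norm_num at hN1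
  obtain ⟨C, hC, hpt⟩ := exists_caccioppoli_pointwise N A S M₁ M₂ M₃ L
    ((hD.a_nonneg 0).trans (hA 0)) hM₁ hM₂ hM₃ hL
  refine ⟨C * (2 / M₂), by positivity, S, hS1, hS, ?_⟩
  intro F g β u hu U η D c T μ hU hUb hη hD1 hη0 hη1 hηU hc hT hμ hμ1 hμρ hμσ hh
  have hηc : HasCompactSupport η := by
    refine HasCompactSupport.of_support_subset_isCompact
      (Metric.isCompact_of_isClosed_isBounded isClosed_closure hUb.closure) fun x hx => ?_
    exact subset_closure (by_contra fun h => hx (hηU x h))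
  obtain ⟨D', hD'⟩ := hη.exists_pow_of_le_one hη0 hη1 hN0
  have hpc : HasCompactSupport fun x => η x ^ N := hηc.pow_of_ne_zero hN0
  obtain ⟨K, hK⟩ := hu.contDiff.exists_lipschitzWith_posPart_sub_mul hD' hpc c
  set φ : EuclideanSpace ℝ (Fin N) → ℝ := fun x => max (u x - c) 0 * η x ^ N with hφ
  have hφc : HasCompactSupport φ := hpc.mul_left
  have hweak := LipschitzWith.integral_inner_gradient_add_integral_mul_eq_zero volume
    hu.locallyIntegrable_flux hu.locallyIntegrable_sub hu.weak hK hφc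
  set h : EuclideanSpace ℝ (Fin N) → ℝ :=
    fun x => |k x| ^ (ρ x / (ρ x - 1)) + |d x| ^ (σ x / (σ x - 1)) with hhdef
  have hh0 : ∀ x, 0 ≤ h x := fun x => by rw [hhdef]; positivity
  have hucont := hu.contDiff.continuous
  have hgcont : Continuous fun x => ‖gradient u x‖ := by
    simp only [norm_gradient_eq_norm_fderiv]
    exact (hu.contDiff.continuous_fderiv one_ne_zero).norm
  have hSm : MeasurableSet {x | c < u x} := measurableSet_lt measurable_const hucont.measurable
  set W := U ∩ {x | c < u x} with hW
  have hWm : MeasurableSet W := hU.inter hSm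
  have hint : ∀ f : EuclideanSpace ℝ (Fin N) → ℝ, Continuous f → IntegrableOn f W := fun f hf =>
    (hf.locallyIntegrable.integrableOn_isCompact
      (Metric.isCompact_of_isClosed_isBounded isClosed_closure hUb.closure)).mono_set
      (Set.inter_subset_left.trans subset_closure)
  have i1 : IntegrableOn (fun x => η x ^ N * Hfun p q a x ‖gradient u x‖) W :=
    hint _ ((hη.continuous.pow N).mul (hD.continuous_Hfun continuous_id hgcont))
  have i2 : IntegrableOn (fun x => critFun p q a x (u x)) W :=
    hint _ (hD.continuous_critFun continuous_id hucont)
  have i3 : IntegrableOn h W := hh.mono_set Set.inter_subset_left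
  have j1 : Integrable fun x => inner ℝ (F x) (gradient φ x) := by
    have hm : AEStronglyMeasurable (fun x => inner ℝ (F x) (gradient φ x)) :=
      hu.locallyIntegrable_flux.aestronglyMeasurable.inner
        ((LinearIsometryEquiv.continuous _).measurable.comp
          (measurable_fderiv ℝ φ)).aestronglyMeasurable
    have hi : Integrable ((tsupport φ).indicator fun x => ‖F x‖ * K) := by
      rw [integrable_indicator_iff (isClosed_tsupport φ).measurableSet]
      exact (hu.locallyIntegrable_flux.integrableOn_isCompact hφc).norm.mul_const _
    refine hi.mono' hm (Eventually.of_forall fun x => ?_)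
    by_cases hx : x ∈ tsupport φ
    · rw [Set.indicator_of_mem hx]
      refine (norm_inner_le_norm _ _).trans ?_
      rw [norm_gradient_eq_norm_fderiv]
      exact mul_le_mul_of_nonneg_left (norm_fderiv_le_of_lipschitz ℝ hK) (norm_nonneg _)
    · rw [Set.indicator_of_notMem hx, inner_gradient_right_eq_fderiv,
        image_eq_zero_of_notMem_tsupport fun h' => hx (tsupport_fderiv_subset ℝ h')]
      simp
  have j2 : Integrable fun x => (β x - g x) * φ x := by
    have := hu.locallyIntegrable_sub.integrable_smul_right_of_hasCompactSupport hK.continuous hφc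
    simpa only [smul_eq_mul] using this
  have hle : ∀ᵐ x, W.indicator (fun x => M₂ / 2 * (η x ^ N * Hfun p q a x ‖gradient u x‖) -
      C * D ^ S * (T * critFun p q a x (u x) + μ * h x)) x ≤
      inner ℝ (F x) (gradient φ x) + (β x - g x) * φ x := by
    filter_upwards [hu.coercive, hu.flux_le, hu.lower_le, hu.sign, hη.ae_differentiableAt]
      with x h1 h2 h3 h4 hηd
    by_cases hx : x ∈ W
    · have hxu : c < u x := hx.2
      have ht : 1 ≤ u x := hc.trans hxu.le
      have habs : |u x| = u x := abs_of_nonneg (by linarith)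
      rw [habs] at h1 h2 h3
      have hud := (hu.contDiff.differentiable one_ne_zero) x
      have hφx : φ x = (u x - c) * η x ^ N := by rw [hφ]; dsimp only; rw [max_eq_left (by linarith)]
      rw [Set.indicator_of_mem hx, inner_gradient_right_eq_fderiv, hφx, hφ,
        fderiv_posPart_sub_mul_pow hud hηd hxu]
      have hlow := hpt (p x) (q x) (a x) (ρ x) (σ x) |k x| |d x| (u x) (η x) ‖gradient u x‖ D T μ
        _ _ _ (hD.one_lt_p x) (hD.p_lt_q x) (hD.q_lt_N x) (hD.q_le_pstar x) (hS x) (hD.a_nonneg x)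
        (hA x) (hρ1 x) (hσ1 x) (hρ x) (hσ x) (abs_nonneg _) (abs_nonneg _) ht (hη0 x) (hη1 x)
        (norm_nonneg _) (by exact_mod_cast hD1) hT hμ hμ1 (hμρ x hx.1) (hμσ x hx.1) h1 h2 h3
      have e1 : (((u x - c) * (N * η x ^ (N - 1))) • fderiv ℝ η x + η x ^ N • fderiv ℝ u x) (F x) =
          (u x - c) * (N * η x ^ (N - 1)) * fderiv ℝ η x (F x) +
            η x ^ N * inner ℝ (F x) (gradient u x) := by
        rw [inner_gradient_right_eq_fderiv]; simp
      have e2 : -(D * ‖F x‖) ≤ fderiv ℝ η x (F x) := by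
        have := (fderiv ℝ η x).le_opNorm (F x)
        have h5 := norm_fderiv_le_of_lipschitz ℝ hη (x₀ := x)
        rw [Real.norm_eq_abs] at this
        have h6 := neg_abs_le (fderiv ℝ η x (F x))
        have h7 := mul_le_mul_of_nonneg_right h5 (norm_nonneg (F x))
        linarith
      have e3 : (u x - c) * (N * η x ^ (N - 1)) * -(D * ‖F x‖) ≤
          (u x - c) * (N * η x ^ (N - 1)) * fderiv ℝ η x (F x) :=
        mul_le_mul_of_nonneg_left e2 (mul_nonneg (by linarith)
          (mul_nonneg (Nat.cast_nonneg _) (pow_nonneg (hη0 x) _)))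
      have e4 : 0 ≤ c * (N * η x ^ (N - 1)) * (D * ‖F x‖) := by
        have := pow_nonneg (hη0 x) (N - 1)
        positivity
      have e5 : 0 ≤ β x * ((u x - c) * η x ^ N) := by
        have hβ : 0 ≤ β x := nonneg_of_mul_nonneg_left h4 (by linarith)
        exact mul_nonneg hβ (mul_nonneg (by linarith) (pow_nonneg (hη0 x) _))
      have e6 : g x * ((u x - c) * η x ^ N) ≤ |g x| * (u x * η x ^ N) := by
        have := pow_nonneg (hη0 x) N
        refine mul_le_mul (le_abs_self _) ?_ (mul_nonneg (by linarith) this) (abs_nonneg _)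
        gcongr; linarith
      rw [e1]
      simp only [Hfun, critFun]
      linarith only [e3, e4, e5, e6, hlow]
    · have hφ0 : φ x = 0 := by
        by_cases hxU : x ∈ U
        · have : u x ≤ c := not_lt.1 fun h' => hx ⟨hxU, h'⟩
          rw [hφ]; dsimp only
          rw [max_eq_right (by linarith), zero_mul]
        · rw [hφ]; dsimp only
          rw [hηU x hxU, zero_pow hN0, mul_zero]
      have hd0 : fderiv ℝ φ x = 0 :=
        fderiv_posPart_sub_mul_of_eq_zero (fun x => pow_nonneg (hη0 x) N) hφ0
      rw [Set.indicator_of_notMem hx, inner_gradient_right_eq_fderiv, hφ0, hd0]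
      simp
  have i5 : IntegrableOn (fun x => T * critFun p q a x (u x) + μ * h x) W :=
    (i2.const_mul T).add (i3.const_mul μ)
  have i4 : IntegrableOn (fun x => M₂ / 2 * (η x ^ N * Hfun p q a x ‖gradient u x‖) -
      C * D ^ S * (T * critFun p q a x (u x) + μ * h x)) W :=
    (i1.const_mul _).sub (i5.const_mul _)
  have hmono := integral_mono_ae ((integrable_indicator_iff hWm).2 i4) (j1.add j2) hle
  rw [integral_indicator hWm] at hmono
  simp only [Pi.add_apply] at hmono
  rw [integral_add j1 j2, hweak, integral_sub (i1.const_mul _)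
    (i5.const_mul _), integral_const_mul, integral_const_mul,
    integral_add (i2.const_mul T) (i3.const_mul μ), integral_const_mul, integral_const_mul] at hmono
  have hle3 : ∫ x in W, h x ≤ ∫ x in U, h x :=
    setIntegral_mono_set hh (Eventually.of_forall hh0)
      (Eventually.of_forall fun x hx => hx.1)
  have h7 : C * D ^ S * (μ * ∫ x in W, h x) ≤ C * D ^ S * (μ * ∫ x in U, h x) := by gcongr
  have h8 : M₂ / 2 * ∫ x in W, η x ^ N * Hfun p q a x ‖gradient u x‖ ≤
      C * D ^ S * (T * (∫ x in W, critFun p q a x (u x)) + μ * ∫ x in U, h x) := by linarith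
  calc _ = 2 / M₂ * (M₂ / 2 * ∫ x in W, η x ^ N * Hfun p q a x ‖gradient u x‖) := by
        field_simp
    _ ≤ 2 / M₂ * (C * D ^ S * (T * (∫ x in W, critFun p q a x (u x)) + μ * ∫ x in U, h x)) := by
        gcongr
    _ = _ := by ring

end Caccioppoli

namespace CondD

variable {N : ℕ} {p q a : EuclideanSpace ℝ (Fin N) → ℝ}

theorem Hfun_mono (hD : CondD N p q a) (x) {s t : ℝ} (hs : 0 ≤ s) (hst : s ≤ t) :
    Hfun p q a x s ≤ Hfun p q a x t :=
  add_le_add (Real.rpow_le_rpow hs hst (zero_le_one.trans (hD.one_lt_p x).le))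
    (mul_le_mul_of_nonneg_left (Real.rpow_le_rpow hs hst (zero_le_one.trans (hD.one_lt_q x).le))
      (hD.a_nonneg x))

theorem Hfun_mul_le (hD : CondD N p q a) {S : ℝ} (hS : ∀ x, N * q x / (N - q x) ≤ S) (x)
    {m t : ℝ} (hm : 1 ≤ m) (ht : 0 ≤ t) : Hfun p q a x (m * t) ≤ m ^ S * Hfun p q a x t := by
  have h0 := (hD.q_lt_qstar x).trans_le (hS x)
  have h1 : m ^ p x ≤ m ^ S :=
    Real.rpow_le_rpow_of_exponent_le hm ((hD.p_lt_q x).le.trans h0.le)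
  have h2 : m ^ q x ≤ m ^ S := Real.rpow_le_rpow_of_exponent_le hm h0.le
  have hm0 : 0 ≤ m := by linarith
  rw [Hfun, Hfun, Real.mul_rpow hm0 ht, Real.mul_rpow hm0 ht]
  have h3 := mul_le_mul_of_nonneg_right h1 (Real.rpow_nonneg ht (p x))
  have h4 := mul_le_mul_of_nonneg_left (mul_le_mul_of_nonneg_right h2 (Real.rpow_nonneg ht (q x)))
    (hD.a_nonneg x)
  linarith

theorem Hfun_add_le (hD : CondD N p q a) {S : ℝ} (hS : ∀ x, N * q x / (N - q x) ≤ S) (x)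
    {s t : ℝ} (hs : 0 ≤ s) (ht : 0 ≤ t) :
    Hfun p q a x (s + t) ≤ 2 ^ S * (Hfun p q a x s + Hfun p q a x t) := by
  have h0 : (0 : ℝ) ≤ 2 ^ S := by positivity
  have hs' := hD.Hfun_nonneg x hs
  have ht' := hD.Hfun_nonneg x ht
  rcases le_total s t with h | h
  · refine ((hD.Hfun_mono x (by positivity) (by linarith : s + t ≤ 2 * t)).trans
      (hD.Hfun_mul_le hS x one_le_two ht)).trans ?_
    exact mul_le_mul_of_nonneg_left (by linarith) h0
  · refine ((hD.Hfun_mono x (by positivity) (by linarith : s + t ≤ 2 * s)).trans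
      (hD.Hfun_mul_le hS x one_le_two hs)).trans ?_
    exact mul_le_mul_of_nonneg_left (by linarith) h0

theorem Hfun_pow_mul_le (hD : CondD N p q a) (x) {s t : ℝ} (hs : 0 ≤ s) (hs1 : s ≤ 1)
    (ht : 0 ≤ t) : Hfun p q a x (s * t) ≤ s * Hfun p q a x t := by
  have h : ∀ e : ℝ, 1 < e → s ^ e ≤ s := fun e he => by
    simpa using Real.rpow_le_rpow_of_exponent_ge' hs hs1 zero_le_one he.le
  rw [Hfun, Hfun, Real.mul_rpow hs ht, Real.mul_rpow hs ht]
  have h3 := mul_le_mul_of_nonneg_right (h _ (hD.one_lt_p x)) (Real.rpow_nonneg ht (p x))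
  have h4 := mul_le_mul_of_nonneg_left (mul_le_mul_of_nonneg_right (h _ (hD.one_lt_q x))
    (Real.rpow_nonneg ht (q x))) (hD.a_nonneg x)
  linarith

theorem Hfun_le_critFun (hD : CondD N p q a) {A : ℝ} (hA : ∀ x, a x ≤ A) (x) {t : ℝ}
    (ht : 1 ≤ t) : Hfun p q a x t ≤ (1 + A) * critFun p q a x t := by
  have h1 : t ^ p x ≤ t ^ (N * p x / (N - p x)) :=
    Real.rpow_le_rpow_of_exponent_le ht (hD.p_lt_pstar x).le
  have h2 : t ^ q x ≤ t ^ (N * p x / (N - p x)) :=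
    Real.rpow_le_rpow_of_exponent_le ht (hD.q_le_pstar x)
  have h3 : a x * t ^ q x ≤ A * t ^ (N * p x / (N - p x)) :=
    mul_le_mul (hA x) h2 (by positivity) ((hD.a_nonneg x).trans (hA x))
  have h4 : 0 ≤ a x ^ (N / (N - q x)) * t ^ (N * q x / (N - q x)) :=
    mul_nonneg (Real.rpow_nonneg (hD.a_nonneg x) _) (by positivity)
  have h5 := mul_nonneg (by linarith [(hD.a_nonneg x).trans (hA x)] : 0 ≤ 1 + A) h4
  rw [Hfun, critFun]
  linarith

theorem critFun_mul_le (hD : CondD N p q a) {S : ℝ} (hS : ∀ x, N * q x / (N - q x) ≤ S) (x)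
    {m t : ℝ} (hm : 1 ≤ m) (ht : 0 ≤ t) :
    critFun p q a x (m * t) ≤ m ^ S * critFun p q a x t := by
  have h1 : m ^ (N * p x / (N - p x)) ≤ m ^ S :=
    Real.rpow_le_rpow_of_exponent_le hm ((hD.pstar_lt_qstar x).le.trans (hS x))
  have h2 : m ^ (N * q x / (N - q x)) ≤ m ^ S := Real.rpow_le_rpow_of_exponent_le hm (hS x)
  have hm0 : 0 ≤ m := by linarith
  rw [critFun, critFun, Real.mul_rpow hm0 ht, Real.mul_rpow hm0 ht]
  have h3 := mul_le_mul_of_nonneg_right h1 (Real.rpow_nonneg ht (N * p x / (N - p x)))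
  have h4 := mul_le_mul_of_nonneg_left (mul_le_mul_of_nonneg_right h2
    (Real.rpow_nonneg ht (N * q x / (N - q x))))
    (Real.rpow_nonneg (hD.a_nonneg x) (N / (N - q x)))
  linarith

theorem one_le_critFun (hD : CondD N p q a) (x) {t : ℝ} (ht : 1 ≤ t) :
    1 ≤ critFun p q a x t := by
  have h1 : 1 ≤ t ^ (N * p x / (N - p x)) := Real.one_le_rpow ht
    (by linarith [hD.one_lt_p x, hD.p_lt_pstar x])
  have h4 : 0 ≤ a x ^ (N / (N - q x)) * t ^ (N * q x / (N - q x)) :=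
    mul_nonneg (Real.rpow_nonneg (hD.a_nonneg x) _) (by positivity)
  rw [critFun]
  linarith

theorem Hfun_cutoff_le (hD : CondD N p q a) {S A : ℝ} (hS1 : 1 ≤ S)
    (hS : ∀ x, N * q x / (N - q x) ≤ S) (hA : ∀ x, a x ≤ A) (x) {e D X t G : ℝ} (he : 0 ≤ e)
    (he1 : e ≤ 1) (hDD : 1 ≤ D) (hX : 0 ≤ X) (ht : 1 ≤ t) (hG0 : 0 ≤ G)
    (hG : G ≤ N * D * t + e ^ N * X) :
    Hfun p q a x G ≤ 2 ^ S * (N ^ S * (1 + A)) *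
      (e ^ N * Hfun p q a x X + D ^ S * critFun p q a x t) := by
  have hN : (1 : ℝ) ≤ N := hD.one_lt_N.le
  have hA0 := (hD.a_nonneg x).trans (hA x)
  have hND : 1 ≤ N * D := one_le_mul_of_one_le_of_one_le hN hDD
  have h1 := (hD.Hfun_mono x hG0 hG).trans
    (hD.Hfun_add_le hS x (by positivity) (by positivity))
  have h2 := hD.Hfun_mul_le hS x hND (by linarith : 0 ≤ t)
  have h3 := hD.Hfun_pow_mul_le x (pow_nonneg he N) (pow_le_one₀ he he1) hX
  have h4 := hD.Hfun_le_critFun hA x ht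
  have hX' : 0 ≤ e ^ N * Hfun p q a x X := mul_nonneg (pow_nonneg he N) (hD.Hfun_nonneg x hX)
  have ht' := hD.critFun_nonneg x (by linarith : 0 ≤ t)
  have hDS : 0 ≤ D ^ S := by positivity
  rw [Real.mul_rpow (by linarith) (by linarith)] at h2
  have h5 : (1 : ℝ) ≤ N ^ S * (1 + A) :=
    one_le_mul_of_one_le_of_one_le (Real.one_le_rpow hN (by linarith)) (by linarith)
  refine h1.trans ?_
  have h2S : (0 : ℝ) ≤ 2 ^ S := by positivity
  rw [mul_assoc (2 ^ S : ℝ)]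
  refine mul_le_mul_of_nonneg_left ?_ h2S
  rw [mul_add, add_comm]
  refine add_le_add (h3.trans (le_mul_of_one_le_left hX' h5)) ?_
  calc Hfun p q a x (N * D * t) ≤ (N ^ S * D ^ S) * Hfun p q a x t := h2
    _ ≤ (N ^ S * D ^ S) * ((1 + A) * critFun p q a x t) :=
      mul_le_mul_of_nonneg_left h4 (by positivity)
    _ = _ := by ring

variable {ρ σ k d : EuclideanSpace ℝ (Fin N) → ℝ} {M₁ M₂ M₃ L : ℝ}

theorem exists_truncation_estimate (hD : CondD N p q a)
    (hρ1 : ∀ x, 1 < ρ x) (hσ1 : ∀ x, 1 < σ x) (hρ : ∀ x, ρ x ≤ N * p x / (N - p x))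
    (hσ : ∀ x, σ x ≤ N * p x / (N - p x))
    (hM₁ : 0 < M₁) (hM₂ : 0 < M₂) (hM₃ : 0 < M₃) (hL : 0 < L) :
    ∃ C > 0, ∃ S ≥ 1, (∀ x, N * q x / (N - q x) ≤ S) ∧
    ∀ F g β u, IsCriticalSolution p q a ρ σ k d M₁ M₂ M₃ L F g β u →
      ∀ (U : Set (EuclideanSpace ℝ (Fin N))) (η : EuclideanSpace ℝ (Fin N) → ℝ) (D : NNReal)
        (c T μ l P : ℝ), MeasurableSet U → Bornology.IsBounded U → LipschitzWith D η → 1 ≤ D →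
        (∀ x, 0 ≤ η x) → (∀ x, η x ≤ 1) → (∀ x ∉ U, η x = 0) → 1 ≤ c → 1 ≤ T → 0 < μ → μ ≤ 1 →
        1 ≤ l → (∀ x ∈ U, P ≤ p x) →
        (∀ x ∈ U, μ ^ (-(ρ x - 1)) ≤ T) → (∀ x ∈ U, μ ^ (-(σ x - 1)) ≤ T) →
        IntegrableOn (fun x => |k x| ^ (ρ x / (ρ x - 1)) + |d x| ^ (σ x / (σ x - 1))) U →
        ∫ x, critFun p q a x (max (u x - c) 0 * η x ^ N) ≤
          C * (D ^ S * (l * (∫ x in U ∩ {x | c < u x}, critFun p q a x (u x)) +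
            l ^ (-(P - 1)) * (T * (∫ x in U ∩ {x | c < u x}, critFun p q a x (u x)) +
            μ * ∫ x in U, (|k x| ^ (ρ x / (ρ x - 1)) + |d x| ^ (σ x / (σ x - 1)))))) ^
              ((N : ℝ) / (N - 1)) := by
  obtain ⟨C0, hC0, S, hS1, hS, hcac⟩ := hD.exists_caccioppoli (k := k) (d := d) hρ1 hσ1 hρ hσ
    hM₁ hM₂ hM₃ hL
  obtain ⟨C1, hC1, hsob⟩ := hD.exists_sobolev
  obtain ⟨A, hA⟩ := hD.a_bdd
  have hN1 := hD.one_lt_N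
  have hN0 : N ≠ 0 := by rintro rfl; norm_num at hN1
  have hA0 := (hD.a_nonneg 0).trans (hA 0)
  set C2 : ℝ := 2 ^ S * (N ^ S * (1 + A)) with hC2
  have hC2p : 0 < C2 := by positivity
  set C3 : ℝ := 2 + C2 + C2 * C0 with hC3
  have hC3p : 0 < C3 := by positivity
  refine ⟨C1 * C3 ^ ((N : ℝ) / (N - 1)), by positivity, S, hS1, hS, ?_⟩
  intro F g β u hu U η D c T μ l P hU hUb hη hD1 hη0 hη1 hηU hc hT hμ hμ1 hl hP hμρ hμσ hh
  have hD1' : (1 : ℝ) ≤ D := by exact_mod_cast hD1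
  have hcc := hcac F g β u hu U η D c T μ hU hUb hη hD1 hη0 hη1 hηU hc hT hμ hμ1 hμρ hμσ hh
  have hηc : HasCompactSupport η := by
    refine HasCompactSupport.of_support_subset_isCompact
      (Metric.isCompact_of_isClosed_isBounded isClosed_closure hUb.closure) fun x hx => ?_
    exact subset_closure (by_contra fun h => hx (hηU x h))
  obtain ⟨D', hD'⟩ := hη.exists_pow_of_le_one hη0 hη1 hN0
  have hpc : HasCompactSupport fun x => η x ^ N := hηc.pow_of_ne_zero hN0
  obtain ⟨K, hK⟩ := hu.contDiff.exists_lipschitzWith_posPart_sub_mul hD' hpc c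
  set w : EuclideanSpace ℝ (Fin N) → ℝ := fun x => max (u x - c) 0 * η x ^ N with hw
  have hwc : HasCompactSupport w := hpc.mul_left
  have hw0 : ∀ x, 0 ≤ w x := fun x => mul_nonneg (le_max_right _ _) (pow_nonneg (hη0 x) _)
  have hucont := hu.contDiff.continuous
  have hgcont : Continuous fun x => ‖gradient u x‖ := by
    simp only [norm_gradient_eq_norm_fderiv]
    exact (hu.contDiff.continuous_fderiv one_ne_zero).norm
  set W := U ∩ {x | c < u x} with hW
  have hwW : {x | 0 < w x} ⊆ W := fun x hx => by
    refine ⟨by_contra fun h => ?_, ?_⟩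
    · have hx : 0 < w x := hx
      simp [hw, hηU x h, hN0] at hx
    · by_contra h
      have hx : 0 < w x := hx
      simp only [Set.mem_ofPred_eq, not_lt] at h
      simp [hw, max_eq_right (by linarith : u x - c ≤ 0)] at hx
  have hWm : MeasurableSet W := hU.inter (measurableSet_lt measurable_const hucont.measurable)
  have hint : ∀ f : EuclideanSpace ℝ (Fin N) → ℝ, Continuous f → IntegrableOn f W := fun f hf =>
    (hf.locallyIntegrable.integrableOn_isCompact
      (Metric.isCompact_of_isClosed_isBounded isClosed_closure hUb.closure)).mono_set
      (Set.inter_subset_left.trans subset_closure)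
  have i1 : IntegrableOn (fun x => η x ^ N * Hfun p q a x ‖gradient u x‖) W :=
    hint _ ((hη.continuous.pow N).mul (hD.continuous_Hfun continuous_id hgcont))
  have i2 : IntegrableOn (fun x => critFun p q a x (u x)) W :=
    hint _ (hD.continuous_critFun continuous_id hucont)
  set lP : ℝ := l ^ (-(P - 1)) with hlP
  have hlP0 : 0 ≤ lP := Real.rpow_nonneg (by linarith) _
  have hDS : 1 ≤ (D : ℝ) ^ S := Real.one_le_rpow hD1' (by linarith)
  set G : EuclideanSpace ℝ (Fin N) → ℝ := fun x =>
    (l + 1 + lP * C2 * D ^ S) * critFun p q a x (u x) +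
      (lP * C2) * (η x ^ N * Hfun p q a x ‖gradient u x‖) with hG
  have hGi : IntegrableOn G W := (i2.const_mul _).add (i1.const_mul _)
  have hmain := hsob w K hK hwc hw0 l hl P (fun x hx => hP x (hwW hx).1) G (hGi.mono_set hwW) (by
    filter_upwards [hη.ae_differentiableAt] with x hηx hx
    obtain ⟨hxU, hxc⟩ := hwW hx
    have hxc : c < u x := hxc
    have hux : 1 ≤ u x := by linarith
    have hcrit := hD.critFun_nonneg x (by linarith : 0 ≤ u x)
    have hw_le : w x ≤ u x := by
      have h1 : max (u x - c) 0 ≤ u x := max_le (by linarith) (by linarith)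
      exact (mul_le_of_le_one_right (le_max_right _ _) (pow_le_one₀ (hη0 x) (hη1 x))).trans h1
    have hg : ‖fderiv ℝ w x‖ ≤ N * D * u x + η x ^ N * ‖gradient u x‖ := by
      rw [hw, fderiv_posPart_sub_mul_pow (hu.contDiff.differentiable one_ne_zero x) hηx hxc,
        norm_gradient_eq_norm_fderiv]
      refine (norm_add_le _ _).trans (add_le_add ?_ ?_)
      · rw [norm_smul, Real.norm_of_nonneg (mul_nonneg (by linarith)
          (mul_nonneg (by positivity) (pow_nonneg (hη0 x) _)))]
        have h1 : ‖fderiv ℝ η x‖ ≤ D := norm_fderiv_le_of_lipschitz ℝ hη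
        have h2 : η x ^ (N - 1) ≤ 1 := pow_le_one₀ (hη0 x) (hη1 x)
        calc (u x - c) * (N * η x ^ (N - 1)) * ‖fderiv ℝ η x‖
            ≤ u x * (N * 1) * D := by
              gcongr
              · exact mul_nonneg (by positivity) (pow_nonneg (hη0 x) _)
              · linarith
          _ = _ := by ring
      · rw [norm_smul, Real.norm_of_nonneg (pow_nonneg (hη0 x) _)]
    have h1 := hD.Hfun_cutoff_le hS1 hS hA x (hη0 x) (hη1 x) hD1' (norm_nonneg (gradient u x))
      hux (norm_nonneg _) hg
    have h2 := mul_le_mul_of_nonneg_left h1 hlP0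
    have h3 := mul_le_mul_of_nonneg_left (hD.critFun_mono x (hw0 x) hw_le)
      (by linarith : 0 ≤ l)
    have h4 := hD.one_le_critFun x hux
    simp only [hG]
    linarith)
  have hG0 : ∀ x ∈ W, 0 ≤ G x := fun x hx => by
    have hxc : c < u x := hx.2
    have h1 := hD.critFun_nonneg x (by linarith : 0 ≤ u x)
    have h2 := hD.Hfun_nonneg x (norm_nonneg (gradient u x))
    have h3 := pow_nonneg (hη0 x) N
    simp only [hG]
    positivity
  have hGle : ∫ x in {x | 0 < w x}, G x ≤ ∫ x in W, G x :=
    setIntegral_mono_set hGi (ae_restrict_of_forall_mem hWm hG0)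
      (Eventually.of_forall hwW)
  have hG0' : 0 ≤ ∫ x in {x | 0 < w x}, G x :=
    setIntegral_nonneg (measurableSet_lt measurable_const hK.continuous.measurable)
      fun x hx => hG0 x (hwW hx)
  have hGeq : ∫ x in W, G x = (l + 1 + lP * C2 * D ^ S) * (∫ x in W, critFun p q a x (u x)) +
      (lP * C2) * ∫ x in W, η x ^ N * Hfun p q a x ‖gradient u x‖ := by
    simp only [hG]
    rw [integral_add (i2.const_mul _) (i1.const_mul _), integral_const_mul, integral_const_mul]
  have hZ0 : 0 ≤ ∫ x in W, critFun p q a x (u x) := setIntegral_nonneg hWm fun x hx => by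
    have hxc : c < u x := hx.2
    exact hD.critFun_nonneg x (by linarith)
  have hI0 : 0 ≤ ∫ x in U, (|k x| ^ (ρ x / (ρ x - 1)) + |d x| ^ (σ x / (σ x - 1))) :=
    integral_nonneg fun x => by positivity
  set Z := ∫ x in W, critFun p q a x (u x)
  set I := ∫ x in U, (|k x| ^ (ρ x / (ρ x - 1)) + |d x| ^ (σ x / (σ x - 1)))
  have hfin : ∫ x in {x | 0 < w x}, G x ≤
      C3 * (D ^ S * (l * Z + lP * (T * Z + μ * I))) := by
    refine hGle.trans (hGeq.le.trans ?_)
    have h1 := mul_le_mul_of_nonneg_left hcc (by positivity : 0 ≤ lP * C2)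
    have h2 : (l + 1) * Z ≤ 2 * (D ^ S * (l * Z)) := by
      have : (l + 1) * Z ≤ 2 * (l * Z) := by nlinarith
      have h3 : l * Z ≤ D ^ S * (l * Z) := le_mul_of_one_le_left (by positivity) hDS
      linarith
    have h3 : lP * C2 * D ^ S * Z ≤ C2 * (D ^ S * (lP * (T * Z + μ * I))) := by
      have h4 : Z ≤ T * Z + μ * I := by
        have := le_mul_of_one_le_left hZ0 hT
        have : 0 ≤ μ * I := by positivity
        linarith
      have h5 := mul_le_mul_of_nonneg_left h4 (by positivity : 0 ≤ lP * C2 * D ^ S)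
      linarith
    have hx1 : 0 ≤ D ^ S * (l * Z) := by positivity
    have hx2 : 0 ≤ D ^ S * (lP * (T * Z + μ * I)) := by positivity
    have hx3 : 0 ≤ C2 * C0 * (D ^ S * (l * Z)) := by positivity
    have hx4 : 0 ≤ C2 * (D ^ S * (l * Z)) := by positivity
    rw [hC3]
    linarith
  refine hmain.trans ?_
  rw [mul_assoc, ← Real.mul_rpow hC3p.le (by positivity)]
  refine mul_le_mul_of_nonneg_left (Real.rpow_le_rpow hG0' hfin ?_) hC1.le
  exact div_nonneg (by linarith) (by linarith)

end CondD

/-- A nonnegative sequence with superlinear geometric recursion and small initial value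
tends to zero. -/
theorem exists_tendsto_zero_of_superlinear_recursion {C b γ : ℝ} (hC : 0 < C) (hb : 1 < b)
    (hγ : 1 < γ) : ∃ z > 0, ∀ Z : ℕ → ℝ, (∀ n, 0 ≤ Z n) →
      (∀ n, Z n ≤ 1 → Z (n + 1) ≤ C * b ^ n * Z n ^ γ) → Z 0 ≤ z →
      Tendsto Z atTop (nhds 0) := by
  obtain ⟨δ, rfl⟩ : ∃ δ, γ = 1 + δ := ⟨γ - 1, by ring⟩
  have hδ : 0 < δ := by linarith
  have hb0 : 0 < b := by linarith
  set s : ℝ := b ^ (-(1 / δ)) with hs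
  have hs0 : 0 < s := Real.rpow_pos_of_pos hb0 _
  have hs1 : s < 1 := Real.rpow_lt_one_of_one_lt_of_neg hb (by simp [hδ])
  have hsδ : s ^ δ = b⁻¹ := by
    rw [hs, ← Real.rpow_mul hb0.le, ← Real.rpow_neg_one]
    congr 1
    field_simp
  set z : ℝ := min 1 ((s / C) ^ (1 / δ)) with hz
  have hz0 : 0 < z := lt_min one_pos (by positivity)
  have hzδ : C * z ^ δ ≤ s := by
    have h1 : z ^ δ ≤ ((s / C) ^ (1 / δ)) ^ δ :=
      Real.rpow_le_rpow hz0.le (min_le_right _ _) hδ.le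
    rw [← Real.rpow_mul (by positivity), one_div_mul_cancel hδ.ne', Real.rpow_one] at h1
    rwa [le_div_iff₀' hC] at h1
  refine ⟨z, hz0, fun Z hZ0 hrec hZz => ?_⟩
  have hle : ∀ n, Z n ≤ z * s ^ n := by
    intro n
    induction n with
    | zero => simpa using hZz
    | succ n ih =>
      have hsn : s ^ n ≤ 1 := pow_le_one₀ hs0.le hs1.le
      have h1 : Z n ≤ 1 := ih.trans (mul_le_one₀ (min_le_left _ _) (by positivity) hsn)
      have h2 : (s ^ n) ^ δ = (b ^ n)⁻¹ := by
        rw [← Real.rpow_natCast, ← Real.rpow_mul hs0.le, mul_comm, Real.rpow_mul hs0.le, hsδ,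
          Real.rpow_natCast, inv_pow]
      calc Z (n + 1) ≤ C * b ^ n * Z n ^ (1 + δ) := hrec n h1
        _ ≤ C * b ^ n * (z * s ^ n) ^ (1 + δ) := by gcongr; exact hZ0 n
        _ = (C * z ^ δ) * z * s ^ n := by
          rw [Real.rpow_add (by positivity), Real.rpow_one, Real.mul_rpow hz0.le (by positivity),
            h2]
          field_simp
        _ ≤ s * z * s ^ n := by gcongr
        _ = z * s ^ (n + 1) := by ring
  refine squeeze_zero hZ0 hle ?_
  simpa using (tendsto_pow_atTop_nhds_zero_of_lt_one hs0.le hs1).const_mul z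

theorem LipschitzWith.cutoff {E : Type*} [PseudoMetricSpace E] (y : E) (R : ℝ) (D : NNReal) :
    LipschitzWith D fun x => max 0 (min 1 (D * (R - dist x y))) := by
  have h1 : LipschitzWith D fun x => (D : ℝ) * (R - dist x y) := by
    refine LipschitzWith.of_dist_le_mul fun x z => ?_
    rw [Real.dist_eq, ← mul_sub, abs_mul, NNReal.abs_eq]
    refine mul_le_mul_of_nonneg_left ?_ D.2
    rw [sub_sub_sub_cancel_left, dist_comm x z]
    exact abs_dist_sub_le _ _ _
  exact (h1.const_min 1).const_max 0

namespace CondD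

variable {N : ℕ} {p q a : EuclideanSpace ℝ (Fin N) → ℝ}
variable {ρ σ k d : EuclideanSpace ℝ (Fin N) → ℝ} {M₁ M₂ M₃ L : ℝ}

theorem exists_recursion_exponent (hD : CondD N p q a) (hρ0 : ∀ x, 0 < ρ x) (hσ0 : ∀ x, 0 < σ x)
    (hκ : ∃ c > (0 : ℝ), ∀ x, c ≤ N * p x / (N - p x) / q x - max (ρ x) (σ x)) :
    ∃ θ ε : ℝ, 0 < θ ∧ θ < 1 / N ∧ 0 < ε ∧ ε ≤ 1 ∧ ∀ x P, p x - ε ≤ P → P ≤ p x →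
      (1 - θ * P) * ρ x ≤ 1 ∧ (1 - θ * P) * σ x ≤ 1 := by
  obtain ⟨c, hc, hκ⟩ := hκ
  obtain ⟨Q, hQN, hQ⟩ := hD.sup_q
  have hN := hD.one_lt_N
  have hN0 : (0 : ℝ) < N := by linarith
  set g : ℝ := N - Q with hg
  have hg0 : 0 < g := by rw [hg]; linarith
  set e : ℝ := c * g ^ 2 / N ^ 2 with he
  have he0 : 0 < e := by positivity
  set δ : ℝ := min (e / (2 * N)) (1 / (2 * N)) with hδ
  have hδ0 : 0 < δ := lt_min (by positivity) (by positivity)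
  have hδ1 : δ * N ≤ e / 2 := by
    have : δ ≤ e / (2 * N) := min_le_left _ _
    rw [le_div_iff₀ (by positivity)] at this
    linarith
  have hδ2 : δ ≤ 1 / (2 * N) := min_le_right _ _
  have hδ3 : δ < 1 / N := hδ2.trans_lt (one_div_lt_one_div_of_lt hN0 (by linarith))
  set ε : ℝ := min 1 (e * N / 2) with hε
  have hε0 : 0 < ε := lt_min one_pos (by positivity)
  have hε1 : ε / N ≤ e / 2 := by
    rw [div_le_iff₀ hN0]
    have : ε ≤ e * N / 2 := min_le_right _ _
    linarith
  refine ⟨1 / N - δ, ε, by linarith, by linarith, hε0, min_le_left _ _, fun x P hP1 hP2 => ?_⟩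
  have hpx := hD.p_lt_N x
  have hp1 := hD.one_lt_p x
  have hpQ : p x ≤ Q := (hD.p_lt_q x).le.trans (hQ x)
  have hpos : 0 < N - p x := by linarith
  have hF0 : 0 ≤ 1 - (1 / N - δ) * P := by
    have h1 : P * (1 / N - δ) ≤ N * (1 / N) := by
      refine mul_le_mul (by linarith) (by linarith) (by linarith) hN0.le
    rw [mul_one_div_cancel hN0.ne'] at h1
    linarith
  have hF : 1 - (1 / N - δ) * P ≤ (N - p x) / N + e := by
    have h1 : δ * P ≤ δ * N := mul_le_mul_of_nonneg_left (by linarith) hδ0.le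
    have h2 : (p x - ε) / N ≤ P / N := div_le_div_of_nonneg_right hP1 hN0.le
    have h3 : (N - p x) / N = 1 - p x / N := by field_simp
    rw [sub_div] at h2
    rw [sub_mul, one_div_mul_eq_div, h3]
    linarith
  have hB : ∀ τ : ℝ, 0 < τ → τ ≤ max (ρ x) (σ x) → (1 - (1 / N - δ) * P) * τ ≤ 1 := by
    intro τ hτ0 hτ
    have h1 : N * p x / (N - p x) / q x ≤ N / (N - p x) := by
      rw [div_div, div_le_div_iff₀ (mul_pos hpos (by linarith [hD.one_lt_q x])) hpos]
      have := mul_le_mul_of_nonneg_left (hD.p_lt_q x).le (by positivity : 0 ≤ N * (N - p x))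
      linarith
    have h2 : τ ≤ N / (N - p x) - c := by linarith [hκ x]
    have h3 : e * (N / (N - p x)) ≤ c * ((N - p x) / N) := by
      have h4 : N / (N - p x) ≤ N / g := div_le_div_of_nonneg_left hN0.le hg0 (by linarith)
      have h5 : g / N ≤ (N - p x) / N := div_le_div_of_nonneg_right (by linarith) hN0.le
      calc e * (N / (N - p x)) ≤ e * (N / g) := mul_le_mul_of_nonneg_left h4 he0.le
        _ = c * (g / N) := by rw [he]; field_simp
        _ ≤ _ := mul_le_mul_of_nonneg_left h5 hc.le
    calc (1 - (1 / N - δ) * P) * τ ≤ ((N - p x) / N + e) * (N / (N - p x) - c) :=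
          mul_le_mul hF h2 hτ0.le (by positivity)
      _ = 1 - c * ((N - p x) / N) + e * (N / (N - p x)) - e * c := by field_simp; ring
      _ ≤ 1 := by
        have : 0 ≤ e * c := by positivity
        linarith
  exact ⟨hB _ (hρ0 x) (le_max_left _ _), hB _ (hσ0 x) (le_max_right _ _)⟩

end CondD

/-- The critical energy of `u` above the level `2 - 2⁻ⁿ` on the ball of radius
`(1 + 2⁻ⁿ) r / 2` around `y`. -/
noncomputable def levelEnergy {N : ℕ} (p q a u : EuclideanSpace ℝ (Fin N) → ℝ)
    (y : EuclideanSpace ℝ (Fin N)) (r : ℝ) (n : ℕ) : ℝ :=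
  ∫ x in Metric.ball y (r / 2 * (1 + (1 / 2) ^ n)) ∩ {x | 2 - (1 / 2) ^ n < u x},
    critFun p q a x (u x)

namespace CondD

variable {N : ℕ} {p q a : EuclideanSpace ℝ (Fin N) → ℝ}
variable {ρ σ k d : EuclideanSpace ℝ (Fin N) → ℝ} {M₁ M₂ M₃ L : ℝ}

theorem integrableOn_critFun (hD : CondD N p q a) {u : EuclideanSpace ℝ (Fin N) → ℝ}
    (hu : Continuous u) (y : EuclideanSpace ℝ (Fin N)) (R : ℝ) :
    IntegrableOn (fun x => critFun p q a x (u x)) (Metric.ball y R) :=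
  ((hD.continuous_critFun continuous_id hu).locallyIntegrable.integrableOn_isCompact
    (isCompact_closedBall y R)).mono_set Metric.ball_subset_closedBall

theorem levelEnergy_nonneg (hD : CondD N p q a) {u : EuclideanSpace ℝ (Fin N) → ℝ}
    (hu : Continuous u) (y : EuclideanSpace ℝ (Fin N)) (r : ℝ) (n : ℕ) :
    0 ≤ levelEnergy p q a u y r n := by
  refine setIntegral_nonneg (measurableSet_ball.inter
    (measurableSet_lt measurable_const hu.measurable)) fun x hx => hD.critFun_nonneg x ?_
  have h1 : (2 : ℝ) - (1 / 2) ^ n < u x := hx.2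
  have h2 : ((1 : ℝ) / 2) ^ n ≤ 1 := pow_le_one₀ (by norm_num) (by norm_num)
  linarith

theorem levelEnergy_succ_le (hD : CondD N p q a) {u : EuclideanSpace ℝ (Fin N) → ℝ}
    (hu : Continuous u) (y : EuclideanSpace ℝ (Fin N)) {r : ℝ} (hr : 0 ≤ r) (n : ℕ) :
    levelEnergy p q a u y r (n + 1) ≤ levelEnergy p q a u y r n := by
  have h3 : ((1 : ℝ) / 2) ^ (n + 1) ≤ (1 / 2) ^ n :=
    pow_le_pow_of_le_one (by norm_num) (by norm_num) n.le_succ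
  have h2 : ((1 : ℝ) / 2) ^ n ≤ 1 := pow_le_one₀ (by norm_num) (by norm_num)
  refine setIntegral_mono_set ((hD.integrableOn_critFun hu y _).mono_set Set.inter_subset_left)
    (ae_restrict_of_forall_mem (measurableSet_ball.inter
      (measurableSet_lt measurable_const hu.measurable)) fun x hx => hD.critFun_nonneg x ?_)
    (Eventually.of_forall fun x hx => ⟨Metric.ball_subset_ball ?_ hx.1, ?_⟩)
  · have h1 : (2 : ℝ) - (1 / 2) ^ n < u x := hx.2
    linarith
  · gcongr
  · have h1 : (2 : ℝ) - (1 / 2) ^ (n + 1) < u x := hx.2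
    show (2 : ℝ) - (1 / 2) ^ n < u x
    linarith

theorem levelEnergy_succ_le_integral (hD : CondD N p q a) {S : ℝ}
    (hS : ∀ x, N * q x / (N - q x) ≤ S) {u η : EuclideanSpace ℝ (Fin N) → ℝ}
    (hu : Continuous u) (hη : Continuous η) (hη0 : ∀ x, 0 ≤ η x) (hηc : HasCompactSupport η)
    (y : EuclideanSpace ℝ (Fin N)) (r : ℝ) (n : ℕ)
    (hη1 : ∀ x ∈ Metric.ball y (r / 2 * (1 + (1 / 2) ^ (n + 1))), η x = 1) :
    levelEnergy p q a u y r (n + 1) ≤ (2 ^ (n + 2)) ^ S *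
      ∫ x, critFun p q a x (max (u x - (2 - (1 / 2) ^ n)) 0 * η x ^ N) := by
  have hN0 : N ≠ 0 := by rintro rfl; have := hD.one_lt_N; norm_num at this
  set w : EuclideanSpace ℝ (Fin N) → ℝ :=
    fun x => max (u x - (2 - (1 / 2) ^ n)) 0 * η x ^ N with hw
  have hw0 : ∀ x, 0 ≤ w x := fun x => mul_nonneg (le_max_right _ _) (pow_nonneg (hη0 x) _)
  have hwcont : Continuous w :=
    ((hu.sub continuous_const).max continuous_const).mul (hη.pow N)
  have hwi : Integrable fun x => critFun p q a x (w x) := by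
    refine (hD.continuous_critFun continuous_id hwcont).integrable_of_hasCompactSupport ?_
    refine hηc.mono fun x hx => ?_
    by_contra h
    have h : η x = 0 := by simpa using h
    refine hx ?_
    simp [hw, h, hN0, hD.critFun_zero]
  rw [← integral_const_mul]
  refine (setIntegral_mono_on ((hD.integrableOn_critFun hu y _).mono_set Set.inter_subset_left)
    (hwi.const_mul _).integrableOn (measurableSet_ball.inter
      (measurableSet_lt measurable_const hu.measurable)) fun x hx => ?_).trans
    (setIntegral_le_integral (hwi.const_mul _) (Eventually.of_forall fun x =>
      mul_nonneg (by positivity) (hD.critFun_nonneg x (hw0 x))))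
  have h1 : (2 : ℝ) - (1 / 2) ^ (n + 1) < u x := hx.2
  have h2 : w x = u x - (2 - (1 / 2) ^ n) := by
    have : ((1 : ℝ) / 2) ^ (n + 1) ≤ (1 / 2) ^ n :=
      pow_le_pow_of_le_one (by norm_num) (by norm_num) n.le_succ
    simp only [hw, hη1 x hx.1, one_pow, mul_one]
    exact max_eq_left (by linarith)
  have h3 : u x ≤ 2 ^ (n + 2) * w x := by
    have hs : ((1 : ℝ) / 2) ^ (n + 2) * 2 ^ (n + 2) = 1 := by
      rw [← mul_pow]; norm_num
    set s : ℝ := (1 / 2) ^ (n + 2) with hsd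
    have e1 : ((1 : ℝ) / 2) ^ n = 4 * s := by rw [hsd, pow_add]; ring
    have e2 : ((1 : ℝ) / 2) ^ (n + 1) = 2 * s := by rw [hsd, pow_succ _ (n + 1)]; ring
    have hs0 : 0 < s := by positivity
    have hs1 : s < 1 := pow_lt_one₀ (by norm_num) (by norm_num) (by omega)
    rw [e2] at h1
    rw [h2, e1]
    have h4 : s * u x ≤ u x - (2 - 4 * s) := by nlinarith
    calc u x = 2 ^ (n + 2) * (s * u x) := by rw [← mul_assoc, mul_comm _ s, hs, one_mul]
      _ ≤ _ := mul_le_mul_of_nonneg_left h4 (by positivity)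
  have hu0 : 0 ≤ u x := by
    have : ((1 : ℝ) / 2) ^ (n + 1) ≤ 1 := pow_le_one₀ (by norm_num) (by norm_num)
    linarith
  exact (hD.critFun_mono x hu0 h3).trans
    (hD.critFun_mul_le hS x (one_le_pow₀ one_le_two) (hw0 x))

theorem exists_levelEnergy_recursion (hD : CondD N p q a)
    (hρ1 : ∀ x, 1 < ρ x) (hσ1 : ∀ x, 1 < σ x) (hρ : ∀ x, ρ x ≤ N * p x / (N - p x))
    (hσ : ∀ x, σ x ≤ N * p x / (N - p x))
    (hM₁ : 0 < M₁) (hM₂ : 0 < M₂) (hM₃ : 0 < M₃) (hL : 0 < L)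
    {θ ε r M : ℝ} {K : NNReal} (hθ : 0 < θ) (hθN : θ < 1 / N) (hε1 : ε ≤ 1)
    (hexp : ∀ x P, p x - ε ≤ P → P ≤ p x → (1 - θ * P) * ρ x ≤ 1 ∧ (1 - θ * P) * σ x ≤ 1)
    (hK : LipschitzWith K p) (hr : 0 < r) (hr1 : r ≤ 1) (hKr : 2 * (K * r) ≤ ε) (hM : 0 ≤ M) :
    ∃ C > 0, ∃ b > 1, ∀ F g β u, IsCriticalSolution p q a ρ σ k d M₁ M₂ M₃ L F g β u → ∀ y,
      IntegrableOn (fun x => |k x| ^ (ρ x / (ρ x - 1)) + |d x| ^ (σ x / (σ x - 1)))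
        (Metric.ball y r) →
      ∫ x in Metric.ball y r, (|k x| ^ (ρ x / (ρ x - 1)) + |d x| ^ (σ x / (σ x - 1))) ≤ M →
      ∀ n, levelEnergy p q a u y r n ≤ 1 → levelEnergy p q a u y r (n + 1) ≤
        C * b ^ n * levelEnergy p q a u y r n ^ ((1 - θ) * (N / (N - 1))) := by
  obtain ⟨C, hC, S, hS1, hS, hest⟩ := hD.exists_truncation_estimate (k := k) (d := d) hρ1 hσ1 hρ
    hσ hM₁ hM₂ hM₃ hL
  have hN := hD.one_lt_N
  have hN0 : (0 : ℝ) < N := by linarith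
  set ν : ℝ := N / (N - 1) with hν
  have hν0 : 0 < ν := div_pos hN0 (by linarith)
  have h2M : 0 < 2 + M := by linarith
  refine ⟨4 ^ S * (C * ((4 / r) ^ S * (2 + M)) ^ ν), by positivity, 2 ^ S * (2 ^ S) ^ ν, ?_,
    fun F g β u hu y hh hhM n hn => ?_⟩
  · have h1 : (1 : ℝ) < 2 ^ S := Real.one_lt_rpow one_lt_two (by linarith)
    exact one_lt_mul_of_lt_of_le h1 (Real.one_le_rpow h1.le hν0.le)
  have hucont := hu.contDiff.continuous
  set Z := levelEnergy p q a u y r n with hZ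
  have hγ : (1 - θ) * ν ≠ 0 := by
    have : 1 / (N : ℝ) < 1 := by rw [div_lt_one hN0]; exact hN
    exact mul_ne_zero (by linarith) hν0.ne'
  rcases (hD.levelEnergy_nonneg hucont y r n).eq_or_lt with h0 | hZ0
  · rw [← hZ] at h0
    rw [← h0, Real.zero_rpow hγ, mul_zero, h0]
    exact hD.levelEnergy_succ_le hucont y hr.le n
  rw [← hZ] at hZ0
  set R : ℝ := r / 2 * (1 + (1 / 2) ^ n) with hR
  have hRr : R ≤ r := by
    have : ((1 : ℝ) / 2) ^ n ≤ 1 := pow_le_one₀ (by norm_num) (by norm_num)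
    rw [hR]; nlinarith
  set D : NNReal := 2 ^ (n + 2) / r.toNNReal with hDd
  have hDr : (D : ℝ) = 2 ^ (n + 2) / r := by simp [hDd, hr.le]
  have hD1 : 1 ≤ D := by
    rw [← NNReal.coe_le_coe, hDr, NNReal.coe_one, le_div_iff₀ hr, one_mul]
    exact hr1.trans (one_le_pow₀ one_le_two)
  set η : EuclideanSpace ℝ (Fin N) → ℝ := fun x => max 0 (min 1 (D * (R - dist x y))) with hη
  have hηL : LipschitzWith D η := LipschitzWith.cutoff y R D
  have hη0 : ∀ x, 0 ≤ η x := fun x => le_max_left _ _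
  have hη1 : ∀ x, η x ≤ 1 := fun x => max_le zero_le_one (min_le_left _ _)
  have hηU : ∀ x ∉ Metric.ball y R, η x = 0 := fun x hx => by
    rw [Metric.mem_ball, not_lt] at hx
    refine max_eq_left ((min_le_right _ _).trans ?_)
    exact mul_nonpos_of_nonneg_of_nonpos D.2 (by linarith)
  have hηB : ∀ x ∈ Metric.ball y (r / 2 * (1 + (1 / 2) ^ (n + 1))), η x = 1 := fun x hx => by
    rw [Metric.mem_ball] at hx
    have h1 : 1 ≤ D * (R - dist x y) := by
      have h2 : r / 2 ^ (n + 2) ≤ R - dist x y := by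
        have h3 : r / 2 ^ (n + 2) = R - r / 2 * (1 + (1 / 2) ^ (n + 1)) := by
          rw [hR, one_div, inv_pow, inv_pow]
          field_simp
          ring
        linarith
      rw [hDr]
      calc (1 : ℝ) = 2 ^ (n + 2) / r * (r / 2 ^ (n + 2)) := by field_simp
        _ ≤ _ := mul_le_mul_of_nonneg_left h2 (by positivity)
    simp only [hη, min_eq_left h1]
    exact max_eq_right zero_le_one
  have hηc : HasCompactSupport η :=
    HasCompactSupport.intro (isCompact_closedBall y R) fun x hx =>
      hηU x fun h => hx (Metric.ball_subset_closedBall h)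
  set P : ℝ := p y - K * r with hP
  have hPx : ∀ x ∈ Metric.ball y R, p x - ε ≤ P ∧ P ≤ p x := fun x hx => by
    have h1 := hK.dist_le_mul x y
    rw [Metric.mem_ball] at hx
    have h2 : (K : ℝ) * dist x y ≤ K * r := mul_le_mul_of_nonneg_left (by linarith) K.2
    rw [Real.dist_eq, abs_le] at h1
    constructor <;> linarith
  have hPpos : 0 ≤ P := by
    have := hD.one_lt_p y
    have : 0 ≤ (K : ℝ) * r := by positivity
    linarith
  have hθP : θ * P ≤ 1 := by
    have h1 : P ≤ N := by
      have : 0 ≤ (K : ℝ) * r := by positivity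
      linarith [hD.p_lt_N y]
    have h2 : θ * P ≤ 1 / N * N := mul_le_mul hθN.le h1 hPpos (by positivity)
    rwa [one_div_mul_cancel hN0.ne'] at h2
  have hest := hest F g β u hu (Metric.ball y R) η D (2 - (1 / 2) ^ n) (Z ^ (-(θ * P)))
    (Z ^ (1 - θ * P)) (Z ^ (-θ)) P measurableSet_ball Metric.isBounded_ball hηL hD1 hη0 hη1 hηU
    (by
      have : ((1 : ℝ) / 2) ^ n ≤ 1 := pow_le_one₀ (by norm_num) (by norm_num)
      linarith)
    (Real.one_le_rpow_of_pos_of_le_one_of_nonpos hZ0 hn (by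
      have : 0 ≤ θ * P := by positivity
      linarith))
    (Real.rpow_pos_of_pos hZ0 _) (Real.rpow_le_one hZ0.le hn (by linarith))
    (Real.one_le_rpow_of_pos_of_le_one_of_nonpos hZ0 hn (by linarith))
    (fun x hx => (hPx x hx).2)
    (fun x hx => by
      rw [← Real.rpow_mul hZ0.le]
      refine Real.rpow_le_rpow_of_exponent_ge hZ0 hn ?_
      have := (hexp x P (hPx x hx).1 (hPx x hx).2).1
      linarith)
    (fun x hx => by
      rw [← Real.rpow_mul hZ0.le]
      refine Real.rpow_le_rpow_of_exponent_ge hZ0 hn ?_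
      have := (hexp x P (hPx x hx).1 (hPx x hx).2).2
      linarith)
    (hh.mono_set (Metric.ball_subset_ball hRr))
  have hI : ∫ x in Metric.ball y R,
      (|k x| ^ (ρ x / (ρ x - 1)) + |d x| ^ (σ x / (σ x - 1))) ≤ M :=
    (setIntegral_mono_set hh (Eventually.of_forall fun x => by positivity)
      (Eventually.of_forall (Metric.ball_subset_ball hRr))).trans hhM
  have hI0 : 0 ≤ ∫ x in Metric.ball y R,
      (|k x| ^ (ρ x / (ρ x - 1)) + |d x| ^ (σ x / (σ x - 1))) :=
    integral_nonneg fun x => by positivity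
  set I := ∫ x in Metric.ball y R, (|k x| ^ (ρ x / (ρ x - 1)) + |d x| ^ (σ x / (σ x - 1)))
  have hZeq : ∫ x in Metric.ball y R ∩ {x | 2 - (1 / 2) ^ n < u x}, critFun p q a x (u x) = Z :=
    rfl
  rw [hZeq] at hest
  have e1 : Z ^ (-θ) * Z = Z ^ (1 - θ) := by
    conv_lhs => rw [← Real.rpow_one Z, ← Real.rpow_mul hZ0.le, ← Real.rpow_add hZ0]
    congr 1; ring
  have e2 : (Z ^ (-θ)) ^ (-(P - 1)) * (Z ^ (-(θ * P)) * Z) = Z ^ (1 - θ) := by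
    conv_lhs => rw [← Real.rpow_one Z, ← Real.rpow_mul hZ0.le, ← Real.rpow_mul hZ0.le,
      ← Real.rpow_mul hZ0.le, ← Real.rpow_add hZ0, ← Real.rpow_add hZ0]
    congr 1; ring
  have e3 : (Z ^ (-θ)) ^ (-(P - 1)) * (Z ^ (1 - θ * P)) = Z ^ (1 - θ) := by
    rw [← Real.rpow_mul hZ0.le, ← Real.rpow_add hZ0]
    congr 1; ring
  have hin : (D : ℝ) ^ S * (Z ^ (-θ) * Z + (Z ^ (-θ)) ^ (-(P - 1)) *
      (Z ^ (-(θ * P)) * Z + Z ^ (1 - θ * P) * I)) ≤ (D : ℝ) ^ S * ((2 + M) * Z ^ (1 - θ)) := by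
    refine mul_le_mul_of_nonneg_left ?_ (by positivity)
    rw [mul_add ((Z ^ (-θ)) ^ (-(P - 1))), e1, e2, ← mul_assoc ((Z ^ (-θ)) ^ (-(P - 1))), e3]
    have := mul_le_mul_of_nonneg_left hI (Real.rpow_nonneg hZ0.le (1 - θ))
    linarith
  have hlast := hest.trans (mul_le_mul_of_nonneg_left
    (Real.rpow_le_rpow (by positivity) hin hν0.le) hC.le)
  refine (hD.levelEnergy_succ_le_integral hS hucont hηL.continuous hη0 hηc y r n hηB).trans ?_
  refine (mul_le_mul_of_nonneg_left hlast (by positivity)).trans_eq ?_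
  have e4 : ((2 : ℝ) ^ (n + 2)) ^ S = 4 ^ S * (2 ^ S) ^ n := by
    rw [pow_add, mul_comm, Real.mul_rpow (by positivity) (by positivity),
      Real.rpow_pow_comm zero_le_two]
    norm_num
  have e5 : (D : ℝ) ^ S = (4 / r) ^ S * (2 ^ S) ^ n := by
    have : (D : ℝ) = 2 ^ (n + 2) * (1 / r) := by rw [hDr]; ring
    rw [this, Real.mul_rpow (by positivity) (by positivity), e4,
      (by ring : (4 : ℝ) / r = 4 * (1 / r)), Real.mul_rpow (by positivity) (by positivity)]
    ring
  have e6 : (((2 : ℝ) ^ S) ^ n) ^ ν = ((2 ^ S) ^ ν) ^ n :=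
    (Real.rpow_pow_comm (by positivity) _ _).symm
  have hZθ : 0 ≤ Z ^ (1 - θ) := Real.rpow_nonneg hZ0.le _
  rw [e4, e5, (by ring : (4 / r) ^ S * (2 ^ S) ^ n * ((2 + M) * Z ^ (1 - θ)) =
    ((4 / r) ^ S * (2 + M)) * ((2 ^ S) ^ n * Z ^ (1 - θ))),
    Real.mul_rpow (by positivity) (by positivity), Real.mul_rpow (by positivity) hZθ, e6,
    ← Real.rpow_mul hZ0.le, mul_pow]
  ring

end CondD

/-- A continuous function on `[0,1]` vanishing at `0` cannot cross a forbidden value. -/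
theorem exists_le_of_le_mul_rpow (C : ℝ) {ν z : ℝ} (hν : 1 < ν) (hz : 0 < z) :
    ∃ e > 0, e ≤ z ∧ ∀ X : ℝ → ℝ, ContinuousOn X (Set.Icc 0 1) → X 0 = 0 →
      (∀ t ∈ Set.Icc (0 : ℝ) 1, X t ≤ C * (X t + e) ^ ν) → X 1 ≤ e := by
  have h1 : Tendsto (fun e : ℝ => C * (2 ^ ν * e ^ (ν - 1))) (nhdsWithin 0 (Set.Ioi 0))
      (nhds 0) := by
    have h2 := (Real.continuousAt_rpow_const 0 (ν - 1) (Or.inr (by linarith))).tendsto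
    rw [Real.zero_rpow (by linarith)] at h2
    simpa using ((h2.const_mul (2 ^ ν)).const_mul C).mono_left nhdsWithin_le_nhds
  obtain ⟨e, he1, he0, hez⟩ := ((h1.eventually_lt_const one_pos).and
    ((eventually_mem_nhdsWithin).and
      (eventually_nhdsWithin_of_eventually_nhds (eventually_le_nhds hz)))).exists
  have he0 : 0 < e := he0
  refine ⟨e, he0, hez, fun X hX hX0 hle => ?_⟩
  by_contra! h
  obtain ⟨t, ht, hte⟩ := intermediate_value_Icc zero_le_one hX
    (⟨by rw [hX0]; exact he0.le, h.le⟩ : e ∈ Set.Icc (X 0) (X 1))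
  have h2 := hle t ht
  rw [hte, ← two_mul, Real.mul_rpow zero_le_two he0.le] at h2
  have h3 : e ^ ν = e ^ (ν - 1) * e := by
    rw [← Real.rpow_add_one he0.ne']; congr 1; ring
  rw [h3] at h2
  nlinarith

namespace CondD

variable {N : ℕ} {p q a : EuclideanSpace ℝ (Fin N) → ℝ}

theorem le_two_of_tendsto_levelEnergy (hD : CondD N p q a) {u : EuclideanSpace ℝ (Fin N) → ℝ}
    (hu : Continuous u) {y : EuclideanSpace ℝ (Fin N)} {r : ℝ} (hr : 0 < r)
    (h : Tendsto (levelEnergy p q a u y r) atTop (nhds 0)) : u y ≤ 2 := by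
  by_contra! hy
  set O : Set (EuclideanSpace ℝ (Fin N)) := Metric.ball y (r / 2) ∩ {x | 2 < u x} with hO
  have hOo : IsOpen O := Metric.isOpen_ball.inter (isOpen_lt continuous_const hu)
  have hOn : O.Nonempty := ⟨y, Metric.mem_ball_self (by positivity), hy⟩
  have hOfin : volume O ≠ ⊤ :=
    ((measure_mono Set.inter_subset_left).trans_lt measure_ball_lt_top).ne
  have hOpos : 0 < volume.real O :=
    ENNReal.toReal_pos (hOo.measure_pos volume hOn).ne' hOfin
  refine hOpos.not_ge (ge_of_tendsto' h fun n => ?_)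
  have hn0 : (0 : ℝ) < (1 / 2) ^ n := by positivity
  have hn1 : ((1 : ℝ) / 2) ^ n ≤ 1 := pow_le_one₀ (by norm_num) (by norm_num)
  have hsub : O ⊆ Metric.ball y (r / 2 * (1 + (1 / 2) ^ n)) ∩ {x | 2 - (1 / 2) ^ n < u x} :=
    fun x hx => ⟨Metric.ball_subset_ball (by nlinarith) hx.1, by
      have h2 : 2 < u x := hx.2
      show 2 - (1 / 2) ^ n < u x
      linarith⟩
  have hint := (hD.integrableOn_critFun hu y (r / 2 * (1 + (1 / 2) ^ n))).mono_set
    (Set.inter_subset_left (t := {x | 2 - (1 / 2) ^ n < u x}))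
  calc volume.real O = ∫ _ in O, (1 : ℝ) := by simp
    _ ≤ ∫ x in O, critFun p q a x (u x) :=
      setIntegral_mono_on (integrableOn_const hOfin) (hint.mono_set hsub) hOo.measurableSet
        fun x hx => hD.one_le_critFun x (by
          have h2 : 2 < u x := hx.2
          linarith)
    _ ≤ _ := setIntegral_mono_set hint (ae_restrict_of_forall_mem (measurableSet_ball.inter
        (measurableSet_lt measurable_const hu.measurable)) fun x hx => hD.critFun_nonneg x (by
          have h2 : 2 - (1 / 2) ^ n < u x := hx.2
          linarith)) (Eventually.of_forall hsub)

theorem exists_levelEnergy_zero_le (hD : CondD N p q a) {r z : ℝ} (hr : 0 < r) (hr1 : r ≤ 1)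
    (hz : 0 < z) : ∃ e > 0, ∀ u : EuclideanSpace ℝ (Fin N) → ℝ, ContDiff ℝ 1 u → ∀ y,
      ∫ x in Metric.ball y (2 * r), (Hfun p q a x ‖gradient u x‖ + Hfun p q a x |u x|) ≤ e →
      levelEnergy p q a u y r 0 ≤ z := by
  obtain ⟨C0, hC0, hsob⟩ := hD.exists_sobolev
  obtain ⟨S, hS1, hS⟩ := hD.exists_qstar_le
  have hN := hD.one_lt_N
  have hν : 1 < (N : ℝ) / (N - 1) := by rw [lt_div_iff₀ (by linarith)]; linarith
  obtain ⟨X0, hX0, hX0z, hbar⟩ := exists_le_of_le_mul_rpow (z := z / 2 ^ S) C0 hν (by positivity)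
  set D : NNReal := 1 / r.toNNReal with hDd
  have hDr : (D : ℝ) = 1 / r := by simp [hDd, hr.le]
  have hD1 : (1 : ℝ) ≤ D := by rw [hDr, le_div_iff₀ hr, one_mul]; exact hr1
  set C1 : ℝ := 2 ^ S * (D ^ S + 1) with hC1
  have hC1p : 0 < C1 := by positivity
  refine ⟨X0 / C1, by positivity, fun u hu y hE => ?_⟩
  set η : EuclideanSpace ℝ (Fin N) → ℝ := fun x => max 0 (min 1 (D * (2 * r - dist x y))) with hη
  have hηL : LipschitzWith D η := LipschitzWith.cutoff y (2 * r) D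
  have hη0 : ∀ x, 0 ≤ η x := fun x => le_max_left _ _
  have hη1 : ∀ x, η x ≤ 1 := fun x => max_le zero_le_one (min_le_left _ _)
  have hηU : ∀ x ∉ Metric.ball y (2 * r), η x = 0 := fun x hx => by
    rw [Metric.mem_ball, not_lt] at hx
    refine max_eq_left ((min_le_right _ _).trans ?_)
    exact mul_nonpos_of_nonneg_of_nonpos D.2 (by linarith)
  have hηB : ∀ x ∈ Metric.ball y r, η x = 1 := fun x hx => by
    rw [Metric.mem_ball] at hx
    have h1 : 1 ≤ D * (2 * r - dist x y) := by
      rw [hDr, one_div_mul_eq_div, le_div_iff₀ hr]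
      linarith
    simp only [hη, min_eq_left h1]
    exact max_eq_right zero_le_one
  have hηc : HasCompactSupport η :=
    HasCompactSupport.intro (isCompact_closedBall y (2 * r)) fun x hx =>
      hηU x fun h => hx (Metric.ball_subset_closedBall h)
  obtain ⟨K, hK⟩ := hu.exists_lipschitzWith_posPart_sub_mul hηL hηc (1 / 2)
  set w : EuclideanSpace ℝ (Fin N) → ℝ := fun x => max (u x - 1 / 2) 0 * η x with hw
  have hwc : HasCompactSupport w := hηc.mul_left
  have hw0 : ∀ x, 0 ≤ w x := fun x => mul_nonneg (le_max_right _ _) (hη0 x)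
  have hwW : ∀ x, 0 < w x → x ∈ Metric.ball y (2 * r) ∧ 1 / 2 < u x := fun x hx => by
    refine ⟨by_contra fun h => ?_, ?_⟩
    · simp [hw, hηU x h] at hx
    · by_contra! h
      have h2 : w x = 0 := by
        simp only [hw, max_eq_right (by linarith : u x - 1 / 2 ≤ 0), zero_mul]
      exact hx.ne' h2
  have hcrit_supp : ∀ f : EuclideanSpace ℝ (Fin N) → ℝ, Continuous f → HasCompactSupport f →
      Integrable fun x => critFun p q a x (f x) := fun f hf hfc => by
    refine (hD.continuous_critFun continuous_id hf).integrable_of_hasCompactSupport ?_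
    refine hfc.mono fun x hx => ?_
    by_contra h
    have h : f x = 0 := by simpa using h
    exact hx (by simp [h, hD.critFun_zero])
  have hwi := hcrit_supp w hK.continuous hwc
  have hgcont : Continuous fun x => ‖gradient u x‖ := by
    simp only [norm_gradient_eq_norm_fderiv]
    exact (hu.continuous_fderiv one_ne_zero).norm
  set h : EuclideanSpace ℝ (Fin N) → ℝ :=
    fun x => Hfun p q a x ‖gradient u x‖ + Hfun p q a x |u x| with hh
  have hhc : Continuous h := (hD.continuous_Hfun continuous_id hgcont).add
    (hD.continuous_Hfun continuous_id hu.continuous.abs)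
  have hh0 : ∀ x, 0 ≤ h x := fun x => add_nonneg (hD.Hfun_nonneg x (norm_nonneg _))
    (hD.Hfun_nonneg x (abs_nonneg _))
  have hhi : IntegrableOn h (Metric.ball y (2 * r)) :=
    (hhc.locallyIntegrable.integrableOn_isCompact (isCompact_closedBall y (2 * r))).mono_set
      Metric.ball_subset_closedBall
  have hpt : ∀ᵐ x, 0 < w x → Hfun p q a x ‖fderiv ℝ w x‖ + 1 ≤ C1 * h x := by
    filter_upwards [hηL.ae_differentiableAt] with x hηx hx
    obtain ⟨-, hux⟩ := hwW x hx
    have hu0 : 0 ≤ u x := by linarith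
    have h1 : ‖fderiv ℝ w x‖ ≤ D * |u x| + ‖gradient u x‖ := by
      rw [hw, fderiv_posPart_sub_mul (hu.differentiable one_ne_zero x) hηx hux,
        norm_gradient_eq_norm_fderiv]
      refine (norm_add_le _ _).trans (add_le_add ?_ ?_)
      · rw [norm_smul, Real.norm_of_nonneg (by linarith), abs_of_nonneg hu0, mul_comm]
        exact mul_le_mul (norm_fderiv_le_of_lipschitz ℝ hηL) (by linarith) (by linarith) D.2
      · rw [norm_smul, Real.norm_of_nonneg (hη0 x)]
        exact mul_le_of_le_one_left (norm_nonneg _) (hη1 x)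
    have h2 := (hD.Hfun_mono x (norm_nonneg _) h1).trans
      (hD.Hfun_add_le hS x (by positivity) (norm_nonneg _))
    have h3 := hD.Hfun_mul_le hS x hD1 (abs_nonneg (u x))
    have h4 : 1 ≤ 2 ^ S * Hfun p q a x |u x| := by
      refine le_trans ?_ (hD.Hfun_mul_le hS x one_le_two (abs_nonneg (u x)))
      have h5 : 1 ≤ 2 * |u x| := by rw [abs_of_nonneg hu0]; linarith
      have h6 := Real.one_le_rpow h5 (zero_le_one.trans (hD.one_lt_p x).le)
      have h7 := mul_nonneg (hD.a_nonneg x) (Real.rpow_nonneg (zero_le_one.trans h5) (q x))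
      rw [Hfun]
      linarith
    have h8 := mul_le_mul_of_nonneg_left h3 (by positivity : (0 : ℝ) ≤ 2 ^ S)
    have h9 : 0 ≤ 2 ^ S * (D : ℝ) ^ S * Hfun p q a x ‖gradient u x‖ :=
      mul_nonneg (by positivity) (hD.Hfun_nonneg x (norm_nonneg _))
    rw [hC1, hh]
    linarith
  set X : ℝ → ℝ := fun t => ∫ x, critFun p q a x (t * w x) with hX
  have hXc : ContinuousOn X (Set.Icc 0 1) := by
    refine continuousOn_of_dominated (bound := fun x => critFun p q a x (w x)) (fun t ht => ?_)
      (fun t ht => Eventually.of_forall fun x => ?_) hwi (Eventually.of_forall fun x => ?_)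
    · exact (hD.continuous_critFun continuous_id
        (continuous_const.mul hK.continuous)).aestronglyMeasurable
    · rw [Real.norm_of_nonneg (hD.critFun_nonneg x (mul_nonneg ht.1 (hw0 x)))]
      exact hD.critFun_mono x (mul_nonneg ht.1 (hw0 x)) (mul_le_of_le_one_left (hw0 x) ht.2)
    · exact (hD.continuous_critFun continuous_const
        (continuous_id.mul continuous_const)).continuousOn
  have hX00 : X 0 = 0 := by simp [hX, hD.critFun_zero]
  have hX1 := hbar X hXc hX00 fun t ht => by
    have htw0 : ∀ x, 0 ≤ t * w x := fun x => mul_nonneg ht.1 (hw0 x)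
    have htL : LipschitzWith (‖t‖₊ * K) fun x => t * w x := by
      exact (lipschitzWith_smul t).comp hK
    have hti := hcrit_supp _ htL.continuous hwc.mul_left
    have hpos : {x | 0 < t * w x} ⊆ Metric.ball y (2 * r) := fun x hx =>
      (hwW x (pos_of_mul_pos_right hx ht.1)).1
    have hhi' : IntegrableOn (fun x => C1 * h x) {x | 0 < t * w x} :=
      IntegrableOn.mono_set (hhi.const_mul C1) hpos
    have hGi : IntegrableOn (fun x => critFun p q a x (t * w x) + C1 * h x)
        {x | 0 < t * w x} := hti.integrableOn.add hhi'
    refine (hsob _ _ htL hwc.mul_left htw0 1 le_rfl 0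
      (fun x _ => zero_le_one.trans (hD.one_lt_p x).le) _ hGi ?_).trans ?_
    · filter_upwards [hpt] with x hx htx
      have hwx := pos_of_mul_pos_right htx ht.1
      have h1 := hx hwx
      have h2 : ‖fderiv ℝ (fun x => t * w x) x‖ ≤ ‖fderiv ℝ w x‖ := by
        rw [show (fun x => t * w x) = t • w from rfl, fderiv_const_smul_field, Pi.smul_apply, norm_smul, Real.norm_of_nonneg ht.1]
        exact mul_le_of_le_one_left (norm_nonneg _) ht.2
      have h3 := hD.Hfun_mono x (norm_nonneg _) h2
      rw [Real.one_rpow, one_mul, one_mul]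
      linarith
    · have hm : MeasurableSet {x | 0 < t * w x} :=
        measurableSet_lt measurable_const htL.continuous.measurable
      refine mul_le_mul_of_nonneg_left (Real.rpow_le_rpow (setIntegral_nonneg hm fun x _ =>
        add_nonneg (hD.critFun_nonneg x (htw0 x)) (mul_nonneg hC1p.le (hh0 x))) ?_
        (by linarith)) hC0.le
      rw [integral_add hti.integrableOn hhi', integral_const_mul]
      refine add_le_add (setIntegral_le_integral hti (Eventually.of_forall fun x =>
        hD.critFun_nonneg x (htw0 x))) ?_
      have h4 : ∫ x in {x | 0 < t * w x}, h x ≤ X0 / C1 :=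
        (setIntegral_mono_set hhi (Eventually.of_forall hh0) (Eventually.of_forall hpos)).trans hE
      rw [le_div_iff₀' hC1p] at h4
      exact h4
  have hX1' : ∫ x, critFun p q a x (w x) ≤ z / 2 ^ S := by
    simp only [hX, one_mul] at hX1
    exact hX1.trans hX0z
  rw [le_div_iff₀' (by positivity), ← integral_const_mul] at hX1'
  refine le_trans ?_ hX1'
  have hlev : levelEnergy p q a u y r 0 =
      ∫ x in Metric.ball y r ∩ {x | 1 < u x}, critFun p q a x (u x) := by
    rw [levelEnergy, pow_zero]; norm_num
  rw [hlev]
  refine (setIntegral_mono_on ((hD.integrableOn_critFun hu.continuous y _).mono_set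
    Set.inter_subset_left) (hwi.const_mul _).integrableOn (measurableSet_ball.inter
      (measurableSet_lt measurable_const hu.continuous.measurable)) fun x hx => ?_).trans
    (setIntegral_le_integral (hwi.const_mul _) (Eventually.of_forall fun x =>
      mul_nonneg (by positivity) (hD.critFun_nonneg x (hw0 x))))
  have h1 : 1 < u x := hx.2
  have h2 : w x = u x - 1 / 2 := by
    simp only [hw, hηB x hx.1, mul_one]
    exact max_eq_left (by linarith)
  exact (hD.critFun_mono x (by linarith) (by linarith : u x ≤ 2 * w x)).trans
    (hD.critFun_mul_le hS x one_le_two (hw0 x))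

end CondD

section Boundedness

variable {N : ℕ} {p q a ρ σ k d : EuclideanSpace ℝ (Fin N) → ℝ} {M₁ M₂ M₃ L : ℝ}

theorem MeasureTheory.Integrable.exists_setIntegral_ball_le {E : Type*} [NormedAddCommGroup E]
    [MeasurableSpace E] [BorelSpace E] {μ : Measure E} {f : E → ℝ} (hf : Integrable f μ)
    (h0 : ∀ x, 0 ≤ f x) {e : ℝ} (he : 0 < e) (s : ℝ) :
    ∃ R, ∀ y, R < ‖y‖ → ∫ x in Metric.ball y s, f x ∂μ ≤ e := by
  have h1 : Tendsto (fun n : ℕ => ∫ x in (Metric.closedBall (0 : E) n)ᶜ, f x ∂μ) atTop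
      (nhds (∫ x in ⋂ n : ℕ, (Metric.closedBall (0 : E) n)ᶜ, f x ∂μ)) := by
    refine tendsto_setIntegral_of_antitone
      (fun n => Metric.isClosed_closedBall.measurableSet.compl) (fun m n hmn => ?_)
      ⟨0, hf.integrableOn⟩
    exact Set.compl_subset_compl.2 (Metric.closedBall_subset_closedBall (by exact_mod_cast hmn))
  have h2 : ⋂ n : ℕ, (Metric.closedBall (0 : E) n)ᶜ = ∅ := by
    rw [← Set.compl_iUnion, Metric.iUnion_closedBall_nat, Set.compl_univ]
  rw [h2, setIntegral_empty] at h1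
  obtain ⟨n, hn⟩ := (h1.eventually_lt_const he).exists
  refine ⟨n + s, fun y hy => le_trans ?_ hn.le⟩
  refine setIntegral_mono_set hf.integrableOn (Eventually.of_forall h0)
    (Eventually.of_forall fun x hx => ?_)
  have hx' : dist x y < s := hx
  have := norm_le_norm_add_norm_sub' y x
  rw [dist_eq_norm, norm_sub_rev] at hx'
  change ¬ dist x 0 ≤ n
  rw [dist_zero_right]
  linarith

namespace CondD

theorem exists_forall_norm_gt_le_two (hD : CondD N p q a)
    (hρ1 : ∀ x, 1 < ρ x) (hσ1 : ∀ x, 1 < σ x) (hρ : ∀ x, ρ x ≤ N * p x / (N - p x))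
    (hσ : ∀ x, σ x ≤ N * p x / (N - p x))
    (hκ : ∃ c > (0 : ℝ), ∀ x, c ≤ N * p x / (N - p x) / q x - max (ρ x) (σ x))
    (hM₁ : 0 < M₁) (hM₂ : 0 < M₂) (hM₃ : 0 < M₃) (hL : 0 < L) {M : ℝ}
    (hkd : ∀ y, IntegrableOn (fun x => |k x| ^ (ρ x / (ρ x - 1)) + |d x| ^ (σ x / (σ x - 1)))
        (Metric.ball y (1 / 2)))
    (hkdM : ∀ y, ∫ x in Metric.ball y (1 / 2),
      (|k x| ^ (ρ x / (ρ x - 1)) + |d x| ^ (σ x / (σ x - 1))) ≤ M)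
    {F : EuclideanSpace ℝ (Fin N) → EuclideanSpace ℝ (Fin N)}
    {g β u : EuclideanSpace ℝ (Fin N) → ℝ}
    (hu : IsCriticalSolution p q a ρ σ k d M₁ M₂ M₃ L F g β u)
    (hint : Integrable fun x => Hfun p q a x ‖gradient u x‖ + Hfun p q a x |u x|) :
    ∃ R, ∀ y, R < ‖y‖ → u y ≤ 2 := by
  obtain ⟨θ, ε, hθ, hθN, hε, hε1, hexp⟩ := hD.exists_recursion_exponent
    (fun x => one_pos.trans (hρ1 x)) (fun x => one_pos.trans (hσ1 x)) hκ
  obtain ⟨K, hK⟩ := hD.lip_p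
  have hN := hD.one_lt_N
  have hN0 : (0 : ℝ) < N := by linarith
  have h0 : ∀ x, 0 ≤ |k x| ^ (ρ x / (ρ x - 1)) + |d x| ^ (σ x / (σ x - 1)) := fun x => by
    positivity
  set r : ℝ := min (1 / 2) (ε / (2 * (K + 1))) with hr
  have hK0 : (0 : ℝ) ≤ K := K.2
  have hr0 : 0 < r := lt_min (by norm_num) (by positivity)
  have hr2 : r ≤ 1 / 2 := min_le_left _ _
  have hKr : 2 * (K * r) ≤ ε := by
    have h1 : r ≤ ε / (2 * (K + 1)) := min_le_right _ _
    rw [le_div_iff₀ (by positivity)] at h1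
    nlinarith
  have hsub : ∀ y : EuclideanSpace ℝ (Fin N), Metric.ball y r ⊆ Metric.ball y (1 / 2) :=
    fun y => Metric.ball_subset_ball hr2
  have hγ : 1 < (1 - θ) * (N / (N - 1)) := by
    rw [lt_div_iff₀ hN0] at hθN
    rw [mul_div_assoc', one_lt_div (by linarith)]
    linarith
  have hM : 0 ≤ M := (setIntegral_nonneg measurableSet_ball fun x _ => h0 x).trans (hkdM 0)
  obtain ⟨C, hC, b, hb, hrec⟩ := hD.exists_levelEnergy_recursion (k := k) (d := d) hρ1 hσ1 hρ hσ
    hM₁ hM₂ hM₃ hL hθ hθN hε1 hexp hK hr0 (by linarith) hKr hM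
  obtain ⟨z, hz, hlim⟩ := exists_tendsto_zero_of_superlinear_recursion hC hb hγ
  obtain ⟨e, he, hstart⟩ := hD.exists_levelEnergy_zero_le hr0 (by linarith) hz
  obtain ⟨R, hR⟩ := hint.exists_setIntegral_ball_le
    (fun x => add_nonneg (hD.Hfun_nonneg x (norm_nonneg _)) (hD.Hfun_nonneg x (abs_nonneg _)))
    he (2 * r)
  refine ⟨R, fun y hy => ?_⟩
  refine hD.le_two_of_tendsto_levelEnergy hu.contDiff.continuous hr0
    (hlim _ (hD.levelEnergy_nonneg hu.contDiff.continuous y r) ?_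
      (hstart u hu.contDiff y (hR y hy)))
  refine hrec F g β u hu y ((hkd y).mono_set (hsub y)) (le_trans ?_ (hkdM y))
  exact setIntegral_mono_set (hkd y) (Eventually.of_forall h0) (Eventually.of_forall (hsub y))

end CondD

end Boundedness

section WeakSolution

variable {N : ℕ} {p q a ρ σ k d V : EuclideanSpace ℝ (Fin N) → ℝ} {M₁ M₂ M₃ L : ℝ}

theorem MeasureTheory.exists_pos_le_of_essInf_pos {α : Type*} [MeasurableSpace α] {μ : Measure α}
    {f : α → ℝ} (hf : 0 < essInf f μ) : ∃ c > 0, ∀ᵐ x ∂μ, c ≤ f x := by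
  rw [essInf_eq_sSup] at hf
  have hne : {a : ℝ | μ {x | f x < a} = 0}.Nonempty := by
    by_contra h
    rw [Set.not_nonempty_iff_eq_empty.1 h, Real.sSup_empty] at hf
    exact hf.false
  obtain ⟨c, hc, hc0⟩ := exists_lt_of_lt_csSup hne hf
  refine ⟨c, hc0, ?_⟩
  rw [ae_iff]
  simp only [not_le]
  exact hc

theorem ball_half_subset_cube (y : EuclideanSpace ℝ (Fin N)) :
    Metric.ball y (1 / 2) ⊆ cube y 1 := fun x hx i => by
  rw [Metric.mem_ball, dist_eq_norm] at hx
  exact (PiLp.norm_apply_le (x - y) i).trans_lt hx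

theorem integrableOn_and_setIntegral_le_of_lintegral_le {α : Type*} [MeasurableSpace α]
    {μ : Measure α} {s : Set α} {f : α → ℝ} (hf : Measurable f) (h0 : ∀ x, 0 ≤ f x) {M : ℝ}
    (h : ∫⁻ x in s, ENNReal.ofReal (f x) ∂μ ≤ ENNReal.ofReal M) :
    IntegrableOn f s μ ∧ ∫ x in s, f x ∂μ ≤ max M 0 := by
  have h1 : IntegrableOn f s μ := (lintegral_ofReal_ne_top_iff_integrable
    hf.aestronglyMeasurable (Eventually.of_forall h0)).1 (h.trans_lt ENNReal.ofReal_lt_top).ne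
  refine ⟨h1, ?_⟩
  rw [← ofReal_integral_eq_lintegral_ofReal h1 (Eventually.of_forall h0)] at h
  refine (ENNReal.ofReal_le_ofReal_iff (le_max_right _ _)).1 (h.trans ?_)
  exact ENNReal.ofReal_le_ofReal (le_max_left _ _)

theorem abs_abs_rpow_sub_two_mul {s : ℝ} (hs : 1 < s) (t : ℝ) :
    |(|t| ^ (s - 2) * t)| = |t| ^ (s - 1) := by
  rcases eq_or_ne t 0 with rfl | ht
  · rw [mul_zero, abs_zero, Real.zero_rpow (by linarith)]
  · rw [abs_mul, abs_of_nonneg (by positivity), ← Real.rpow_add_one (abs_ne_zero.2 ht)]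
    congr 1
    ring

theorem MeasureTheory.LocallyIntegrable.of_abs_rpow_conj {α : Type*} [TopologicalSpace α]
    [MeasurableSpace α] {μ : Measure α} [IsLocallyFiniteMeasure μ]
    {k ρ : α → ℝ} (hk : AEStronglyMeasurable k μ) (hρ : ∀ x, 1 < ρ x)
    (h : LocallyIntegrable (fun x => |k x| ^ (ρ x / (ρ x - 1))) μ) : LocallyIntegrable k μ := by
  refine ((locallyIntegrable_const 1).add h).mono hk (Eventually.of_forall fun x => ?_)
  have h1 : 1 ≤ ρ x / (ρ x - 1) := by
    rw [one_le_div (by linarith [hρ x])]; linarith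
  have h2 : 0 ≤ |k x| ^ (ρ x / (ρ x - 1)) := by positivity
  change |k x| ≤ |1 + |k x| ^ (ρ x / (ρ x - 1))|
  rw [abs_of_nonneg (by linarith : 0 ≤ 1 + |k x| ^ (ρ x / (ρ x - 1)))]
  rcases le_total |k x| 1 with h3 | h3
  · linarith
  · have := Real.rpow_le_rpow_of_exponent_le h3 h1
    rw [Real.rpow_one] at this
    linarith

theorem ContDiff.continuous_gradient {E : Type*} [NormedAddCommGroup E] [InnerProductSpace ℝ E]
    [CompleteSpace E] {u : E → ℝ} (hu : ContDiff ℝ 1 u) : Continuous (gradient u) :=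
  (InnerProductSpace.toDual ℝ E).symm.continuous.comp (hu.continuous_fderiv one_ne_zero)

namespace CondD

theorem locallyIntegrable_potential (hD : CondD N p q a) (hV : LocallyIntegrable V)
    {u : EuclideanSpace ℝ (Fin N) → ℝ} (hu : Continuous u) : LocallyIntegrable fun x =>
      V x * (|u x| ^ (p x - 2) * u x + a x * |u x| ^ (q x - 2) * u x) := by
  have hp (c : ℝ) : Continuous fun x => p x - c := hD.continuous_p.sub continuous_const
  have hq (c : ℝ) : Continuous fun x => q x - c := hD.continuous_q.sub continuous_const
  have ha := hD.continuous_a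
  have hc : Continuous fun x => |u x| ^ (p x - 1) + a x * |u x| ^ (q x - 1) :=
    (hu.abs.rpow (hp 1) fun x => Or.inr (by linarith [hD.one_lt_p x])).add
      (ha.mul (hu.abs.rpow (hq 1)
        fun x => Or.inr (by linarith [hD.one_lt_q x])))
  refine (hV.mul_continuous hc).mono ?_ (Eventually.of_forall fun x => ?_)
  · have h1 : Measurable fun x => |u x| ^ (p x - 2) * u x + a x * |u x| ^ (q x - 2) * u x :=
      (((hu.abs.measurable.pow (hp 2).measurable).mul hu.measurable)).add
        ((ha.measurable.mul (hu.abs.measurable.pow (hq 2).measurable)).mul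
          hu.measurable)
    exact hV.aestronglyMeasurable.mul h1.aestronglyMeasurable
  · have h1 := hD.a_nonneg x
    rw [norm_mul, norm_mul, Real.norm_eq_abs (|u x| ^ (p x - 1) + _),
      abs_of_nonneg (add_nonneg (by positivity) (mul_nonneg h1 (by positivity)))]
    refine mul_le_mul_of_nonneg_left ?_ (norm_nonneg _)
    rw [mul_assoc]
    refine (norm_add_le _ _).trans (le_of_eq ?_)
    rw [norm_mul (a x), Real.norm_eq_abs, Real.norm_eq_abs, Real.norm_eq_abs,
      abs_abs_rpow_sub_two_mul (hD.one_lt_p x), abs_abs_rpow_sub_two_mul (hD.one_lt_q x),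
      abs_of_nonneg h1]

theorem continuous_flux_bound (hD : CondD N p q a) {v w : EuclideanSpace ℝ (Fin N) → ℝ}
    (hv : Continuous v) (hw : Continuous w) : Continuous fun x => v x ^ (N * p x / (N - p x) - 1) +
      a x ^ (N / (N - q x)) * v x ^ (N * q x / (N - q x) - 1) + w x ^ (p x - 1) +
      a x * w x ^ (q x - 1) := by
  have h1 := hD.one_lt_p
  have h2 := hD.one_lt_q
  have h3 := hD.p_lt_pstar
  have h4 := hD.q_lt_qstar
  have hp : Continuous fun x => p x - 1 := hD.continuous_p.sub continuous_const
  have hq : Continuous fun x => q x - 1 := hD.continuous_q.sub continuous_const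
  have hps : Continuous fun x => N * p x / (N - p x) - 1 :=
    hD.continuous_pstar.sub continuous_const
  have hqs : Continuous fun x => N * q x / (N - q x) - 1 :=
    hD.continuous_qstar.sub continuous_const
  refine (((hv.rpow hps fun x => Or.inr ?_).add
    (hD.continuous_rpow_a.mul
      (hv.rpow hqs fun x => Or.inr ?_))).add
    (hw.rpow hp fun x => Or.inr ?_)).add
    (hD.continuous_a.mul (hw.rpow hq fun x => Or.inr ?_))
  · linarith [h1 x, h3 x]
  · linarith [h2 x, h4 x]
  · linarith [h1 x]
  · linarith [h2 x]

theorem continuous_lower_bound (hD : CondD N p q a) {v w : EuclideanSpace ℝ (Fin N) → ℝ}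
    (hv : Continuous v) (hw : Continuous w) : Continuous fun x => v x ^ (N * p x / (N - p x) - 1) +
      a x ^ (N / (N - q x)) * v x ^ (N * q x / (N - q x) - 1) +
      w x ^ (p x / ((N * p x / (N - p x)) / (N * p x / (N - p x) - 1))) +
      a x ^ ((N + 1) / (N : ℝ)) *
        w x ^ (q x / ((N * q x / (N - q x)) / (N * q x / (N - q x) - 1))) := by
  have h1 := hD.one_lt_p
  have h2 := hD.one_lt_q
  have h3 := hD.p_lt_pstar
  have h4 := hD.q_lt_qstar
  have hN := hD.one_lt_N
  have h5 : ∀ x, 0 < N * p x / (N - p x) - 1 := fun x => by linarith [h1 x, h3 x]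
  have h6 : ∀ x, 0 < N * q x / (N - q x) - 1 := fun x => by linarith [h2 x, h4 x]
  have hps : Continuous fun x => N * p x / (N - p x) - 1 :=
    hD.continuous_pstar.sub continuous_const
  have hqs : Continuous fun x => N * q x / (N - q x) - 1 :=
    hD.continuous_qstar.sub continuous_const
  refine (((hv.rpow hps fun x => Or.inr (h5 x)).add
    (hD.continuous_rpow_a.mul
      (hv.rpow hqs fun x => Or.inr (h6 x)))).add
    (hw.rpow (hD.continuous_p.div (hD.continuous_pstar.div hps fun x => (h5 x).ne') fun x => ?_)
        fun x => Or.inr ?_)).add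
    ((hD.continuous_a.rpow continuous_const fun x => Or.inr (by positivity)).mul
      (hw.rpow (hD.continuous_q.div (hD.continuous_qstar.div hqs fun x => (h6 x).ne') fun x => ?_)
        fun x => Or.inr ?_))
  · exact (div_pos (by linarith [h5 x]) (h5 x)).ne'
  · exact div_pos (by linarith [h1 x]) (div_pos (by linarith [h5 x]) (h5 x))
  · exact (div_pos (by linarith [h6 x]) (h6 x)).ne'
  · exact div_pos (by linarith [h2 x]) (div_pos (by linarith [h6 x]) (h6 x))

theorem qstar_div_q (hD : CondD N p q a) (x : EuclideanSpace ℝ (Fin N)) :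
    N * q x / (N - q x) / q x = N / (N - q x) := by
  have := hD.one_lt_q x
  rw [div_right_comm, mul_div_cancel_right₀ _ (by linarith)]

theorem integrable_Hfun_of_rhoV_lt_top (hD : CondD N p q a) {c : ℝ} (hc : 0 < c)
    (hV : ∀ᵐ x, c ≤ V x) {u : EuclideanSpace ℝ (Fin N) → ℝ} (hu : ContDiff ℝ 1 u)
    (h : rhoV p q a V u < ⊤) :
    Integrable fun x => Hfun p q a x ‖gradient u x‖ + Hfun p q a x |u x| := by
  have h1 : Continuous fun x => Hfun p q a x ‖gradient u x‖ :=
    hD.continuous_Hfun continuous_id hu.continuous_gradient.norm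
  have h2 : Continuous fun x => Hfun p q a x |u x| :=
    hD.continuous_Hfun continuous_id hu.continuous.abs
  have h3 : ∀ x, 0 ≤ Hfun p q a x ‖gradient u x‖ := fun x => hD.Hfun_nonneg x (norm_nonneg _)
  have h4 : ∀ x, 0 ≤ Hfun p q a x |u x| := fun x => hD.Hfun_nonneg x (abs_nonneg _)
  have h5 : Integrable fun x => Hfun p q a x ‖gradient u x‖ :=
    (lintegral_ofReal_ne_top_iff_integrable h1.aestronglyMeasurable (Eventually.of_forall h3)).1
      ((lintegral_mono fun x => le_self_add).trans_lt h).ne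
  have h6 : Integrable fun x => c * Hfun p q a x |u x| := by
    refine (lintegral_ofReal_ne_top_iff_integrable
      (continuous_const.mul h2).aestronglyMeasurable
      (Eventually.of_forall fun x => mul_nonneg hc.le (h4 x))).1
      ((lintegral_mono_ae ?_).trans_lt h).ne
    filter_upwards [hV] with x hx
    exact (ENNReal.ofReal_le_ofReal (mul_le_mul_of_nonneg_right hx (h4 x))).trans le_add_self
  exact h5.add ((integrable_const_mul_iff (IsUnit.mk0 c hc.ne') _).1 h6)

end CondD

end WeakSolution

/-- **Global boundedness, critical case, coercive potential.**
Under (D), (H₂) and `ess inf V > 0`, every weak solution `u ∈ W^{1,H}_V(ℝ^N)` of the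
generalized Schrödinger-type double phase problem with critical growth belongs to
`L^∞(ℝ^N)`. -/
theorem stmt15 {N : ℕ} (p q a V : EuclideanSpace ℝ (Fin N) → ℝ) (hD : CondD N p q a)
    (hVloc : LocallyIntegrable V volume)
    (hVinf : 0 < essInf V (volume : Measure (EuclideanSpace ℝ (Fin N))))
    (𝒜 : EuclideanSpace ℝ (Fin N) → ℝ → EuclideanSpace ℝ (Fin N) → EuclideanSpace ℝ (Fin N))
    (ℬ : EuclideanSpace ℝ (Fin N) → ℝ → EuclideanSpace ℝ (Fin N) → ℝ)
    -- (H₂): Carathéodory conditions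
    (h𝒜meas : ∀ (t : ℝ) (ξ : EuclideanSpace ℝ (Fin N)), Measurable fun x => 𝒜 x t ξ)
    (h𝒜cont : ∀ x, Continuous fun tξ : ℝ × EuclideanSpace ℝ (Fin N) => 𝒜 x tξ.1 tξ.2)
    (hℬmeas : ∀ (t : ℝ) (ξ : EuclideanSpace ℝ (Fin N)), Measurable fun x => ℬ x t ξ)
    (hℬcont : ∀ x, Continuous fun tξ : ℝ × EuclideanSpace ℝ (Fin N) => ℬ x tξ.1 tξ.2)
    -- (H₂): the exponents ρ, σ with κ = max{ρ,σ} ≪ p*/q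
    (ρ σ : EuclideanSpace ℝ (Fin N) → ℝ)
    (hρlip : ∃ K : NNReal, LipschitzWith K ρ) (hσlip : ∃ K : NNReal, LipschitzWith K σ)
    (hρbdd : ∃ C : ℝ, ∀ x, ρ x ≤ C) (hσbdd : ∃ C : ℝ, ∀ x, σ x ≤ C)
    (hρ1 : ∃ c > (1 : ℝ), ∀ x, c ≤ ρ x) (hσ1 : ∃ c > (1 : ℝ), ∀ x, c ≤ σ x)
    (hκ : ∃ c > (0 : ℝ), ∀ x, c ≤ N * p x / (N - p x) / q x - max (ρ x) (σ x))
    -- (H₂): the weights k, d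
    (k d : EuclideanSpace ℝ (Fin N) → ℝ) (hkmeas : Measurable k) (hdmeas : Measurable d)
    (hkd : ∃ M : ℝ, ∀ y : EuclideanSpace ℝ (Fin N),
      (∫⁻ x in cube y 1, ENNReal.ofReal
        (|k x| ^ (ρ x / (ρ x - 1)) + |d x| ^ (σ x / (σ x - 1)))) ≤ ENNReal.ofReal M)
    -- (H₂): critical growth/coercivity conditions
    (M₁ M₂ M₃ L : ℝ) (hM₁ : 0 < M₁) (hM₂ : 0 < M₂) (hM₃ : 0 < M₃) (hL : 0 < L)
    (hgrowthA : ∀ᵐ x ∂(volume : Measure (EuclideanSpace ℝ (Fin N))),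
      ∀ (t : ℝ) (ξ : EuclideanSpace ℝ (Fin N)),
        ‖𝒜 x t ξ‖ ≤ M₁ * (|k x| + |t| ^ (N * p x / (N - p x) - 1) +
          a x ^ ((N * q x / (N - q x)) / q x) * |t| ^ (N * q x / (N - q x) - 1) +
          ‖ξ‖ ^ (p x - 1) + a x * ‖ξ‖ ^ (q x - 1)))
    (hcoerciveA : ∀ᵐ x ∂(volume : Measure (EuclideanSpace ℝ (Fin N))),
      ∀ (t : ℝ) (ξ : EuclideanSpace ℝ (Fin N)),
        M₂ * (‖ξ‖ ^ p x + a x * ‖ξ‖ ^ q x) -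
          M₃ * (|t| ^ (N * p x / (N - p x)) +
            a x ^ ((N * q x / (N - q x)) / q x) * |t| ^ (N * q x / (N - q x)) + 1) ≤
          @inner ℝ _ _ (𝒜 x t ξ) ξ)
    (hgrowthB : ∀ᵐ x ∂(volume : Measure (EuclideanSpace ℝ (Fin N))),
      ∀ (t : ℝ) (ξ : EuclideanSpace ℝ (Fin N)),
        |ℬ x t ξ| ≤ L * (|d x| + |t| ^ (N * p x / (N - p x) - 1) +
          a x ^ ((N * q x / (N - q x)) / q x) * |t| ^ (N * q x / (N - q x) - 1) +
          ‖ξ‖ ^ (p x / ((N * p x / (N - p x)) / (N * p x / (N - p x) - 1))) +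
          a x ^ ((N + 1) / (N : ℝ)) *
            ‖ξ‖ ^ (q x / ((N * q x / (N - q x)) / (N * q x / (N - q x) - 1)))))
    :
    ∀ u : EuclideanSpace ℝ (Fin N) → ℝ, ContDiff ℝ 1 u →
      -- u ∈ W^{1,H}_V(ℝ^N) : finite modular
      rhoV p q a V u < ⊤ →
      -- u is a weak solution
      (∀ φ : EuclideanSpace ℝ (Fin N) → ℝ, ContDiff ℝ (⊤ : ℕ∞) φ → HasCompactSupport φ →
        (∫ x, @inner ℝ _ _ (𝒜 x (u x) (gradient u x)) (gradient φ x)) +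
          (∫ x, V x * ((|u x| ^ (p x - 2) * u x + a x * |u x| ^ (q x - 2) * u x) * φ x)) =
          ∫ x, ℬ x (u x) (gradient u x) * φ x) →
      -- conclusion: u ∈ L^∞(ℝ^N)
      eLpNorm u ⊤ volume < ⊤ := by
  have hρ1' : ∀ x, 1 < ρ x := fun x => by obtain ⟨c, hc, h⟩ := hρ1; exact hc.trans_le (h x)
  have hσ1' : ∀ x, 1 < σ x := fun x => by obtain ⟨c, hc, h⟩ := hσ1; exact hc.trans_le (h x)
  have hmax : ∀ x, max (ρ x) (σ x) ≤ N * p x / (N - p x) := fun x => by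
    obtain ⟨c, hc, h⟩ := hκ
    have h1 := h x
    have h2 : N * p x / (N - p x) / q x ≤ N * p x / (N - p x) :=
      div_le_self (by linarith [hD.p_lt_pstar x, hD.one_lt_p x]) (hD.one_lt_q x).le
    linarith
  have hρc : Continuous ρ := hρlip.elim fun _ h => h.continuous
  have hσc : Continuous σ := hσlip.elim fun _ h => h.continuous
  obtain ⟨M, hM⟩ := hkd
  have hball := fun y => integrableOn_and_setIntegral_le_of_lintegral_le
    (f := fun x => |k x| ^ (ρ x / (ρ x - 1)) + |d x| ^ (σ x / (σ x - 1)))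
    ((hkmeas.abs.pow (hρc.measurable.div (hρc.measurable.sub_const 1))).add
      (hdmeas.abs.pow (hσc.measurable.div (hσc.measurable.sub_const 1))))
    (fun x => by positivity)
    ((lintegral_mono_set (ball_half_subset_cube y)).trans (hM y))
  have hkd1 : LocallyIntegrable fun x =>
      |k x| ^ (ρ x / (ρ x - 1)) + |d x| ^ (σ x / (σ x - 1)) := fun y =>
    ⟨_, Metric.ball_mem_nhds y one_half_pos, (hball y).1⟩
  have hk : LocallyIntegrable k := .of_abs_rpow_conj hkmeas.aestronglyMeasurable hρ1' <|
    hkd1.mono (hkmeas.abs.pow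
      (hρc.measurable.div (hρc.measurable.sub_const 1))).aestronglyMeasurable <|
      Eventually.of_forall fun x => by
        rw [Real.norm_of_nonneg (by positivity), Real.norm_of_nonneg (by positivity)]
        exact le_add_of_nonneg_right (by positivity)
  have hd : LocallyIntegrable d := .of_abs_rpow_conj hdmeas.aestronglyMeasurable hσ1' <|
    hkd1.mono (hdmeas.abs.pow
      (hσc.measurable.div (hσc.measurable.sub_const 1))).aestronglyMeasurable <|
      Eventually.of_forall fun x => by
        rw [Real.norm_of_nonneg (by positivity), Real.norm_of_nonneg (by positivity)]
        exact le_add_of_nonneg_left (by positivity)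
  have hnk : LocallyIntegrable fun x => |k x| :=
    hk.mono hkmeas.abs.aestronglyMeasurable (Eventually.of_forall fun x => (abs_abs (k x)).le)
  have hnd : LocallyIntegrable fun x => |d x| :=
    hd.mono hdmeas.abs.aestronglyMeasurable (Eventually.of_forall fun x => (abs_abs (d x)).le)
  obtain ⟨c, hc, hVc⟩ := exists_pos_le_of_essInf_pos hVinf
  intro u hu hfin hweak
  have hgr := hu.continuous_gradient
  have hcomp : Measurable fun x => ((u x, gradient u x), x) :=
    (hu.continuous.measurable.prodMk hgr.measurable).prodMk measurable_id
  have hFm : Measurable fun x => 𝒜 x (u x) (gradient u x) :=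
    (measurable_uncurry_of_continuous_of_measurable
      (u := fun (tξ : ℝ × EuclideanSpace ℝ (Fin N)) x => 𝒜 x tξ.1 tξ.2) h𝒜cont
      fun tξ => h𝒜meas tξ.1 tξ.2).comp hcomp
  have hgm : Measurable fun x => ℬ x (u x) (gradient u x) :=
    (measurable_uncurry_of_continuous_of_measurable
      (u := fun (tξ : ℝ × EuclideanSpace ℝ (Fin N)) x => ℬ x tξ.1 tξ.2) hℬcont
      fun tξ => hℬmeas tξ.1 tξ.2).comp hcomp
  have hflux : ∀ᵐ x, ‖𝒜 x (u x) (gradient u x)‖ ≤ M₁ * (|k x| + |u x| ^ (N * p x / (N - p x) - 1) +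
      a x ^ (N / (N - q x)) * |u x| ^ (N * q x / (N - q x) - 1) +
      ‖gradient u x‖ ^ (p x - 1) + a x * ‖gradient u x‖ ^ (q x - 1)) := by
    filter_upwards [hgrowthA] with x hx
    simpa only [hD.qstar_div_q] using hx (u x) (gradient u x)
  have hlower : ∀ᵐ x, |ℬ x (u x) (gradient u x)| ≤
      L * (|d x| + |u x| ^ (N * p x / (N - p x) - 1) +
      a x ^ (N / (N - q x)) * |u x| ^ (N * q x / (N - q x) - 1) +
      ‖gradient u x‖ ^ (p x / ((N * p x / (N - p x)) / (N * p x / (N - p x) - 1))) +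
      a x ^ ((N + 1) / (N : ℝ)) *
        ‖gradient u x‖ ^ (q x / ((N * q x / (N - q x)) / (N * q x / (N - q x) - 1)))) := by
    filter_upwards [hgrowthB] with x hx
    simpa only [hD.qstar_div_q] using hx (u x) (gradient u x)
  have hF : LocallyIntegrable fun x => 𝒜 x (u x) (gradient u x) := by
    refine ((hnk.add (hD.continuous_flux_bound hu.continuous.abs
      hgr.norm).locallyIntegrable).smul M₁).mono hFm.aestronglyMeasurable ?_
    filter_upwards [hflux] with x hx
    refine hx.trans (le_trans (le_of_eq ?_) (le_abs_self _))
    simp only [Pi.smul_apply, Pi.add_apply, smul_eq_mul]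
    ring
  have hg : LocallyIntegrable fun x => ℬ x (u x) (gradient u x) := by
    refine ((hnd.add (hD.continuous_lower_bound hu.continuous.abs
      hgr.norm).locallyIntegrable).smul L).mono hgm.aestronglyMeasurable ?_
    filter_upwards [hlower] with x hx
    refine hx.trans (le_trans (le_of_eq ?_) (le_abs_self _))
    simp only [Pi.smul_apply, Pi.add_apply, smul_eq_mul]
    ring
  have hβ := hD.locallyIntegrable_potential hVloc hu.continuous
  have hsol : IsCriticalSolution p q a ρ σ k d M₁ M₂ M₃ L
      (fun x => 𝒜 x (u x) (gradient u x)) (fun x => ℬ x (u x) (gradient u x))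
      (fun x => V x * (|u x| ^ (p x - 2) * u x + a x * |u x| ^ (q x - 2) * u x)) u := by
    refine ⟨hu, hF, hβ.sub hg, ?_, hflux, hlower, ?_, fun φ hφ hφc => ?_⟩
    · filter_upwards [hcoerciveA] with x hx
      simpa only [hD.qstar_div_q, Hfun, critFun] using hx (u x) (gradient u x)
    · filter_upwards [hVc] with x hx
      have h1 := hD.a_nonneg x
      have h2 : 0 ≤ |u x| ^ (p x - 2) := by positivity
      have h3 : 0 ≤ |u x| ^ (q x - 2) := by positivity
      have h4 : V x * (|u x| ^ (p x - 2) * u x + a x * |u x| ^ (q x - 2) * u x) * u x =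
          V x * ((|u x| ^ (p x - 2) + a x * |u x| ^ (q x - 2)) * u x ^ 2) := by ring
      rw [h4]
      exact mul_nonneg (hc.le.trans hx) (by positivity)
    · have h1 := hβ.integrable_smul_right_of_hasCompactSupport hφ.continuous hφc
      have h2 := hg.integrable_smul_right_of_hasCompactSupport hφ.continuous hφc
      simp only [smul_eq_mul] at h1 h2
      have h3 := hweak φ hφ hφc
      simp only [← mul_assoc] at h3
      simp only [sub_mul]
      rw [integral_sub h1 h2, ← h3]
      ring
  have hint := hD.integrable_Hfun_of_rhoV_lt_top hc hVc hu hfin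
  obtain ⟨R₁, hR₁⟩ := hD.exists_forall_norm_gt_le_two hρ1' hσ1'
    (fun x => (le_max_left _ _).trans (hmax x)) (fun x => (le_max_right _ _).trans (hmax x)) hκ
    hM₁ hM₂ hM₃ hL (fun y => (hball y).1) (fun y => (hball y).2) hsol hint
  obtain ⟨R₂, hR₂⟩ := hD.exists_forall_norm_gt_le_two hρ1' hσ1'
    (fun x => (le_max_left _ _).trans (hmax x)) (fun x => (le_max_right _ _).trans (hmax x)) hκ
    hM₁ hM₂ hM₃ hL (fun y => (hball y).1) (fun y => (hball y).2) hsol.neg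
    (by simpa only [gradient_neg_eq, norm_neg, abs_neg] using hint)
  obtain ⟨C, hC⟩ := (isCompact_closedBall (0 : EuclideanSpace ℝ (Fin N))
    (max R₁ R₂)).exists_bound_of_continuousOn hu.continuous.continuousOn
  refine (memLp_top_of_bound hu.continuous.aestronglyMeasurable (max C 2)
    (Eventually.of_forall fun x => ?_)).2
  by_cases hx : x ∈ Metric.closedBall (0 : EuclideanSpace ℝ (Fin N)) (max R₁ R₂)
  · exact (hC x hx).trans (le_max_left _ _)
  · rw [mem_closedBall_zero_iff, not_le, max_lt_iff] at hx
    exact (abs_le'.2 ⟨hR₁ x hx.1, hR₂ x hx.2⟩).trans (le_max_right _ _)
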